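/- arXiv:1309.0379 — 10 statements merged into one kernel-verified Lean document; each statement's English description precedes it below -/
import Mathlib

section
/- Let f : ℝ → ℝ be a Lipschitz KPP-type nonlinearity and Φ : ℝ → ℝ a diffusion potential as in the context. Then the travelling-wave problem d/dx[φ(q'(x))] + c q'(x) + f(q(x)) = 0 on ℝ, q' ≤ 0, lim_{x→−∞} q(x) = 1, lim_{x→+∞} q(x) = −1, q(0) = μ, admits a unique solution pair [q, c] (a C¹ profile q and a speed c ∈ ℝ). Moreover this solution satisfies: q' ∈ L¹(ℝ) ∩ L^∞(ℝ); q'(x) < 0 at every x with −1 < q(x) < 1; and c = (∫_{−∞}^{∞} |q'|² dx)^{−1} ∫_{−1}^{1} f(s) ds ≥ 0. In particular c > 0 if and only if F(1) = ∫_{−1}^{1} f(s) ds > 0. -/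
open MeasureTheory Set Filter

/-- `q` (with speed `c`) is a travelling-wave profile for the 1-D equation
`d/dx [φ(q')] + c q' + f(q) = 0` with `q' ≤ 0`, `q(-∞) = 1`, `q(+∞) = -1`,
normalized by `q 0 = μ`.  Here `φ = Φ'` is the derivative of the diffusion
potential. -/
def IsTW (φ f : ℝ → ℝ) (μ : ℝ) (q : ℝ → ℝ) (c : ℝ) : Prop :=
  ContDiff ℝ 1 q ∧
  (∀ x : ℝ, HasDerivAt (fun y => φ (deriv q y)) (-(c * deriv q x + f (q x))) x) ∧
  (∀ x : ℝ, deriv q x ≤ 0) ∧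
  Tendsto q atBot (nhds 1) ∧
  Tendsto q atTop (nhds (-1)) ∧
  q 0 = μ

/-- The phase-plane coordinates attached to the diffusion flux `φ`: `Θ` is the Legendre-type
energy of the flux, `V` is its inverse, and `P` recovers the slope from the energy. -/
structure PhaseCoordinates (φ Θ V P : ℝ → ℝ) : Prop where
  hasDerivAt_energy : ∀ p, 0 ≤ p → HasDerivAt Θ p (φ p)
  energy_zero : Θ 0 = 0
  inv_continuous : Continuous V
  inv_strictMono : StrictMono V
  inv_zero : V 0 = 0
  slope_continuous : Continuous P
  slope_mono : Monotone P
  slope_of_nonpos : ∀ y, y ≤ 0 → P y = 0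
  slope_pos : ∀ y, 0 < y → 0 < P y
  flux_slope : ∀ y, 0 ≤ y → φ (P y) = V y
  slope_energy : ∀ p, 0 ≤ p → P (Θ (φ p)) = p
  hasDerivAt_inv : ∀ y, 0 < y → HasDerivAt V (P y)⁻¹ y
  slope_growth : ∃ A, 0 ≤ A ∧ ∀ y, 0 ≤ y → P y ≤ A * (1 + y)
  slope_lipschitz : ∀ ε, 0 < ε → ∃ L, 0 ≤ L ∧ ∀ x y, ε ≤ x → x ≤ y → P y - P x ≤ L * (y - x)

theorem PhaseCoordinates.slope_nonneg {φ Θ V P : ℝ → ℝ} (h : PhaseCoordinates φ Θ V P) (y : ℝ) :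
    0 ≤ P y := by
  rcases le_or_gt y 0 with hy | hy
  · exact (h.slope_of_nonpos y hy).ge
  · exact (h.slope_pos y hy).le

theorem exists_phaseCoordinates (φ : ℝ → ℝ) (Λ₁ : ℝ) (hΛ₁ : 0 < Λ₁)
    (hφcont : Continuous φ) (hφodd : ∀ s, φ (-s) = - φ s) (hφmono : StrictMono φ)
    (hφtop : Tendsto φ atTop atTop) (hφbot : Tendsto φ atBot atBot)
    (hφdiff : ∀ z : ℝ, 0 < z → DifferentiableAt ℝ φ z)
    (hΛ : ∀ z : ℝ, 0 < z → Λ₁ * φ z ≤ z * deriv φ z) :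
    ∃ Θ V P : ℝ → ℝ, PhaseCoordinates φ Θ V P := by
  have hφ0 : φ 0 = 0 := by
    have := hφodd 0
    rw [neg_zero] at this
    linarith
  have hsurj : Function.Surjective φ := hφcont.surjective hφtop hφbot
  set eφ : ℝ ≃o ℝ := hφmono.orderIsoOfSurjective φ hsurj with heφ
  set ψ : ℝ → ℝ := fun w => eφ.symm w with hψ
  have hφψ : ∀ w, φ (ψ w) = w := fun w => eφ.apply_symm_apply w
  have hψφ : ∀ p, ψ (φ p) = p := fun p => eφ.symm_apply_apply p
  have hψcont : Continuous ψ := eφ.symm.continuous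
  have hψmono : StrictMono ψ := eφ.symm.strictMono
  have hψ0 : ψ 0 = 0 := by
    have := hψφ 0
    rwa [hφ0] at this
  have hψodd : ∀ w, ψ (-w) = -ψ w := fun w =>
    hφmono.injective (by rw [hφψ, hφodd, hφψ])
  have habs : Continuous fun t => |ψ t| := hψcont.abs
  set Θ : ℝ → ℝ := fun w => ∫ t in (0:ℝ)..w, |ψ t| with hΘ
  have hΘd : ∀ w, HasDerivAt Θ |ψ w| w := fun w =>
    (habs.integral_hasStrictDerivAt 0 w).hasDerivAt
  have hΘc : Continuous Θ := continuous_iff_continuousAt.2 fun w => (hΘd w).continuousAt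
  have hΘ0 : Θ 0 = 0 := by simp [hΘ]
  have hΘodd : ∀ w, Θ (-w) = -Θ w := by
    intro w
    have h := intervalIntegral.integral_comp_neg (a := 0) (b := w) (fun t => |ψ t|)
    simp only [hψodd, abs_neg, neg_zero] at h
    simp only [hΘ]
    rw [h]
    exact intervalIntegral.integral_symm _ _
  have hΘmono : StrictMono Θ := by
    intro a b hab
    have hpos : 0 < ∫ t in a..b, |ψ t| := by
      apply intervalIntegral.integral_pos hab habs.continuousOn (fun t _ => abs_nonneg _)
      by_cases ha : a = 0
      · exact ⟨b, right_mem_Icc.2 hab.le, abs_pos.2 (by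
          rw [← hψ0]; exact hψmono.injective.ne (by linarith [ha ▸ hab] : b ≠ 0))⟩
      · exact ⟨a, left_mem_Icc.2 hab.le, abs_pos.2 (by
          rw [← hψ0]; exact hψmono.injective.ne ha)⟩
    have := intervalIntegral.integral_add_adjacent_intervals
      (habs.intervalIntegrable (μ := volume) 0 a) (habs.intervalIntegrable a b)
    change (∫ t in (0:ℝ)..a, |ψ t|) < ∫ t in (0:ℝ)..b, |ψ t|
    linarith
  have hψ1 : 0 < ψ 1 := by
    rw [← hψ0]; exact hψmono one_pos
  have hΘtop : Tendsto Θ atTop atTop := by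
    have hlin : Tendsto (fun w : ℝ => ψ 1 * (w - 1)) atTop atTop :=
      (tendsto_atTop_add_const_right atTop (-1) tendsto_id).const_mul_atTop hψ1
    refine tendsto_atTop_mono' atTop ?_ hlin
    filter_upwards [eventually_ge_atTop (1:ℝ)] with w hw
    have h := (convex_Ici (1:ℝ)).mul_sub_le_image_sub_of_le_deriv hΘc.continuousOn
      (fun x _ => (hΘd x).differentiableAt.differentiableWithinAt) (C := ψ 1) (by
        intro x hx
        rw [interior_Ici] at hx
        rw [(hΘd x).deriv]
        exact (hψmono hx).le.trans (le_abs_self _)) 1 (mem_Ici.2 le_rfl) w hw hw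
    have h1 : 0 ≤ Θ 1 := hΘ0 ▸ hΘmono.monotone zero_le_one
    linarith
  have hΘbot : Tendsto Θ atBot atBot := by
    have : Θ = fun w => -Θ (-w) := by
      ext w; rw [hΘodd, neg_neg]
    rw [this]
    exact tendsto_neg_atTop_atBot.comp (hΘtop.comp tendsto_neg_atBot_atTop)
  set eΘ : ℝ ≃o ℝ := hΘmono.orderIsoOfSurjective Θ (hΘc.surjective hΘtop hΘbot) with heΘ
  set V : ℝ → ℝ := fun y => eΘ.symm y with hV
  have hΘV : ∀ y, Θ (V y) = y := fun y => eΘ.apply_symm_apply y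
  have hVΘ : ∀ w, V (Θ w) = w := fun w => eΘ.symm_apply_apply w
  have hVcont : Continuous V := eΘ.symm.continuous
  have hVmono : StrictMono V := eΘ.symm.strictMono
  have hV0 : V 0 = 0 := by
    have := hVΘ 0
    rwa [hΘ0] at this
  set P : ℝ → ℝ := fun y => max 0 (ψ (V y)) with hP
  have hPnn : ∀ y, 0 ≤ y → P y = ψ (V y) := fun y hy => max_eq_right (by
    rw [← hψ0, ← hV0]; exact hψmono.monotone (hVmono.monotone hy))
  have hPpos : ∀ y, 0 < y → 0 < P y := fun y hy => by
    rw [hPnn y hy.le, ← hψ0, ← hV0]; exact hψmono (hVmono hy)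
  have hPmono : Monotone P := fun a b hab =>
    max_le_max le_rfl (hψmono.monotone (hVmono.monotone hab))
  have hφP : ∀ y, 0 ≤ y → φ (P y) = V y := fun y hy => by rw [hPnn y hy, hφψ]
  have hΘp : ∀ p, 0 ≤ p → HasDerivAt Θ p (φ p) := by
    intro p hp
    have := hΘd (φ p)
    rwa [hψφ, abs_of_nonneg hp] at this
  have hLip : ∀ ε, 0 < ε → ∀ x y, ε ≤ x → x ≤ y →
      P y - P x ≤ (Λ₁ * φ (P ε))⁻¹ * (y - x) := by
    intro ε hε x y hx hxy
    have hPε := hPpos ε hε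
    have hκ : 0 < Λ₁ * φ (P ε) := mul_pos hΛ₁ (hφ0 ▸ hφmono hPε)
    have hd : ∀ p, 0 < p → HasDerivAt (fun p => Θ (φ p)) (p * deriv φ p) p := fun p hp =>
      (hΘp p hp.le).comp p (hφdiff p hp).hasDerivAt
    have h := (convex_Ici (P ε)).mul_sub_le_image_sub_of_le_deriv (f := fun p => Θ (φ p))
      (hΘc.comp hφcont).continuousOn
      (fun p hp => by
        rw [interior_Ici] at hp
        exact (hd p (hPε.trans hp)).differentiableAt.differentiableWithinAt)
      (C := Λ₁ * φ (P ε)) (by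
        intro p hp
        rw [interior_Ici] at hp
        have hp0 : 0 < p := hPε.trans hp
        rw [(hd p hp0).deriv]
        exact (mul_le_mul_of_nonneg_left (hφmono hp).le hΛ₁.le).trans (hΛ p hp0))
      (P x) (hPmono hx) (P y) (hPmono (hx.trans hxy)) (hPmono hxy)
    simp only [hφP x (hε.le.trans hx), hφP y (hε.le.trans (hx.trans hxy)), hΘV] at h
    rw [inv_mul_eq_div, le_div_iff₀ hκ]
    linarith
  have hκ : ∀ ε, 0 < ε → 0 ≤ (Λ₁ * φ (P ε))⁻¹ := fun ε hε =>
    inv_nonneg.2 (mul_nonneg hΛ₁.le (hφ0 ▸ hφmono.monotone (hPpos ε hε).le))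
  refine ⟨Θ, V, P, hΘp, hΘ0, hVcont, hVmono, hV0,
    continuous_const.max (hψcont.comp hVcont), hPmono, ?_, hPpos, hφP, ?_, ?_, ?_, ?_⟩
  · intro y hy
    refine max_eq_left ?_
    rw [← hψ0, ← hV0]; exact hψmono.monotone (hVmono.monotone hy)
  · intro p hp
    have : ψ (V (Θ (φ p))) = p := by rw [hVΘ, hψφ]
    simp only [hP]
    rw [this, max_eq_right hp]
  · intro y hy
    have h := hΘd (V y)
    rw [← hPnn y hy.le, abs_of_pos (hPpos y hy)] at h
    exact HasDerivAt.of_local_left_inverse hVcont.continuousAt h (hPpos y hy).ne'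
      (Eventually.of_forall hΘV)
  · set k := (Λ₁ * φ (P 1))⁻¹ with hk
    have hk0 : 0 ≤ k := hκ 1 one_pos
    have hP1 := hPpos 1 one_pos
    refine ⟨P 1 + k, by positivity, fun y hy => ?_⟩
    rcases le_total y 1 with h1 | h1
    · have := hPmono h1
      nlinarith [mul_nonneg (add_nonneg hP1.le hk0) hy]
    · have := hLip 1 one_pos 1 y le_rfl h1
      nlinarith [mul_nonneg hP1.le hy]
  · exact fun ε hε => ⟨_, hκ ε hε, hLip ε hε⟩

/-- A function that starts at `0` and cannot increase while it is positive stays nonpositive. -/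
theorem nonpos_of_deriv_nonpos_of_pos {a b : ℝ} {g g' : ℝ → ℝ}
    (hd : ∀ r ∈ Ioo a b, HasDerivAt g (g' r) r) (h0 : Tendsto g (nhdsWithin a (Ioi a)) (nhds 0))
    (hg' : ∀ r ∈ Ioo a b, 0 < g r → g' r ≤ 0) : ∀ r ∈ Ioo a b, g r ≤ 0 := by
  intro r hr
  by_contra! hpos
  have hev : ∀ᶠ s in nhdsWithin a (Ioi a), g s < g r ∧ s < r :=
    (h0.eventually_lt_const hpos).and
      (mem_nhdsWithin_of_mem_nhds (Iio_mem_nhds hr.1))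
  obtain ⟨s, ⟨hs, hsr⟩, hsa⟩ := (hev.and self_mem_nhdsWithin).exists
  obtain ⟨t, ht, htmax⟩ : ∃ t ∈ Icc s r, g t ≤ max 0 (g s) ∧ ∀ u ∈ Ioc t r, max 0 (g s) < g u := by
    have hc : ContinuousOn g (Icc s r) := fun u hu =>
      (hd u ⟨hsa.trans_le hu.1, hu.2.trans_lt hr.2⟩).continuousAt.continuousWithinAt
    have hclosed : IsCompact (Icc s r ∩ g ⁻¹' Iic (max 0 (g s))) :=
      isCompact_Icc.of_isClosed_subset
        (hc.preimage_isClosed_of_isClosed isClosed_Icc isClosed_Iic) inter_subset_left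
    obtain ⟨t, ⟨ht, htv⟩, hmax⟩ := hclosed.exists_isGreatest
      ⟨s, left_mem_Icc.2 hsr.le, mem_preimage.2 (mem_Iic.2 (le_max_right _ _))⟩
    refine ⟨t, ht, htv, fun u hu => ?_⟩
    by_contra! hu'
    exact absurd (hmax ⟨⟨ht.1.trans hu.1.le, hu.2⟩, hu'⟩) (not_le.2 hu.1)
  have htr : t < r := by
    rcases ht.2.lt_or_eq with h | h
    · exact h
    · exact absurd (h ▸ htmax.1) (not_le.2 (max_lt hpos hs))
  have hanti : AntitoneOn g (Icc t r) := by
    refine antitoneOn_of_deriv_nonpos (convex_Icc t r) (fun u hu =>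
      (hd u ⟨hsa.trans_le (ht.1.trans hu.1), hu.2.trans_lt hr.2⟩).continuousAt.continuousWithinAt)
      (fun u hu => ?_) (fun u hu => ?_)
    all_goals
      rw [interior_Icc] at hu
      have hd' := hd u ⟨hsa.trans_le (ht.1.trans hu.1.le), hu.2.trans hr.2⟩
    · exact hd'.differentiableAt.differentiableWithinAt
    · rw [hd'.deriv]
      exact hg' u ⟨hsa.trans_le (ht.1.trans hu.1.le), hu.2.trans hr.2⟩
        ((le_max_left _ _).trans_lt (htmax.2 u ⟨hu.1, hu.2.le⟩))
  have := hanti (left_mem_Icc.2 htr.le) (right_mem_Icc.2 htr.le) htr.le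
  exact absurd (this.trans htmax.1) (not_le.2 (max_lt hpos hs))

/-- Comparison of positive phase-plane trajectories leaving a zero, where the reaction is
nonpositive. -/
theorem PhaseCoordinates.trajectory_le {φ Θ V P : ℝ → ℝ} (hP : PhaseCoordinates φ Θ V P)
    {a b c₁ c₂ : ℝ} {f Y₁ Y₂ : ℝ → ℝ} (hc : c₁ ≤ c₂) (hf : ∀ r ∈ Ioo a b, f r ≤ 0)
    (hpos₁ : ∀ r ∈ Ioo a b, 0 < Y₁ r) (hpos₂ : ∀ r ∈ Ioo a b, 0 < Y₂ r)
    (hd₁ : ∀ r ∈ Ioo a b, HasDerivAt Y₁ (c₁ * P (Y₁ r) - f r) r)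
    (hd₂ : ∀ r ∈ Ioo a b, HasDerivAt Y₂ (c₂ * P (Y₂ r) - f r) r)
    (h₁ : Tendsto Y₁ (nhdsWithin a (Ioi a)) (nhds 0))
    (h₂ : Tendsto Y₂ (nhdsWithin a (Ioi a)) (nhds 0)) :
    ∀ r ∈ Ioo a b, Y₁ r ≤ Y₂ r := by
  have hV : ∀ {Y : ℝ → ℝ}, Tendsto Y (nhdsWithin a (Ioi a)) (nhds 0) →
      Tendsto (fun r => V (Y r)) (nhdsWithin a (Ioi a)) (nhds 0) := fun h => by
    have := (hP.inv_continuous.tendsto 0).comp h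
    rwa [hP.inv_zero] at this
  have h := nonpos_of_deriv_nonpos_of_pos (a := a) (b := b) (g := fun r => V (Y₁ r) - V (Y₂ r))
    (g' := fun r => (P (Y₁ r))⁻¹ * (c₁ * P (Y₁ r) - f r) - (P (Y₂ r))⁻¹ * (c₂ * P (Y₂ r) - f r))
    (fun r hr => ((hP.hasDerivAt_inv _ (hpos₁ r hr)).comp r (hd₁ r hr)).sub
      ((hP.hasDerivAt_inv _ (hpos₂ r hr)).comp r (hd₂ r hr)))
    (by simpa using (hV h₁).sub (hV h₂)) (by
      intro r hr hgt
      have hle : Y₂ r ≤ Y₁ r := (hP.inv_strictMono.lt_iff_lt.1 (sub_pos.1 hgt)).le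
      have p₁ := hP.slope_pos _ (hpos₁ r hr)
      have p₂ := hP.slope_pos _ (hpos₂ r hr)
      have hinv : (P (Y₁ r))⁻¹ ≤ (P (Y₂ r))⁻¹ := inv_anti₀ p₂ (hP.slope_mono hle)
      have e₁ : (P (Y₁ r))⁻¹ * (c₁ * P (Y₁ r) - f r) = c₁ - f r * (P (Y₁ r))⁻¹ := by
        field_simp
      have e₂ : (P (Y₂ r))⁻¹ * (c₂ * P (Y₂ r) - f r) = c₂ - f r * (P (Y₂ r))⁻¹ := by
        field_simp
      change (P (Y₁ r))⁻¹ * (c₁ * P (Y₁ r) - f r) - (P (Y₂ r))⁻¹ * (c₂ * P (Y₂ r) - f r) ≤ 0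
      rw [e₁, e₂]
      nlinarith [mul_nonneg (neg_nonneg.2 (hf r hr)) (sub_nonneg.2 hinv)])
  intro r hr
  exact hP.inv_strictMono.le_iff_le.1 (sub_nonpos.1 (h r hr))

/-- Comparison of positive phase-plane trajectories entering a zero, where the reaction is
nonnegative. -/
theorem PhaseCoordinates.trajectory_ge {φ Θ V P : ℝ → ℝ} (hP : PhaseCoordinates φ Θ V P)
    {a b c₁ c₂ : ℝ} {f Y₁ Y₂ : ℝ → ℝ} (hc : c₁ ≤ c₂) (hf : ∀ r ∈ Ioo a b, 0 ≤ f r)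
    (hpos₁ : ∀ r ∈ Ioo a b, 0 < Y₁ r) (hpos₂ : ∀ r ∈ Ioo a b, 0 < Y₂ r)
    (hd₁ : ∀ r ∈ Ioo a b, HasDerivAt Y₁ (c₁ * P (Y₁ r) - f r) r)
    (hd₂ : ∀ r ∈ Ioo a b, HasDerivAt Y₂ (c₂ * P (Y₂ r) - f r) r)
    (h₁ : Tendsto Y₁ (nhdsWithin b (Iio b)) (nhds 0))
    (h₂ : Tendsto Y₂ (nhdsWithin b (Iio b)) (nhds 0)) :
    ∀ r ∈ Ioo a b, Y₂ r ≤ Y₁ r := by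
  have hmem : ∀ r ∈ Ioo (-b) (-a), -r ∈ Ioo a b := fun r hr =>
    ⟨by linarith [hr.2], by linarith [hr.1]⟩
  have hderiv : ∀ {c : ℝ} {Y : ℝ → ℝ},
      (∀ r ∈ Ioo a b, HasDerivAt Y (c * P (Y r) - f r) r) →
      ∀ r ∈ Ioo (-b) (-a),
        HasDerivAt (fun s => Y (-s)) (-c * P (Y (-r)) - -f (-r)) r := by
    intro c Y h r hr
    refine ((h (-r) (hmem r hr)).comp r (hasDerivAt_neg r)).congr_deriv ?_
    ring
  have hlim : ∀ {Y : ℝ → ℝ}, Tendsto Y (nhdsWithin b (Iio b)) (nhds 0) →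
      Tendsto (fun s => Y (-s)) (nhdsWithin (-b) (Ioi (-b))) (nhds 0) := fun h => by
    refine h.comp ?_
    have := tendsto_neg_nhdsGT (a := -b)
    rwa [neg_neg] at this
  have h := hP.trajectory_le (a := -b) (b := -a) (c₁ := -c₂) (c₂ := -c₁) (f := fun s => -f (-s))
    (Y₁ := fun s => Y₂ (-s)) (Y₂ := fun s => Y₁ (-s)) (neg_le_neg hc)
    (fun r hr => neg_nonpos.2 (hf _ (hmem r hr))) (fun r hr => hpos₂ _ (hmem r hr))
    (fun r hr => hpos₁ _ (hmem r hr)) (hderiv hd₂) (hderiv hd₁) (hlim h₂) (hlim h₁)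
  intro r hr
  simpa using h (-r) ⟨neg_lt_neg hr.2, neg_lt_neg hr.1⟩

/-- A balanced or unbalanced bistable reaction with stable zeros `-1`, `1`, unstable zero `μ`,
and strictly dominant potential well at `1`. -/
structure IsBistable (f : ℝ → ℝ) (μ : ℝ) : Prop where
  mid_mem : μ ∈ Ioo (-1:ℝ) 1
  continuous : Continuous f
  neg_one : f (-1) = 0
  one : f 1 = 0
  neg : ∀ s ∈ Ioo (-1:ℝ) μ, f s < 0
  pos : ∀ s ∈ Ioo μ (1:ℝ), 0 < f s
  potential : ∀ r ∈ Ioo (-1:ℝ) 1, 0 < ∫ s in r..(1:ℝ), f s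

section Potential

variable {f : ℝ → ℝ} {μ : ℝ} (hf : IsBistable f μ)
include hf

theorem IsBistable.hasDerivAt_potential (r : ℝ) :
    HasDerivAt (fun r => ∫ s in (-1:ℝ)..r, f s) (f r) r :=
  (hf.continuous.integral_hasStrictDerivAt (-1) r).hasDerivAt

theorem IsBistable.continuous_potential : Continuous fun r => ∫ s in (-1:ℝ)..r, f s :=
  continuous_iff_continuousAt.2 fun r => (hf.hasDerivAt_potential r).continuousAt

theorem IsBistable.potential_lt {r : ℝ} (hr : r ∈ Ioo (-1:ℝ) 1) :
    ∫ s in (-1:ℝ)..r, f s < ∫ s in (-1:ℝ)..1, f s := by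
  have := intervalIntegral.integral_add_adjacent_intervals
    (hf.continuous.intervalIntegrable (μ := volume) (-1) r) (hf.continuous.intervalIntegrable r 1)
  linarith [hf.potential r hr]

theorem IsBistable.potential_one_nonneg : 0 ≤ ∫ s in (-1:ℝ)..1, f s := by
  have h : Tendsto (fun r => ∫ s in (-1:ℝ)..r, f s) (nhdsWithin (-1) (Ioi (-1))) (nhds 0) := by
    have := hf.continuous_potential.tendsto (-1)
    rw [intervalIntegral.integral_same] at this
    exact this.mono_left nhdsWithin_le_nhds
  refine le_of_tendsto h ?_
  filter_upwards [Ioo_mem_nhdsGT (show (-1:ℝ) < 1 by norm_num)] with r hr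
  exact (hf.potential_lt hr).le

theorem IsBistable.potential_neg {r : ℝ} (hr : r ∈ Ioc (-1:ℝ) μ) :
    ∫ s in (-1:ℝ)..r, f s < 0 := by
  have h := intervalIntegral.intervalIntegral_pos_of_pos_on (f := fun s => -f s)
    (hf.continuous.neg.intervalIntegrable (-1) r)
    (fun s hs => neg_pos.2 (hf.neg s ⟨hs.1, hs.2.trans_le hr.2⟩)) hr.1
  rw [intervalIntegral.integral_neg] at h
  linarith

end Potential

theorem exists_seq_deriv_tendsto_zero_atTop {q : ℝ → ℝ} {l : ℝ} (hq : Differentiable ℝ q)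
    (hl : Tendsto q atTop (nhds l)) :
    ∃ x : ℕ → ℝ, Tendsto x atTop atTop ∧ Tendsto (fun n => deriv q (x n)) atTop (nhds 0) := by
  have h : ∀ n : ℕ, ∃ x ∈ Ioo (n:ℝ) (n + 1), deriv q x = q (n + 1) - q n := fun n => by
    obtain ⟨x, hx, hx'⟩ := exists_deriv_eq_slope q (lt_add_one (n:ℝ)) hq.continuous.continuousOn
      hq.differentiableOn
    exact ⟨x, hx, by simpa using hx'⟩
  choose x hx hx' using h
  refine ⟨x, tendsto_atTop_mono (fun n => (hx n).1.le) tendsto_natCast_atTop_atTop, ?_⟩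
  simp only [hx']
  have h1 : Tendsto (fun n : ℕ => (n:ℝ) + 1) atTop atTop :=
    tendsto_atTop_add_const_right _ _ tendsto_natCast_atTop_atTop
  simpa using (hl.comp h1).sub (hl.comp tendsto_natCast_atTop_atTop)

theorem exists_seq_deriv_tendsto_zero_atBot {q : ℝ → ℝ} {l : ℝ} (hq : Differentiable ℝ q)
    (hl : Tendsto q atBot (nhds l)) :
    ∃ x : ℕ → ℝ, Tendsto x atTop atBot ∧ Tendsto (fun n => deriv q (x n)) atTop (nhds 0) := by
  obtain ⟨x, hx, hx'⟩ := exists_seq_deriv_tendsto_zero_atTop (q := fun x => q (-x))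
    (hq.comp differentiable_neg) (hl.comp tendsto_neg_atTop_atBot)
  refine ⟨fun n => -x n, tendsto_neg_atTop_atBot.comp hx, ?_⟩
  simp only [deriv_comp_neg] at hx'
  simpa using hx'.neg

section Wave

variable {φ f q : ℝ → ℝ} {μ c : ℝ}

theorem IsTW.antitone (h : IsTW φ f μ q c) : Antitone q :=
  antitone_of_deriv_nonpos (h.1.differentiable one_ne_zero) h.2.2.1

theorem IsTW.mem_Icc (h : IsTW φ f μ q c) (x : ℝ) : q x ∈ Icc (-1:ℝ) 1 :=
  ⟨h.antitone.le_of_tendsto h.2.2.2.2.1 x, h.antitone.ge_of_tendsto h.2.2.2.1 x⟩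

theorem IsTW.exists_eq (h : IsTW φ f μ q c) {r : ℝ} (hr : r ∈ Ioo (-1:ℝ) 1) : ∃ x, q x = r :=
  mem_range_of_exists_le_of_exists_ge h.1.continuous
    (h.2.2.2.2.1.eventually_le_const hr.1).exists (h.2.2.2.1.eventually_const_le hr.2).exists

end Wave

section Energy

variable {φ Θ V P f q : ℝ → ℝ} {μ c : ℝ}

/-- The energy of a travelling wave at a point. -/
noncomputable def waveEnergy (φ Θ f q : ℝ → ℝ) (x : ℝ) : ℝ :=
  Θ (φ (-deriv q x)) + ∫ s in (-1:ℝ)..q x, f s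

variable (hP : PhaseCoordinates φ Θ V P) (hφcont : Continuous φ) (hφodd : ∀ s, φ (-s) = -φ s)
  (hφmono : StrictMono φ) (hf : IsBistable f μ) (h : IsTW φ f μ q c)

include hP hφodd h in
theorem IsTW.hasDerivAt_energy_slope (x : ℝ) :
    HasDerivAt (fun y => Θ (φ (-deriv q y)))
      (-deriv q x * (c * deriv q x + f (q x))) x := by
  have hw : HasDerivAt (fun y => φ (-deriv q y)) (c * deriv q x + f (q x)) x := by
    simp only [hφodd]
    exact (h.2.1 x).neg.congr_deriv (neg_neg _)
  exact (hP.hasDerivAt_energy _ (neg_nonneg.2 (h.2.2.1 x))).comp x hw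

include hP hφodd hf h in
theorem IsTW.hasDerivAt_waveEnergy (x : ℝ) :
    HasDerivAt (waveEnergy φ Θ f q) (-c * deriv q x ^ 2) x := by
  have h2 := (hf.hasDerivAt_potential (q x)).comp x
    (h.1.differentiable one_ne_zero x).hasDerivAt
  exact ((h.hasDerivAt_energy_slope hP hφodd x).add h2).congr_deriv (by ring)

theorem PhaseCoordinates.continuousAt_energy_zero (hP : PhaseCoordinates φ Θ V P)
    (hφcont : Continuous φ) (hφodd : ∀ s, φ (-s) = -φ s) {u : ℕ → ℝ}
    (hu : Tendsto u atTop (nhds 0)) : Tendsto (fun n => Θ (φ (-u n))) atTop (nhds 0) := by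
  have hφ0 : φ 0 = 0 := by
    have := hφodd 0
    rw [neg_zero] at this
    linarith
  have h1 : Tendsto (fun n => φ (-u n)) atTop (nhds (φ 0)) :=
    (hφcont.tendsto 0).comp (by simpa using hu.neg)
  have h2 := (hP.hasDerivAt_energy 0 le_rfl).continuousAt.tendsto.comp h1
  rwa [hφ0, hP.energy_zero] at h2

include hP hφcont hφodd hf h in
theorem IsTW.exists_seq_waveEnergy_atTop :
    ∃ x : ℕ → ℝ, Tendsto x atTop atTop ∧
      Tendsto (fun n => waveEnergy φ Θ f q (x n)) atTop (nhds 0) := by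
  obtain ⟨x, hx, hx'⟩ :=
    exists_seq_deriv_tendsto_zero_atTop (h.1.differentiable one_ne_zero) h.2.2.2.2.1
  refine ⟨x, hx, ?_⟩
  have h1 := hP.continuousAt_energy_zero hφcont hφodd hx'
  have h2 := (hf.continuous_potential.tendsto (-1)).comp (h.2.2.2.2.1.comp hx)
  simpa [waveEnergy] using h1.add h2

include hP hφcont hφodd hf h in
theorem IsTW.exists_seq_waveEnergy_atBot :
    ∃ x : ℕ → ℝ, Tendsto x atTop atBot ∧
      Tendsto (fun n => waveEnergy φ Θ f q (x n)) atTop (nhds (∫ s in (-1:ℝ)..1, f s)) := by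
  obtain ⟨x, hx, hx'⟩ :=
    exists_seq_deriv_tendsto_zero_atBot (h.1.differentiable one_ne_zero) h.2.2.2.1
  refine ⟨x, hx, ?_⟩
  have h1 := hP.continuousAt_energy_zero hφcont hφodd hx'
  have h2 := (hf.continuous_potential.tendsto 1).comp (h.2.2.2.1.comp hx)
  simpa [waveEnergy] using h1.add h2

include hP hφcont hφodd hf h in
theorem IsTW.speed_nonneg : 0 ≤ c := by
  by_contra! hc
  have hmono : Monotone (waveEnergy φ Θ f q) :=
    monotone_of_deriv_nonneg (fun x => (h.hasDerivAt_waveEnergy hP hφodd hf x).differentiableAt)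
      fun x => by
        rw [(h.hasDerivAt_waveEnergy hP hφodd hf x).deriv]
        exact mul_nonneg (neg_nonneg.2 hc.le) (sq_nonneg _)
  obtain ⟨a, ha, ha'⟩ := h.exists_seq_waveEnergy_atTop hP hφcont hφodd hf
  obtain ⟨b, hb, hb'⟩ := h.exists_seq_waveEnergy_atBot hP hφcont hφodd hf
  have hE : waveEnergy φ Θ f q = fun _ => 0 := by
    ext x
    have h1 : waveEnergy φ Θ f q x ≤ 0 := ge_of_tendsto ha' <| by
      filter_upwards [ha.eventually_ge_atTop x] with n hn using hmono hn
    have h2 : ∫ s in (-1:ℝ)..1, f s ≤ waveEnergy φ Θ f q x := le_of_tendsto hb' <| by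
      filter_upwards [hb.eventually_le_atBot x] with n hn using hmono hn
    exact le_antisymm h1 (hf.potential_one_nonneg.trans h2)
  have hq0 : ∀ x, deriv q x = 0 := fun x => by
    have h1 := h.hasDerivAt_waveEnergy hP hφodd hf x
    rw [hE] at h1
    have h2 := h1.unique (hasDerivAt_const x 0)
    rcases mul_eq_zero.1 h2 with h3 | h3
    · linarith
    · exact pow_eq_zero_iff two_ne_zero |>.1 h3
  have hconst : ∀ x, q x = q 0 := fun x =>
    is_const_of_deriv_eq_zero (h.1.differentiable one_ne_zero) hq0 x 0
  have hq : q = fun _ => q 0 := funext hconst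
  have l1 := h.2.2.2.1
  have l2 := h.2.2.2.2.1
  rw [hq] at l1 l2
  have e1 := tendsto_nhds_unique l1 tendsto_const_nhds
  have e2 := tendsto_nhds_unique l2 tendsto_const_nhds
  linarith

include hP hφcont hφodd hf h in
theorem IsTW.waveEnergy_mem (x : ℝ) :
    waveEnergy φ Θ f q x ∈ Icc 0 (∫ s in (-1:ℝ)..1, f s) := by
  have hc := h.speed_nonneg hP hφcont hφodd hf
  have hanti : Antitone (waveEnergy φ Θ f q) :=
    antitone_of_deriv_nonpos (fun x => (h.hasDerivAt_waveEnergy hP hφodd hf x).differentiableAt)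
      fun x => by
        rw [(h.hasDerivAt_waveEnergy hP hφodd hf x).deriv]
        exact mul_nonpos_of_nonpos_of_nonneg (neg_nonpos.2 hc) (sq_nonneg _)
  obtain ⟨a, ha, ha'⟩ := h.exists_seq_waveEnergy_atTop hP hφcont hφodd hf
  obtain ⟨b, hb, hb'⟩ := h.exists_seq_waveEnergy_atBot hP hφcont hφodd hf
  constructor
  · refine le_of_tendsto ha' ?_
    filter_upwards [ha.eventually_ge_atTop x] with n hn using hanti hn
  · refine ge_of_tendsto hb' ?_
    filter_upwards [hb.eventually_le_atBot x] with n hn using hanti hn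

include hP hφcont hφodd hf h in
theorem IsTW.exists_deriv_bound : ∃ M, 0 ≤ M ∧ ∀ x, -deriv q x ≤ M := by
  obtain ⟨B, hB⟩ := (isCompact_Icc (a := (-1:ℝ)) (b := 1)).bddAbove_image
    ((continuous_const (y := ∫ s in (-1:ℝ)..1, f s)).sub hf.continuous_potential).continuousOn
  refine ⟨P B, hP.slope_nonneg B, fun x => ?_⟩
  rw [← hP.slope_energy _ (neg_nonneg.2 (h.2.2.1 x))]
  refine hP.slope_mono (le_trans ?_ (hB ⟨q x, h.mem_Icc x, rfl⟩))
  have := (h.waveEnergy_mem hP hφcont hφodd hf x).2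
  rw [waveEnergy] at this
  change _ ≤ (∫ s in (-1:ℝ)..1, f s) - ∫ s in (-1:ℝ)..q x, f s
  linarith

include hP hφcont hφodd hf h in
theorem IsTW.waveEnergy_le {M : ℝ} (hM : ∀ x, -deriv q x ≤ M) (x : ℝ) :
    waveEnergy φ Θ f q x ≤ c * M * (q x + 1) := by
  have hc := h.speed_nonneg hP hφcont hφodd hf
  have hd : ∀ x, HasDerivAt (fun x => waveEnergy φ Θ f q x - c * M * q x)
      (-c * deriv q x ^ 2 - c * M * deriv q x) x := fun x =>
    (h.hasDerivAt_waveEnergy hP hφodd hf x).sub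
      ((h.1.differentiable one_ne_zero x).hasDerivAt.const_mul (c * M))
  have hmono : Monotone fun x => waveEnergy φ Θ f q x - c * M * q x :=
    monotone_of_deriv_nonneg (fun x => (hd x).differentiableAt) fun x => by
      rw [(hd x).deriv]
      have := mul_nonneg hc (mul_nonneg (neg_nonneg.2 (h.2.2.1 x)) (sub_nonneg.2 (hM x)))
      change 0 ≤ -c * deriv q x ^ 2 - c * M * deriv q x
      linarith
  obtain ⟨a, ha, ha'⟩ := h.exists_seq_waveEnergy_atTop hP hφcont hφodd hf
  have hlim := ha'.sub ((h.2.2.2.2.1.comp ha).const_mul (c * M))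
  have := ge_of_tendsto hlim <| by
    filter_upwards [ha.eventually_ge_atTop x] with n hn using hmono hn
  change waveEnergy φ Θ f q x - c * M * q x ≤ _ at this
  linarith

include hP hφcont hφodd hφmono hf h in
theorem IsTW.deriv_neg {x : ℝ} (hx : q x ∈ Ioo (-1:ℝ) 1) : deriv q x < 0 := by
  refine lt_of_le_of_ne (h.2.2.1 x) fun h0 => ?_
  have hmax : IsLocalMax (fun y => φ (deriv q y)) x := Eventually.of_forall fun y => by
    simp only [h0]
    exact hφmono.monotone (h.2.2.1 y)
  have hzero := hmax.hasDerivAt_eq_zero (h.2.1 x)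
  rw [h0, mul_zero, zero_add, neg_eq_zero] at hzero
  rcases le_or_gt (q x) μ with hle | hgt
  · have hE := (h.waveEnergy_mem hP hφcont hφodd hf x).1
    have hφ0 : φ 0 = 0 := by
      have := hφodd 0
      rw [neg_zero] at this
      linarith
    rw [waveEnergy, h0, neg_zero, hφ0, hP.energy_zero, zero_add] at hE
    exact absurd (hf.potential_neg ⟨hx.1, hle⟩) (not_lt.2 hE)
  · exact (hf.pos _ ⟨hgt, hx.2⟩).ne' hzero

include hP hφcont hφodd hφmono hf h in
theorem IsTW.eq_of_eq {x y : ℝ} (hx : q x ∈ Ioo (-1:ℝ) 1) (hxy : q x = q y) : x = y := by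
  wlog hlt : x < y generalizing x y
  · rcases (not_lt.1 hlt).eq_or_lt with h' | h'
    · exact h'.symm
    · exact (this (hxy ▸ hx) hxy.symm h').symm
  exfalso
  have hz : (x + y) / 2 ∈ Ioo x y := ⟨by linarith, by linarith⟩
  have hconst : ∀ z ∈ Ioo x y, q z = q x := fun z hz =>
    le_antisymm (h.antitone hz.1.le) (hxy ▸ h.antitone hz.2.le)
  have hev : q =ᶠ[nhds ((x + y) / 2)] fun _ => q x := by
    filter_upwards [Ioo_mem_nhds hz.1 hz.2] with z hz using hconst z hz
  have h1 := h.deriv_neg hP hφcont hφodd hφmono hf (x := (x + y) / 2)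
    (by rw [hconst _ hz]; exact hx)
  rw [hev.deriv_eq, deriv_const] at h1
  exact lt_irrefl _ h1

include hP hφcont hφodd hφmono hf h in
/-- The phase-plane trajectory of a travelling wave. -/
theorem IsTW.exists_trajectory :
    ∃ Y : ℝ → ℝ, (∀ r ∈ Ioo (-1:ℝ) 1, 0 < Y r) ∧
      (∀ r ∈ Ioo (-1:ℝ) 1, HasDerivAt Y (c * P (Y r) - f r) r) ∧
      Tendsto Y (nhdsWithin (-1) (Ioi (-1))) (nhds 0) ∧
      Tendsto Y (nhdsWithin 1 (Iio 1)) (nhds 0) ∧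
      ∀ x, q x ∈ Ioo (-1:ℝ) 1 → deriv q x = -P (Y (q x)) := by
  classical
  have hex : ∀ r, ∃ x, r ∈ Ioo (-1:ℝ) 1 → q x = r := fun r => by
    by_cases hr : r ∈ Ioo (-1:ℝ) 1
    · obtain ⟨x, hx⟩ := h.exists_eq hr
      exact ⟨x, fun _ => hx⟩
    · exact ⟨0, fun h => absurd h hr⟩
  choose X hX using hex
  have hXq : ∀ x, q x ∈ Ioo (-1:ℝ) 1 → X (q x) = x := fun x hx =>
    (h.eq_of_eq hP hφcont hφodd hφmono hf hx (hX _ hx).symm).symm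
  obtain ⟨M, hM0, hM⟩ := h.exists_deriv_bound hP hφcont hφodd hf
  have hslope : ∀ x, P (Θ (φ (-deriv q x))) = -deriv q x := fun x =>
    hP.slope_energy _ (neg_nonneg.2 (h.2.2.1 x))
  have hYnn : ∀ x, 0 ≤ Θ (φ (-deriv q x)) := fun x => by
    by_contra! hneg
    have h1 := hslope x
    rw [hP.slope_of_nonpos _ hneg.le] at h1
    have hφ0 : φ 0 = 0 := by
      have := hφodd 0
      rw [neg_zero] at this
      linarith
    rw [← h1, hφ0, hP.energy_zero] at hneg
    exact lt_irrefl _ hneg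
  refine ⟨fun r => Θ (φ (-deriv q (X r))), fun r hr => ?_, fun r hr => ?_, ?_, ?_, fun x hx => ?_⟩
  · have hd := h.deriv_neg hP hφcont hφodd hφmono hf (x := X r) (by rwa [hX r hr])
    refine lt_of_le_of_ne (hYnn _) fun h0 => ?_
    have h1 := hslope (X r)
    change 0 = Θ (φ (-deriv q (X r))) at h0
    rw [← h0, hP.slope_of_nonpos 0 le_rfl] at h1
    linarith
  · have hmem : q (X r) ∈ Ioo (-1:ℝ) 1 := by rwa [hX r hr]
    have hd := h.deriv_neg hP hφcont hφodd hφmono hf hmem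
    have hs : HasStrictDerivAt q (deriv q (X r)) (X r) :=
      h.1.contDiffAt.hasStrictDerivAt one_ne_zero
    have hXd := (hs.to_local_left_inverse hd.ne (g := X) (by
      filter_upwards [h.1.continuous.continuousAt.preimage_mem_nhds
        (Ioo_mem_nhds hmem.1 hmem.2)] with y hy using hXq y hy)).hasDerivAt
    rw [hX r hr] at hXd
    refine ((h.hasDerivAt_energy_slope hP hφodd (X r)).comp r hXd).congr_deriv ?_
    rw [hslope, hX r hr]
    have := hd.ne
    field_simp
    ring
  · have hb : Tendsto (fun r : ℝ => c * M * (r + 1) - ∫ s in (-1:ℝ)..r, f s)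
        (nhdsWithin (-1) (Ioi (-1))) (nhds 0) := by
      have : Continuous fun r : ℝ => c * M * (r + 1) - ∫ s in (-1:ℝ)..r, f s :=
        (continuous_const.mul (continuous_id.add continuous_const)).sub hf.continuous_potential
      have := this.tendsto (-1)
      simp only [neg_add_cancel, mul_zero, intervalIntegral.integral_same, sub_zero] at this
      exact this.mono_left nhdsWithin_le_nhds
    refine squeeze_zero' (Eventually.of_forall fun r => hYnn _) ?_ hb
    filter_upwards [Ioo_mem_nhdsGT (show (-1:ℝ) < 1 by norm_num)] with r hr
    have := h.waveEnergy_le hP hφcont hφodd hf hM (X r)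
    rw [waveEnergy, hX r hr] at this
    linarith
  · have hb : Tendsto (fun r : ℝ => (∫ s in (-1:ℝ)..1, f s) - ∫ s in (-1:ℝ)..r, f s)
        (nhdsWithin 1 (Iio 1)) (nhds 0) := by
      have := (tendsto_const_nhds (x := ∫ s in (-1:ℝ)..1, f s)).sub
        (hf.continuous_potential.tendsto 1)
      rw [sub_self] at this
      exact this.mono_left nhdsWithin_le_nhds
    refine squeeze_zero' (Eventually.of_forall fun r => hYnn _) ?_ hb
    filter_upwards [Ioo_mem_nhdsLT (show (-1:ℝ) < 1 by norm_num)] with r hr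
    have := (h.waveEnergy_mem hP hφcont hφodd hf (X r)).2
    rw [waveEnergy, hX r hr] at this
    linarith
  · simp only [hXq x hx, hslope, neg_neg]

end Energy

/-- The travel time `∫ dr / p` from `μ` is strictly differentiable where the slope `p` is
positive. -/
theorem hasStrictDerivAt_travelTime {p : ℝ → ℝ} {a b μ : ℝ} (hμ : μ ∈ Ioo a b)
    (hc : ContinuousOn p (Ioo a b)) (hpos : ∀ r ∈ Ioo a b, 0 < p r) {r : ℝ} (hr : r ∈ Ioo a b) :
    HasStrictDerivAt (fun r => ∫ s in μ..r, (p s)⁻¹) (p r)⁻¹ r := by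
  have hinv : ContinuousOn (fun s => (p s)⁻¹) (Ioo a b) := hc.inv₀ fun s hs => (hpos s hs).ne'
  refine intervalIntegral.integral_hasStrictDerivAt_right
    (hinv.mono (ordConnected_Ioo.uIcc_subset hμ hr)).intervalIntegrable ?_
    (hinv.continuousAt (Ioo_mem_nhds hr.1 hr.2))
  exact hinv.stronglyMeasurableAtFilter isOpen_Ioo r hr

section Uniqueness

variable {φ Θ V P f q q₁ q₂ : ℝ → ℝ} {μ c c₁ c₂ : ℝ}

/-- The position at which a profile takes a given value is determined by the travel time. -/
theorem IsTW.travelTime_eq (h : IsTW φ f μ q c) (hμ : μ ∈ Ioo (-1:ℝ) 1) {p : ℝ → ℝ}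
    (hc : ContinuousOn p (Ioo (-1) 1)) (hpos : ∀ r ∈ Ioo (-1:ℝ) 1, 0 < p r)
    (hq : ∀ x, q x ∈ Ioo (-1:ℝ) 1 → deriv q x = -p (q x)) {x : ℝ} (hx : q x ∈ Ioo (-1:ℝ) 1) :
    x = -∫ s in μ..q x, (p s)⁻¹ := by
  have hopen : IsOpen (q ⁻¹' Ioo (-1) 1) := isOpen_Ioo.preimage h.1.continuous
  have hconn : IsPreconnected (q ⁻¹' Ioo (-1) 1) :=
    (ordConnected_Ioo.preimage_anti h.antitone).isPreconnected
  have hd : ∀ y ∈ q ⁻¹' Ioo (-1) 1,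
      HasDerivAt (fun y => (∫ s in μ..q y, (p s)⁻¹) + y) 0 y := fun y hy => by
    have h1 := (hasStrictDerivAt_travelTime hμ hc hpos hy).hasDerivAt.comp y
      (h.1.differentiable one_ne_zero y).hasDerivAt
    refine (h1.add (hasDerivAt_id y)).congr_deriv ?_
    have := (hpos _ hy).ne'
    rw [hq y hy]
    field_simp
    ring
  have h0 : (0:ℝ) ∈ q ⁻¹' Ioo (-1) 1 := by
    rw [mem_preimage, h.2.2.2.2.2]
    exact hμ
  have := hopen.is_const_of_deriv_eq_zero hconn
    (fun y hy => (hd y hy).differentiableAt.differentiableWithinAt)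
    (fun y hy => (hd y hy).deriv) hx h0
  simp only [h.2.2.2.2.2, intervalIntegral.integral_same, add_zero] at this
  linarith

variable (hP : PhaseCoordinates φ Θ V P) (hφcont : Continuous φ) (hφodd : ∀ s, φ (-s) = -φ s)
  (hφmono : StrictMono φ) (hf : IsBistable f μ)

include hP hf in
theorem trajectory_eq_mid_of_le (hc : c₁ ≤ c₂) {Y₁ Y₂ : ℝ → ℝ}
    (hpos₁ : ∀ r ∈ Ioo (-1:ℝ) 1, 0 < Y₁ r) (hpos₂ : ∀ r ∈ Ioo (-1:ℝ) 1, 0 < Y₂ r)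
    (hd₁ : ∀ r ∈ Ioo (-1:ℝ) 1, HasDerivAt Y₁ (c₁ * P (Y₁ r) - f r) r)
    (hd₂ : ∀ r ∈ Ioo (-1:ℝ) 1, HasDerivAt Y₂ (c₂ * P (Y₂ r) - f r) r)
    (hl₁ : Tendsto Y₁ (nhdsWithin (-1) (Ioi (-1))) (nhds 0))
    (hl₂ : Tendsto Y₂ (nhdsWithin (-1) (Ioi (-1))) (nhds 0))
    (hr₁ : Tendsto Y₁ (nhdsWithin 1 (Iio 1)) (nhds 0))
    (hr₂ : Tendsto Y₂ (nhdsWithin 1 (Iio 1)) (nhds 0)) :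
    (∀ r ∈ Ioo (-1) μ, Y₁ r ≤ Y₂ r) ∧ (∀ r ∈ Ioo μ 1, Y₂ r ≤ Y₁ r) ∧ Y₁ μ = Y₂ μ := by
  have hsub₁ : Ioo (-1) μ ⊆ Ioo (-1:ℝ) 1 := Ioo_subset_Ioo_right hf.mid_mem.2.le
  have hsub₂ : Ioo μ 1 ⊆ Ioo (-1:ℝ) 1 := Ioo_subset_Ioo_left hf.mid_mem.1.le
  have hle := hP.trajectory_le hc (fun r hr => (hf.neg r hr).le)
    (fun r hr => hpos₁ r (hsub₁ hr)) (fun r hr => hpos₂ r (hsub₁ hr))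
    (fun r hr => hd₁ r (hsub₁ hr)) (fun r hr => hd₂ r (hsub₁ hr)) hl₁ hl₂
  have hge := hP.trajectory_ge hc (fun r hr => (hf.pos r hr).le)
    (fun r hr => hpos₁ r (hsub₂ hr)) (fun r hr => hpos₂ r (hsub₂ hr))
    (fun r hr => hd₁ r (hsub₂ hr)) (fun r hr => hd₂ r (hsub₂ hr)) hr₁ hr₂
  have t₁ := (hd₁ μ hf.mid_mem).continuousAt.tendsto
  have t₂ := (hd₂ μ hf.mid_mem).continuousAt.tendsto
  refine ⟨hle, hge, le_antisymm ?_ ?_⟩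
  · refine le_of_tendsto_of_tendsto (t₁.mono_left nhdsWithin_le_nhds)
      (t₂.mono_left nhdsWithin_le_nhds) (b := nhdsWithin μ (Iio μ)) ?_
    filter_upwards [Ioo_mem_nhdsLT hf.mid_mem.1] with r hr using hle r hr
  · refine le_of_tendsto_of_tendsto (t₂.mono_left nhdsWithin_le_nhds)
      (t₁.mono_left nhdsWithin_le_nhds) (b := nhdsWithin μ (Ioi μ)) ?_
    filter_upwards [Ioo_mem_nhdsGT hf.mid_mem.2] with r hr using hge r hr

include hP hφcont hφodd hφmono hf in
theorem IsTW.speed_ge_of_le (h₁ : IsTW φ f μ q₁ c₁) (h₂ : IsTW φ f μ q₂ c₂) (hc : c₁ ≤ c₂) :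
    c₂ ≤ c₁ := by
  obtain ⟨Y₁, hpos₁, hd₁, hl₁, hr₁, -⟩ := h₁.exists_trajectory hP hφcont hφodd hφmono hf
  obtain ⟨Y₂, hpos₂, hd₂, hl₂, hr₂, -⟩ := h₂.exists_trajectory hP hφcont hφodd hφmono hf
  obtain ⟨-, hge, hmid⟩ := trajectory_eq_mid_of_le hP hf hc hpos₁ hpos₂ hd₁ hd₂ hl₁ hl₂ hr₁ hr₂
  have hd := (hd₂ μ hf.mid_mem).sub (hd₁ μ hf.mid_mem)
  have hslope : Tendsto (slope (Y₂ - Y₁) μ) (nhdsWithin μ (Ioi μ)) (nhds _) :=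
    (hasDerivAt_iff_tendsto_slope.1 hd).mono_left
      (nhdsWithin_mono _ fun r (hr : μ < r) => hr.ne')
  have := le_of_tendsto hslope (b := 0) (by
    filter_upwards [Ioo_mem_nhdsGT hf.mid_mem.2] with r hr
    rw [slope_def_field]
    refine div_nonpos_of_nonpos_of_nonneg ?_ (sub_nonneg.2 hr.1.le)
    simp only [Pi.sub_apply, hmid, sub_self, sub_zero]
    linarith [hge r hr])
  rw [hmid] at this
  have hp := hP.slope_pos _ (hpos₂ μ hf.mid_mem)
  nlinarith

include hP hφcont hφodd hφmono hf in
theorem IsTW.speed_unique (h₁ : IsTW φ f μ q₁ c₁) (h₂ : IsTW φ f μ q₂ c₂) : c₁ = c₂ := by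
  rcases le_total c₁ c₂ with hc | hc
  · exact le_antisymm hc (h₁.speed_ge_of_le hP hφcont hφodd hφmono hf h₂ hc)
  · exact le_antisymm (h₂.speed_ge_of_le hP hφcont hφodd hφmono hf h₁ hc) hc

theorem IsTW.eq_of_forall_eq_iff (h₁ : IsTW φ f μ q₁ c₁) (h₂ : IsTW φ f μ q₂ c₂)
    (hμ : μ ∈ Ioo (-1:ℝ) 1) {X : ℝ → ℝ} (hX₁ : ∀ x, q₁ x ∈ Ioo (-1:ℝ) 1 → x = X (q₁ x))
    (hX₂ : ∀ x, q₂ x ∈ Ioo (-1:ℝ) 1 → x = X (q₂ x)) : q₁ = q₂ := by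
  have key : ∀ {q q' : ℝ → ℝ} {c c' : ℝ}, IsTW φ f μ q c → IsTW φ f μ q' c' →
      (∀ x, q x ∈ Ioo (-1:ℝ) 1 → x = X (q x)) → (∀ x, q' x ∈ Ioo (-1:ℝ) 1 → x = X (q' x)) →
      ∀ x, q x ∈ Ioo (-1:ℝ) 1 → q' x = q x := by
    intro q q' c c' _ h' hX hX' x hx
    obtain ⟨y, hy⟩ := h'.exists_eq hx
    have hyx : y = x := by rw [hX' y (hy ▸ hx), hy, ← hX x hx]
    rw [← hy, hyx]
  ext x
  by_cases hx₁ : q₁ x ∈ Ioo (-1:ℝ) 1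
  · exact (key h₁ h₂ hX₁ hX₂ x hx₁).symm
  by_cases hx₂ : q₂ x ∈ Ioo (-1:ℝ) 1
  · exact key h₂ h₁ hX₂ hX₁ x hx₂
  have hend : ∀ {q : ℝ → ℝ} {c : ℝ}, IsTW φ f μ q c → q x ∉ Ioo (-1:ℝ) 1 →
      (x ≤ 0 → q x = 1) ∧ (0 ≤ x → q x = -1) := by
    intro q c h hx
    have hm := h.mem_Icc x
    refine ⟨fun h0 => ?_, fun h0 => ?_⟩
    · have h1 := h.antitone h0
      rw [h.2.2.2.2.2] at h1
      by_contra hne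
      exact hx ⟨hμ.1.trans_le h1, lt_of_le_of_ne hm.2 hne⟩
    · have h1 := h.antitone h0
      rw [h.2.2.2.2.2] at h1
      by_contra hne
      exact hx ⟨lt_of_le_of_ne hm.1 (Ne.symm hne), h1.trans_lt hμ.2⟩
  rcases le_total x 0 with h0 | h0
  · rw [(hend h₁ hx₁).1 h0, (hend h₂ hx₂).1 h0]
  · rw [(hend h₁ hx₁).2 h0, (hend h₂ hx₂).2 h0]

include hP hφcont hφodd hφmono hf in
theorem IsTW.unique (h₁ : IsTW φ f μ q₁ c₁) (h₂ : IsTW φ f μ q₂ c₂) : q₁ = q₂ ∧ c₁ = c₂ := by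
  obtain rfl := h₁.speed_unique hP hφcont hφodd hφmono hf h₂
  refine ⟨?_, rfl⟩
  obtain ⟨Y₁, hpos₁, hd₁, hl₁, hr₁, hq₁⟩ := h₁.exists_trajectory hP hφcont hφodd hφmono hf
  obtain ⟨Y₂, hpos₂, hd₂, hl₂, hr₂, hq₂⟩ := h₂.exists_trajectory hP hφcont hφodd hφmono hf
  obtain ⟨hl, hg, hmid⟩ :=
    trajectory_eq_mid_of_le hP hf le_rfl hpos₁ hpos₂ hd₁ hd₂ hl₁ hl₂ hr₁ hr₂
  obtain ⟨hl', hg', -⟩ :=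
    trajectory_eq_mid_of_le hP hf le_rfl hpos₂ hpos₁ hd₂ hd₁ hl₂ hl₁ hr₂ hr₁
  have hY : ∀ r ∈ Ioo (-1:ℝ) 1, Y₂ r = Y₁ r := by
    intro r hr
    rcases lt_trichotomy r μ with h | rfl | h
    · exact le_antisymm (hl' r ⟨hr.1, h⟩) (hl r ⟨hr.1, h⟩)
    · exact hmid.symm
    · exact le_antisymm (hg r ⟨h, hr.2⟩) (hg' r ⟨h, hr.2⟩)
  have hc : ContinuousOn (fun r => P (Y₁ r)) (Ioo (-1) 1) := fun r hr =>
    (hP.slope_continuous.continuousAt.comp (hd₁ r hr).continuousAt).continuousWithinAt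
  have hpos : ∀ r ∈ Ioo (-1:ℝ) 1, 0 < P (Y₁ r) := fun r hr => hP.slope_pos _ (hpos₁ r hr)
  exact h₁.eq_of_forall_eq_iff h₂ hf.mid_mem (X := fun r => -∫ s in μ..r, (P (Y₁ s))⁻¹)
    (fun x hx => h₁.travelTime_eq hf.mid_mem hc hpos hq₁ hx)
    (fun x hx => h₂.travelTime_eq hf.mid_mem hc hpos
      (fun y hy => by rw [hq₂ y hy, hY _ hy]) hx)

end Uniqueness

/-- The projection of the real line onto `[-1, 1]`. -/
noncomputable def clampUnit (r : ℝ) : ℝ := max (-1) (min 1 r)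

theorem continuous_clampUnit : Continuous clampUnit :=
  continuous_const.max (continuous_const.min continuous_id)

theorem clampUnit_mem (r : ℝ) : clampUnit r ∈ Icc (-1:ℝ) 1 :=
  ⟨le_max_left _ _, max_le (by norm_num) (min_le_left _ _)⟩

theorem clampUnit_of_mem {r : ℝ} (hr : r ∈ Icc (-1:ℝ) 1) : clampUnit r = r := by
  rw [clampUnit, min_eq_right hr.2, max_eq_right hr.1]

/-- The integral operator whose fixed points solve `Y' = c P(Y) - f`, `Y(-1) = 0`. -/
noncomputable def energyMap (P f : ℝ → ℝ) (c : ℝ) (X : ℝ → ℝ) (r : ℝ) : ℝ :=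
  c * (∫ s in (-1:ℝ)..clampUnit r, P (X s)) - ∫ s in (-1:ℝ)..clampUnit r, f s

/-- The monotone iteration approximating the least fixed point of `energyMap`. -/
noncomputable def energyIter (P f : ℝ → ℝ) (c : ℝ) : ℕ → ℝ → ℝ
  | 0 => energyMap P f 0 0
  | n + 1 => energyMap P f c (energyIter P f c n)

/-- Solutions of the phase-plane equation `Y' = c P(Y) - f` on `[-1, 1]` with `Y(-1) = 0`,
extended constantly. -/
def IsPhaseSolution (P f : ℝ → ℝ) (c : ℝ) (Y : ℝ → ℝ) : Prop :=
  Continuous Y ∧ ∀ r, Y r = energyMap P f c Y r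

section Iteration

variable {φ Θ V P f : ℝ → ℝ} {μ c c' : ℝ} (hP : PhaseCoordinates φ Θ V P) (hf : IsBistable f μ)

include hP hf in
theorem continuous_energyMap {X : ℝ → ℝ} (hX : Continuous X) : Continuous (energyMap P f c X) := by
  have h1 : Continuous fun r => ∫ s in (-1:ℝ)..r, P (X s) :=
    intervalIntegral.continuous_primitive
      (fun a b => (hP.slope_continuous.comp hX).intervalIntegrable a b) (-1)
  exact ((continuous_const.mul (h1.comp continuous_clampUnit))).sub
    (hf.continuous_potential.comp continuous_clampUnit)

include hP in
theorem energyMap_mono (hc : 0 ≤ c) (hcc : c ≤ c') {X X' : ℝ → ℝ} (hX : Continuous X)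
    (hX' : Continuous X') (hXX : ∀ s ∈ Icc (-1:ℝ) 1, X s ≤ X' s) (r : ℝ) :
    energyMap P f c X r ≤ energyMap P f c' X' r := by
  have hr := clampUnit_mem r
  have h1 : ∫ s in (-1:ℝ)..clampUnit r, P (X s) ≤ ∫ s in (-1:ℝ)..clampUnit r, P (X' s) :=
    intervalIntegral.integral_mono_on hr.1
      ((hP.slope_continuous.comp hX).intervalIntegrable _ _)
      ((hP.slope_continuous.comp hX').intervalIntegrable _ _)
      fun s hs => hP.slope_mono (hXX s ⟨hs.1, hs.2.trans hr.2⟩)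
  have h2 : 0 ≤ ∫ s in (-1:ℝ)..clampUnit r, P (X s) :=
    intervalIntegral.integral_nonneg hr.1 fun s _ => hP.slope_nonneg _
  exact sub_le_sub_right (mul_le_mul hcc h1 h2 (hc.trans hcc)) _

include hP hf in
theorem continuous_energyIter (n : ℕ) : Continuous (energyIter P f c n) := by
  induction n with
  | zero => exact continuous_energyMap hP hf continuous_zero
  | succ n ih => exact continuous_energyMap hP hf ih

include hP in
theorem energyMap_zero_le (hc : 0 ≤ c) (X : ℝ → ℝ) (r : ℝ) :
    energyMap P f 0 0 r ≤ energyMap P f c X r := by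
  rw [energyMap, energyMap, zero_mul]
  exact sub_le_sub_right (mul_nonneg hc
    (intervalIntegral.integral_nonneg (clampUnit_mem r).1 fun s _ => hP.slope_nonneg _)) _

include hP hf in
theorem energyIter_mono (hc : 0 ≤ c) (r : ℝ) : Monotone fun n => energyIter P f c n r := by
  suffices h : ∀ n r, energyIter P f c n r ≤ energyIter P f c (n + 1) r from
    monotone_nat_of_le_succ fun n => h n r
  intro n
  induction n with
  | zero => exact fun r => energyMap_zero_le hP hc _ r
  | succ n ih =>
    exact fun r => energyMap_mono hP hc le_rfl (continuous_energyIter hP hf n)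
      (continuous_energyIter hP hf (n + 1)) (fun s _ => ih s) r

include hP hf in
theorem energyIter_le_of_speed_le (hc : 0 ≤ c) (hcc : c ≤ c') (n : ℕ) (r : ℝ) :
    energyIter P f c n r ≤ energyIter P f c' n r := by
  induction n generalizing r with
  | zero => exact le_rfl
  | succ n ih =>
    exact energyMap_mono hP hc hcc (continuous_energyIter hP hf n)
      (continuous_energyIter hP hf n) (fun s _ => ih s) r

include hP hf in
theorem exists_energyIter_bound (hc : 0 ≤ c) :
    ∃ M, ∀ c' ∈ Icc 0 c, ∀ n r, |energyIter P f c' n r| ≤ M := by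
  obtain ⟨A, hA, hPA⟩ := hP.slope_growth
  obtain ⟨B, hB⟩ := (isCompact_Icc (a := (-1:ℝ)) (b := 1)).exists_bound_of_continuousOn
    hf.continuous_potential.continuousOn
  have hB0 : 0 ≤ B := (norm_nonneg _).trans (hB 1 (by norm_num))
  set k := c * A with hk
  have hk0 : 0 ≤ k := mul_nonneg hc hA
  set b : ℝ → ℝ := fun r => (1 + B) * Real.exp (k * (clampUnit r + 1)) - 1 with hb
  have hexp : ∀ r, 1 ≤ Real.exp (k * (clampUnit r + 1)) := fun r =>
    Real.one_le_exp (mul_nonneg hk0 (by linarith [(clampUnit_mem r).1]))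
  have hb0 : ∀ r, 0 ≤ b r := fun r => by
    simp only [hb]
    nlinarith [hexp r]
  have hpot : ∀ r, -∫ s in (-1:ℝ)..clampUnit r, f s ≤ B := fun r =>
    (neg_le_abs _).trans (hB _ (clampUnit_mem r))
  have hstep : ∀ X : ℝ → ℝ, Continuous X → (∀ r, X r ≤ b r) → ∀ r, energyMap P f c X r ≤ b r := by
    intro X hX hXb r
    have hprim : ∀ s, HasDerivAt (fun s => (1 + B) * Real.exp (k * (s + 1)))
        (k * ((1 + B) * Real.exp (k * (s + 1)))) s := fun s => by
      have h1 : HasDerivAt (fun s : ℝ => k * (s + 1)) k s := by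
        simpa using ((hasDerivAt_id s).add_const 1).const_mul k
      exact (h1.exp.const_mul (1 + B)).congr_deriv (by ring)
    have hcont : Continuous fun s : ℝ => k * ((1 + B) * Real.exp (k * (s + 1))) := by fun_prop
    have hint := intervalIntegral.integral_eq_sub_of_hasDerivAt (fun s _ => hprim s)
      (hcont.intervalIntegrable (μ := volume) (-1) (clampUnit r))
    have hle : ∫ s in (-1:ℝ)..clampUnit r, c * P (X s) ≤
        ∫ s in (-1:ℝ)..clampUnit r, k * ((1 + B) * Real.exp (k * (s + 1))) := by
      refine intervalIntegral.integral_mono_on (clampUnit_mem r).1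
        ((continuous_const.mul (hP.slope_continuous.comp hX)).intervalIntegrable _ _)
        (hcont.intervalIntegrable _ _) fun s hs => ?_
      have hs' : clampUnit s = s := clampUnit_of_mem ⟨hs.1, hs.2.trans (clampUnit_mem r).2⟩
      have h1 : P (X s) ≤ A * (1 + b s) := (hP.slope_mono (hXb s)).trans (hPA _ (hb0 s))
      have h2 : 1 + b s = (1 + B) * Real.exp (k * (s + 1)) := by
        simp only [hb, hs']
        ring
      rw [h2] at h1
      calc c * P (X s) ≤ c * (A * ((1 + B) * Real.exp (k * (s + 1)))) :=
            mul_le_mul_of_nonneg_left h1 hc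
        _ = k * ((1 + B) * Real.exp (k * (s + 1))) := by rw [hk]; ring
    rw [hint, intervalIntegral.integral_const_mul, neg_add_cancel, mul_zero, Real.exp_zero] at hle
    have := hpot r
    simp only [energyMap, hb]
    linarith
  have hup : ∀ n r, energyIter P f c n r ≤ b r := by
    intro n
    induction n with
    | zero =>
      exact fun r => (energyMap_zero_le hP hc (fun _ => 0) r).trans
        (hstep _ continuous_const (fun r => hb0 r) r)
    | succ n ih => exact hstep _ (continuous_energyIter hP hf n) ih
  refine ⟨(1 + B) * Real.exp (k * 2), fun c' hc' n r => abs_le.2 ⟨?_, ?_⟩⟩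
  · have h1 := energyIter_mono hP hf hc'.1 r (Nat.zero_le n)
    change energyMap P f 0 0 r ≤ _ at h1
    have h2 : -B ≤ energyMap P f 0 0 r := by
      rw [energyMap, zero_mul, zero_sub]
      exact neg_le_neg ((le_abs_self _).trans (hB _ (clampUnit_mem r)))
    have h3 : 1 ≤ Real.exp (k * 2) := Real.one_le_exp (by positivity)
    nlinarith
  · have h1 := (energyIter_le_of_speed_le hP hf hc'.1 hc'.2 n r).trans (hup n r)
    have h2 : Real.exp (k * (clampUnit r + 1)) ≤ Real.exp (k * 2) :=
      Real.exp_le_exp.2 (mul_le_mul_of_nonneg_left (by linarith [(clampUnit_mem r).2]) hk0)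
    simp only [hb] at h1
    nlinarith

include hP hf in
/-- Bounded pointwise limits of approximate fixed points are phase-plane solutions. -/
theorem IsPhaseSolution.of_tendsto {X : ℕ → ℝ → ℝ} {Y : ℝ → ℝ} {d : ℕ → ℝ} {M : ℝ}
    (hX : ∀ n, Continuous (X n)) (hM : ∀ n r, |X n r| ≤ M) (hd : Tendsto d atTop (nhds c))
    (hXY : ∀ r, Tendsto (fun n => X n r) atTop (nhds (Y r)))
    (hmap : ∀ r, Tendsto (fun n => energyMap P f (d n) (X n) r) atTop (nhds (Y r))) :
    IsPhaseSolution P f c Y := by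
  have hPX : ∀ r, Tendsto (fun n => P (X n r)) atTop (nhds (P (Y r))) := fun r =>
    (hP.slope_continuous.tendsto _).comp (hXY r)
  have hbound : ∀ n r, ‖P (X n r)‖ ≤ P M := fun n r => by
    rw [Real.norm_of_nonneg (hP.slope_nonneg _)]
    exact hP.slope_mono ((le_abs_self _).trans (hM n r))
  have hmeas : Measurable fun r => P (Y r) :=
    measurable_of_tendsto_metrizable (fun n => (hP.slope_continuous.comp (hX n)).measurable)
      (tendsto_pi_nhds.2 hPX)
  have hint : ∀ a b, IntervalIntegrable (fun r => P (Y r)) volume a b := fun a b =>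
    (intervalIntegrable_const (c := P M)).mono_fun hmeas.aestronglyMeasurable
      (Eventually.of_forall fun r =>
        (le_of_tendsto (hPX r).norm (Eventually.of_forall fun n => hbound n r)).trans
          (le_abs_self _))
  have heq : ∀ r, Y r = energyMap P f c Y r := fun r => by
    refine tendsto_nhds_unique (hmap r) (Tendsto.sub (Tendsto.mul hd ?_) tendsto_const_nhds)
    refine intervalIntegral.tendsto_integral_filter_of_dominated_convergence (fun _ => P M)
      (Eventually.of_forall fun n => (hP.slope_continuous.comp (hX n)).aestronglyMeasurable)
      (Eventually.of_forall fun n => Eventually.of_forall fun s _ => hbound n s)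
      intervalIntegrable_const (Eventually.of_forall fun s _ => hPX s)
  refine ⟨?_, heq⟩
  rw [show Y = energyMap P f c Y from funext heq]
  exact (continuous_const.mul ((intervalIntegral.continuous_primitive hint (-1)).comp
    continuous_clampUnit)).sub (hf.continuous_potential.comp continuous_clampUnit)

include hP hf in
/-- The least phase-plane solutions form a monotone, locally bounded family in the speed. -/
theorem exists_phaseSolution_family :
    ∃ y : ℝ → ℝ → ℝ, (∀ c, 0 ≤ c → IsPhaseSolution P f c (y c)) ∧
      (∀ c c', 0 ≤ c → c ≤ c' → ∀ r, y c r ≤ y c' r) ∧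
      (∀ c, 0 ≤ c → ∃ M, ∀ c' ∈ Icc 0 c, ∀ r, |y c' r| ≤ M) ∧
      ∀ c, 0 ≤ c → ∀ r, energyMap P f c (energyMap P f 0 0) r ≤ y c r := by
  have hlim : ∀ c, 0 ≤ c → ∀ r, Tendsto (fun n => energyIter P f c n r) atTop
      (nhds (⨆ n, energyIter P f c n r)) := by
    intro c hc r
    obtain ⟨M, hM⟩ := exists_energyIter_bound hP hf hc
    refine tendsto_atTop_ciSup (energyIter_mono hP hf hc r) ⟨M, ?_⟩
    rintro _ ⟨n, rfl⟩
    exact (le_abs_self _).trans (hM c ⟨hc, le_rfl⟩ n r)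
  refine ⟨fun c r => ⨆ n, energyIter P f c n r, fun c hc => ?_, fun c c' hc hcc r => ?_,
    fun c hc => ?_, fun c hc r => ?_⟩
  · obtain ⟨M, hM⟩ := exists_energyIter_bound hP hf hc
    exact IsPhaseSolution.of_tendsto hP hf (continuous_energyIter hP hf)
      (hM c ⟨hc, le_rfl⟩) (tendsto_const_nhds (x := c)) (hlim c hc)
      fun r => (hlim c hc r).comp (tendsto_add_atTop_nat 1)
  · exact le_of_tendsto_of_tendsto' (hlim c hc r) (hlim c' (hc.trans hcc) r)
      fun n => energyIter_le_of_speed_le hP hf hc hcc n r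
  · obtain ⟨M, hM⟩ := exists_energyIter_bound hP hf hc
    exact ⟨M, fun c' hc' r => le_of_tendsto (hlim c' hc'.1 r).abs
      (Eventually.of_forall fun n => hM c' hc' n r)⟩
  · exact (energyIter_mono hP hf hc r).ge_of_tendsto (hlim c hc r) 1

end Iteration

section PhaseSolution

variable {φ Θ V P f Y Z : ℝ → ℝ} {μ c : ℝ} (hP : PhaseCoordinates φ Θ V P) (hf : IsBistable f μ)

theorem IsPhaseSolution.eq_on_Icc (h : IsPhaseSolution P f c Y) {r : ℝ} (hr : r ∈ Icc (-1:ℝ) 1) :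
    Y r = c * (∫ s in (-1:ℝ)..r, P (Y s)) - ∫ s in (-1:ℝ)..r, f s := by
  rw [h.2 r, energyMap, clampUnit_of_mem hr]

theorem IsPhaseSolution.at_neg_one (h : IsPhaseSolution P f c Y) : Y (-1) = 0 := by
  rw [h.eq_on_Icc (by norm_num)]
  simp

theorem IsPhaseSolution.tendsto_neg_one (h : IsPhaseSolution P f c Y) :
    Tendsto Y (nhdsWithin (-1) (Ioi (-1))) (nhds 0) := by
  have := h.1.tendsto (-1)
  rw [h.at_neg_one] at this
  exact this.mono_left nhdsWithin_le_nhds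

include hP hf in
theorem IsPhaseSolution.hasDerivAt (h : IsPhaseSolution P f c Y) {r : ℝ}
    (hr : r ∈ Ioo (-1:ℝ) 1) : HasDerivAt Y (c * P (Y r) - f r) r := by
  have h1 := ((hP.slope_continuous.comp h.1).integral_hasStrictDerivAt (-1) r).hasDerivAt
  refine ((h1.const_mul c).sub (hf.hasDerivAt_potential r)).congr_of_eventuallyEq ?_
  filter_upwards [Ioo_mem_nhds hr.1 hr.2] with s hs
  exact h.eq_on_Icc ⟨hs.1.le, hs.2.le⟩

include hP hf in
theorem IsPhaseSolution.pos_of_le_mid (h : IsPhaseSolution P f c Y) (hc : 0 ≤ c) {r : ℝ}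
    (hr : r ∈ Ioc (-1:ℝ) μ) : 0 < Y r := by
  rw [h.eq_on_Icc ⟨hr.1.le, hr.2.trans hf.mid_mem.2.le⟩]
  have h1 := mul_nonneg hc (intervalIntegral.integral_nonneg (μ := volume) hr.1.le
    fun s _ => hP.slope_nonneg (Y s))
  linarith [hf.potential_neg hr]

include hP hf in
/-- Once a phase-plane solution vanishes beyond the unstable zero, it is negative at `1`. -/
theorem IsPhaseSolution.neg_of_nonpos (h : IsPhaseSolution P f c Y) {r : ℝ} (hr : r ∈ Ioo μ 1)
    (hY : Y r ≤ 0) : Y 1 < 0 := by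
  have hr' : r ∈ Ioo (-1:ℝ) 1 := ⟨hf.mid_mem.1.trans hr.1, hr.2⟩
  have hle : ∀ s ∈ Icc r 1, Y s ≤ 0 := by
    have hlt : ∀ s ∈ Ico r 1, Y s ≤ 0 := by
      intro s hs
      exact image_le_of_deriv_right_lt_deriv_boundary (f := Y) (f' := fun s => c * P (Y s) - f s)
        (B := fun _ => 0) (B' := fun _ => 0) (a := r) (b := s) h.1.continuousOn
        (fun t ht => (h.hasDerivAt hP hf
          ⟨hr'.1.trans_le ht.1, ht.2.trans hs.2⟩).hasDerivWithinAt)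
        hY (fun t => hasDerivAt_const t 0)
        (fun t ht h0 => by
          rw [h0, hP.slope_of_nonpos 0 le_rfl]
          linarith [hf.pos t ⟨hr.1.trans_le ht.1, ht.2.trans hs.2⟩])
        (right_mem_Icc.2 hs.1)
    intro s hs
    rcases hs.2.lt_or_eq with h1 | rfl
    · exact hlt s ⟨hs.1, h1⟩
    · refine le_of_tendsto ((h.1.tendsto 1).mono_left (nhdsWithin_le_nhds (s := Iio 1))) ?_
      filter_upwards [Ioo_mem_nhdsLT hr.2] with t ht using hlt t ⟨ht.1.le, ht.2⟩
  have hPc := hP.slope_continuous.comp h.1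
  have h1 := h.eq_on_Icc (r := 1) (by norm_num)
  have h2 := h.eq_on_Icc ⟨hr'.1.le, hr'.2.le⟩
  have e1 := intervalIntegral.integral_add_adjacent_intervals
    (hPc.intervalIntegrable (μ := volume) (-1) r) (hPc.intervalIntegrable r 1)
  have e2 := intervalIntegral.integral_add_adjacent_intervals
    (hf.continuous.intervalIntegrable (μ := volume) (-1) r) (hf.continuous.intervalIntegrable r 1)
  have e3 : ∫ s in r..1, (P ∘ Y) s = 0 := by
    rw [← intervalIntegral.integral_zero (a := r) (b := 1) (μ := volume)]
    refine intervalIntegral.integral_congr fun s hs => ?_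
    rw [uIcc_of_le hr.2.le] at hs
    exact hP.slope_of_nonpos _ (hle s hs)
  rw [e3, add_zero] at e1
  change (∫ s in (-1:ℝ)..r, P (Y s)) = ∫ s in (-1:ℝ)..1, P (Y s) at e1
  rw [← e1] at h1
  linarith [hf.potential r hr']

include hP hf in
theorem IsPhaseSolution.pos (h : IsPhaseSolution P f c Y) (hc : 0 ≤ c) (h1 : 0 ≤ Y 1) {r : ℝ}
    (hr : r ∈ Ioo (-1:ℝ) 1) : 0 < Y r := by
  rcases le_or_gt r μ with hle | hgt
  · exact h.pos_of_le_mid hP hf hc ⟨hr.1, hle⟩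
  · by_contra! hY
    exact absurd (h.neg_of_nonpos hP hf ⟨hgt, hr.2⟩ hY) (not_lt.2 h1)

include hP hf in
theorem IsPhaseSolution.eq_mid (hY : IsPhaseSolution P f c Y) (hZ : IsPhaseSolution P f c Z)
    (hc : 0 ≤ c) : Y μ = Z μ := by
  have key : ∀ {Y Z : ℝ → ℝ}, IsPhaseSolution P f c Y → IsPhaseSolution P f c Z → Y μ ≤ Z μ := by
    intro Y Z hY hZ
    have hle := hP.trajectory_le (a := -1) (b := μ) (le_refl c) (fun r hr => (hf.neg r hr).le)
      (fun r hr => hY.pos_of_le_mid hP hf hc ⟨hr.1, hr.2.le⟩)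
      (fun r hr => hZ.pos_of_le_mid hP hf hc ⟨hr.1, hr.2.le⟩)
      (fun r hr => hY.hasDerivAt hP hf ⟨hr.1, hr.2.trans hf.mid_mem.2⟩)
      (fun r hr => hZ.hasDerivAt hP hf ⟨hr.1, hr.2.trans hf.mid_mem.2⟩)
      hY.tendsto_neg_one hZ.tendsto_neg_one
    refine le_of_tendsto_of_tendsto ((hY.1.tendsto μ).mono_left nhdsWithin_le_nhds)
      ((hZ.1.tendsto μ).mono_left nhdsWithin_le_nhds) (b := nhdsWithin μ (Iio μ)) ?_
    filter_upwards [Ioo_mem_nhdsLT hf.mid_mem.1] with r hr using hle r hr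
  exact le_antisymm (key hY hZ) (key hZ hY)

theorem PhaseCoordinates.exists_slope_sub_le (hP : PhaseCoordinates φ Θ V P) {ε B : ℝ}
    (hε : 0 < ε) :
    ∃ L, ∀ x y, x ≤ y → ε ≤ y → y ≤ B → P y - P x ≤ L * (y - x) := by
  obtain ⟨L, hL0, hL⟩ := hP.slope_lipschitz (ε / 2) (by positivity)
  refine ⟨L + P B / (ε / 2), fun x y hxy hεy hyB => ?_⟩
  have hPB : 0 ≤ P B / (ε / 2) := div_nonneg (hP.slope_nonneg B) (by positivity)
  have hsub : 0 ≤ y - x := sub_nonneg.2 hxy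
  rcases le_or_gt (ε / 2) x with hx | hx
  · have := hL x y hx hxy
    nlinarith [mul_nonneg hPB hsub]
  · have h1 : P y - P x ≤ P B := by
      linarith [hP.slope_mono hyB, hP.slope_nonneg x]
    have h2 : P B ≤ P B / (ε / 2) * (y - x) := by
      calc P B = P B / (ε / 2) * (ε / 2) := by field_simp
        _ ≤ P B / (ε / 2) * (y - x) := mul_le_mul_of_nonneg_left (by linarith) hPB
    nlinarith [mul_nonneg hL0 hsub]

include hP hf in
/-- Ordered phase-plane solutions whose upper member stays positive coincide at `1`. -/
theorem IsPhaseSolution.eq_at_one (hY : IsPhaseSolution P f c Y) (hZ : IsPhaseSolution P f c Z)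
    (hc : 0 ≤ c) (hle : ∀ r, Y r ≤ Z r) (hZ1 : 0 < Z 1) : Y 1 = Z 1 := by
  have hμ := hf.mid_mem
  have hpos : ∀ r ∈ Icc μ 1, 0 < Z r := fun r hr => by
    rcases hr.2.lt_or_eq with h | rfl
    · exact hZ.pos hP hf hc hZ1.le ⟨hμ.1.trans_le hr.1, h⟩
    · exact hZ1
  obtain ⟨m, hm, hmin⟩ := isCompact_Icc.exists_isMinOn (nonempty_Icc.2 hμ.2.le)
    (hZ.1.continuousOn (s := Icc μ 1))
  obtain ⟨M, -, hmax⟩ := isCompact_Icc.exists_isMaxOn (nonempty_Icc.2 hμ.2.le)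
    (hZ.1.continuousOn (s := Icc μ 1))
  obtain ⟨L, hL⟩ := hP.exists_slope_sub_le (B := Z M) (hpos m hm)
  have hd : ∀ r ∈ Ioo μ 1, HasDerivAt (fun r => (Z r - Y r) * Real.exp (-(c * L) * r))
      ((c * (P (Z r) - P (Y r)) - c * L * (Z r - Y r)) * Real.exp (-(c * L) * r)) r := by
    intro r hr
    have hr' : r ∈ Ioo (-1:ℝ) 1 := ⟨hμ.1.trans hr.1, hr.2⟩
    have h1 := (hZ.hasDerivAt hP hf hr').sub (hY.hasDerivAt hP hf hr')
    have h2 : HasDerivAt (fun s : ℝ => -(c * L) * s) (-(c * L)) r := by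
      simpa using (hasDerivAt_id r).const_mul (-(c * L))
    refine (h1.mul h2.exp).congr_deriv ?_
    simp only [Pi.sub_apply]
    ring
  have hanti : AntitoneOn (fun r => (Z r - Y r) * Real.exp (-(c * L) * r)) (Icc μ 1) := by
    refine antitoneOn_of_deriv_nonpos (convex_Icc _ _)
      ((hZ.1.sub hY.1).mul (by fun_prop)).continuousOn (fun r hr => ?_) (fun r hr => ?_)
    all_goals rw [interior_Icc] at hr
    · exact (hd r hr).differentiableAt.differentiableWithinAt
    · rw [(hd r hr).deriv]
      refine mul_nonpos_of_nonpos_of_nonneg ?_ (Real.exp_pos _).le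
      have hr' : r ∈ Icc μ 1 := ⟨hr.1.le, hr.2.le⟩
      have := mul_le_mul_of_nonneg_left (hL (Y r) (Z r) (hle r) (hmin hr') (hmax hr')) hc
      linarith
  have h1 := hanti (left_mem_Icc.2 hμ.2.le) (right_mem_Icc.2 hμ.2.le) hμ.2.le
  simp only [hY.eq_mid hP hf hZ hc, sub_self, zero_mul] at h1
  have h2 := nonpos_of_mul_nonpos_left h1 (Real.exp_pos _)
  exact le_antisymm (hle 1) (sub_nonpos.1 h2)

include hP hf in
/-- Shooting in the speed: some phase-plane solution connects the two stable zeros. -/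
theorem exists_connecting_phaseSolution :
    ∃ c Z, 0 ≤ c ∧ IsPhaseSolution P f c Z ∧ (∀ r ∈ Ioo (-1:ℝ) 1, 0 < Z r) ∧ Z 1 = 0 := by
  obtain ⟨y, hy, hmono, hbound, hlow⟩ := exists_phaseSolution_family hP hf
  set S : Set ℝ := {c | 0 ≤ c ∧ y c 1 ≤ 0} with hS
  have h0S : (0:ℝ) ∈ S := by
    refine ⟨le_rfl, ?_⟩
    rw [(hy 0 le_rfl).eq_on_Icc (by norm_num), zero_mul, zero_sub]
    exact neg_nonpos.2 hf.potential_one_nonneg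
  have hSbdd : BddAbove S := by
    set X : ℝ → ℝ := energyMap P f 0 0 with hX
    have hXc : Continuous X := continuous_energyMap hP hf continuous_zero
    set I := ∫ s in (-1:ℝ)..1, P (X s) with hI
    have hIpos : 0 < I := by
      refine intervalIntegral.integral_pos (by norm_num)
        (hP.slope_continuous.comp hXc).continuousOn (fun s _ => hP.slope_nonneg _)
        ⟨μ, ⟨hf.mid_mem.1.le, hf.mid_mem.2.le⟩, hP.slope_pos _ ?_⟩
      rw [hX, energyMap, zero_mul, zero_sub,
        clampUnit_of_mem ⟨hf.mid_mem.1.le, hf.mid_mem.2.le⟩]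
      exact neg_pos.2 (hf.potential_neg ⟨hf.mid_mem.1, le_rfl⟩)
    set C := (∫ s in (-1:ℝ)..1, f s) / I + 1 with hC
    have hC0 : 0 ≤ C := add_nonneg (div_nonneg hf.potential_one_nonneg hIpos.le) zero_le_one
    refine ⟨C, fun c hc => ?_⟩
    by_contra! hlt
    have h1 := (hlow C hC0 1).trans (hmono C c hC0 hlt.le 1)
    rw [energyMap, clampUnit_of_mem (by norm_num)] at h1
    have h2 : C * I = (∫ s in (-1:ℝ)..1, f s) + I := by
      rw [hC, add_mul, div_mul_cancel₀ _ hIpos.ne', one_mul]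
    change C * I - _ ≤ _ at h1
    linarith [hc.2]
  set c := sSup S with hc
  have hc0 : 0 ≤ c := le_csSup hSbdd h0S
  obtain ⟨d, hdmono, hdlim, hdS⟩ := exists_seq_tendsto_sSup ⟨0, h0S⟩ hSbdd
  have hdc : ∀ n, d n ≤ c := fun n => le_csSup hSbdd (hdS n)
  obtain ⟨M, hM⟩ := hbound (c + 1) (by linarith)
  have hexL : ∀ r, ∃ l, Tendsto (fun n => y (d n) r) atTop (nhds l) := fun r =>
    ⟨_, tendsto_atTop_ciSup (fun m n hmn => hmono _ _ (hdS m).1 (hdmono hmn) r) ⟨M, by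
      rintro _ ⟨n, rfl⟩
      exact (le_abs_self _).trans (hM _ ⟨(hdS n).1, by linarith [hdc n]⟩ r)⟩⟩
  choose Y hYlim using hexL
  have hYsol : IsPhaseSolution P f c Y :=
    IsPhaseSolution.of_tendsto hP hf (fun n => (hy _ (hdS n).1).1)
      (fun n r => hM _ ⟨(hdS n).1, by linarith [hdc n]⟩ r) hdlim hYlim
      fun r => (hYlim r).congr fun n => (hy _ (hdS n).1).2 r
  have hY1 : Y 1 ≤ 0 := le_of_tendsto (hYlim 1) (Eventually.of_forall fun n => (hdS n).2)
  set e : ℕ → ℝ := fun n => c + 1 / ((n:ℝ) + 1) with he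
  have hce : ∀ n, c < e n := fun n => lt_add_of_pos_right _ Nat.one_div_pos_of_nat
  have he0 : ∀ n, 0 ≤ e n := fun n => hc0.trans (hce n).le
  have he1 : ∀ n, e n ≤ c + 1 := fun n => by
    have : 1 / ((n:ℝ) + 1) ≤ 1 := by
      rw [div_le_one (by positivity)]
      linarith [(Nat.cast_nonneg n : (0:ℝ) ≤ n)]
    simp only [he]
    linarith
  have hanti : Antitone e := fun m n hmn =>
    add_le_add_right (Nat.one_div_le_one_div hmn) c
  have helim : Tendsto e atTop (nhds c) := by
    have := (tendsto_one_div_add_atTop_nhds_zero_nat (𝕜 := ℝ)).const_add c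
    rwa [add_zero] at this
  have hexR : ∀ r, ∃ l, Tendsto (fun n => y (e n) r) atTop (nhds l) := fun r =>
    ⟨_, tendsto_atTop_ciInf (fun m n hmn => hmono _ _ (he0 n) (hanti hmn) r) ⟨-M, by
      rintro _ ⟨n, rfl⟩
      exact (abs_le.1 (hM _ ⟨he0 n, he1 n⟩ r)).1⟩⟩
  choose Z hZlim using hexR
  have hZsol : IsPhaseSolution P f c Z :=
    IsPhaseSolution.of_tendsto hP hf (fun n => (hy _ (he0 n)).1)
      (fun n r => hM _ ⟨he0 n, he1 n⟩ r) helim hZlim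
      fun r => (hZlim r).congr fun n => (hy _ (he0 n)).2 r
  have hZ1 : 0 ≤ Z 1 := ge_of_tendsto (hZlim 1) (Eventually.of_forall fun n => by
    by_contra! hneg
    exact absurd (le_csSup hSbdd (show e n ∈ S from ⟨he0 n, hneg.le⟩)) (not_le.2 (hce n)))
  have hYZ : ∀ r, Y r ≤ Z r := fun r =>
    le_of_tendsto_of_tendsto' (hYlim r) (hZlim r) fun n =>
      hmono _ _ (hdS n).1 ((hdc n).trans (hce n).le) r
  refine ⟨c, Z, hc0, hZsol, fun r hr => hZsol.pos hP hf hc0 hZ1 hr, ?_⟩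
  refine le_antisymm ?_ hZ1
  by_contra! hpos
  exact absurd (hYsol.eq_at_one hP hf hZsol hc0 hYZ hpos) (by linarith)

end PhaseSolution

/-- A function that is monotone between the ends `-1` and `1` stays constant where it reaches
them; differentiability in between extends to the whole line. -/
theorem hasDerivAt_of_hasDerivAt_of_mem_Ioo {q u v : ℝ → ℝ} (hq : Antitone q)
    (hmem : ∀ x, q x ∈ Icc (-1:ℝ) 1) (hu : Continuous u) (hv : Continuous v)
    (hin : ∀ x, q x ∈ Ioo (-1:ℝ) 1 → HasDerivAt u (v x) x) {a b : ℝ}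
    (ha : ∀ x, q x = 1 → u x = a ∧ v x = 0) (hb : ∀ x, q x = -1 → u x = b ∧ v x = 0) (x : ℝ) :
    HasDerivAt u (v x) x := by
  set A : Set ℝ := {x | q x = 1 ∧ ∀ y, x < y → q y < 1} with hA
  set B : Set ℝ := {x | q x = -1 ∧ ∀ y, y < x → -1 < q y} with hB
  have hAc : A.Countable := by
    refine Set.Subsingleton.countable fun x hx y hy => ?_
    rcases lt_trichotomy x y with h | h | h
    · exact absurd hy.1 (hx.2 y h).ne
    · exact h
    · exact absurd hx.1 (hy.2 x h).ne
  have hBc : B.Countable := by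
    refine Set.Subsingleton.countable fun x hx y hy => ?_
    rcases lt_trichotomy x y with h | h | h
    · exact absurd hx.1 (hy.2 x h).ne'
    · exact h
    · exact absurd hy.1 (hx.2 y h).ne'
  have hoff : ∀ x, x ∉ A ∪ B → HasDerivAt u (v x) x := by
    intro x hx
    rw [mem_union, not_or] at hx
    rcases (hmem x).2.lt_or_eq with h1 | h1
    · rcases (hmem x).1.lt_or_eq with h2 | h2
      · exact hin x ⟨h2, h1⟩
      · have : ∃ y, y < x ∧ q y ≤ -1 := by
          by_contra! hcon
          exact hx.2 ⟨h2.symm, hcon⟩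
        obtain ⟨y, hyx, hy⟩ := this
        rw [(hb x h2.symm).2]
        refine (hasDerivAt_const x b).congr_of_eventuallyEq ?_
        filter_upwards [Ioi_mem_nhds hyx] with z hz
        exact (hb z (le_antisymm ((hq (le_of_lt hz)).trans hy) (hmem z).1)).1
    · have : ∃ y, x < y ∧ 1 ≤ q y := by
        by_contra! hcon
        exact hx.1 ⟨h1, hcon⟩
      obtain ⟨y, hyx, hy⟩ := this
      rw [(ha x h1).2]
      refine (hasDerivAt_const x a).congr_of_eventuallyEq ?_
      filter_upwards [Iio_mem_nhds hyx] with z hz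
      exact (ha z (le_antisymm (hmem z).2 (hy.trans (hq (le_of_lt hz))))).1
  have hint : ∀ y, ∫ t in (0:ℝ)..y, v t = u y - u 0 := fun y =>
    integral_eq_of_hasDerivAt_off_countable u v (hAc.union hBc) hu.continuousOn
      (fun t ht => hoff t ht.2) (hv.intervalIntegrable _ _)
  have h := (hv.integral_hasStrictDerivAt 0 x).hasDerivAt.const_add (u 0)
  refine h.congr_of_eventuallyEq (Eventually.of_forall fun y => ?_)
  change u y = u 0 + ∫ t in (0:ℝ)..y, v t
  rw [hint]
  ring

/-- The monotone solution of `q' = -p(q)` connecting two consecutive zeros of `p`. -/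
theorem exists_decreasing_connection {p : ℝ → ℝ} {μ : ℝ} (hμ : μ ∈ Ioo (-1:ℝ) 1)
    (hp : Continuous p) (hpos : ∀ r ∈ Ioo (-1:ℝ) 1, 0 < p r) (hl : p (-1) = 0) (hr : p 1 = 0) :
    ∃ q : ℝ → ℝ, Antitone q ∧ (∀ x, q x ∈ Icc (-1:ℝ) 1) ∧ Tendsto q atBot (nhds 1) ∧
      Tendsto q atTop (nhds (-1)) ∧ q 0 = μ ∧ ∀ x, HasDerivAt q (-p (q x)) x := by
  set G : ℝ → ℝ := fun r => -∫ s in μ..r, (p s)⁻¹ with hG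
  have hGd : ∀ r ∈ Ioo (-1:ℝ) 1, HasStrictDerivAt G (-(p r)⁻¹) r := fun r hr =>
    (hasStrictDerivAt_travelTime hμ hp.continuousOn hpos hr).neg
  have hGc : ∀ r ∈ Ioo (-1:ℝ) 1, ContinuousAt G r := fun r hr => (hGd r hr).hasDerivAt.continuousAt
  have hGanti : StrictAntiOn G (Ioo (-1) 1) := by
    refine strictAntiOn_of_deriv_neg (convex_Ioo _ _)
      (fun r hr => (hGc r hr).continuousWithinAt) fun r hr => ?_
    rw [interior_Ioo] at hr
    rw [(hGd r hr).hasDerivAt.deriv]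
    exact neg_neg_of_pos (inv_pos.2 (hpos r hr))
  have hG0 : G μ = 0 := by simp [hG]
  have hex : ∀ x, ∃ s ∈ Icc (-1:ℝ) 1, (∀ r ∈ Ioo (-1:ℝ) 1, x ≤ G r → r ≤ s) ∧
      ∀ r ∈ Ioo (-1:ℝ) 1, G r ≤ x → s ≤ r := by
    intro x
    set S : Set ℝ := insert (-1) {r | r ∈ Ioo (-1:ℝ) 1 ∧ x ≤ G r} with hS
    have hne : S.Nonempty := insert_nonempty _ _
    have hS1 : ∀ r ∈ S, r ≤ 1 := by
      rintro r (rfl | hr)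
      · norm_num
      · exact hr.1.2.le
    have hbdd : BddAbove S := ⟨1, hS1⟩
    refine ⟨sSup S, ⟨le_csSup hbdd (mem_insert _ _), csSup_le hne hS1⟩,
      fun r hr hx => le_csSup hbdd (mem_insert_of_mem _ ⟨hr, hx⟩), fun r hr hx => ?_⟩
    refine csSup_le hne ?_
    rintro r' (rfl | hr')
    · exact hr.1.le
    · exact (hGanti.le_iff_ge hr hr'.1).1 (hx.trans hr'.2)
  choose q hmem hge hle using hex
  have hlt : ∀ {x r : ℝ}, r ∈ Ioo (-1:ℝ) 1 → r < q x → x < G r := fun hr h =>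
    not_le.1 fun h' => absurd (hle _ _ hr h') (not_le.2 h)
  have hgt : ∀ {x r : ℝ}, r ∈ Ioo (-1:ℝ) 1 → q x < r → G r < x := fun hr h =>
    not_le.1 fun h' => absurd (hge _ _ hr h') (not_le.2 h)
  have hanti : Antitone q := by
    intro x y hxy
    by_contra! h
    obtain ⟨r, hr1, hr2⟩ := exists_between h
    have hr : r ∈ Ioo (-1:ℝ) 1 := ⟨(hmem x).1.trans_lt hr1, hr2.trans_le (hmem y).2⟩
    linarith [hlt hr hr2, hgt hr hr1]
  have hqG : ∀ r ∈ Ioo (-1:ℝ) 1, q (G r) = r := fun r hr =>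
    le_antisymm (hle _ _ hr le_rfl) (hge _ _ hr le_rfl)
  have hqc : Continuous q := by
    refine continuous_iff_continuousAt.2 fun x => tendsto_order.2 ⟨fun a ha => ?_, fun a ha => ?_⟩
    · rcases lt_or_ge a (-1) with h | h
      · exact Eventually.of_forall fun y => h.trans_le (hmem y).1
      · obtain ⟨r, hr1, hr2⟩ := exists_between ha
        have hr : r ∈ Ioo (-1:ℝ) 1 := ⟨h.trans_lt hr1, hr2.trans_le (hmem x).2⟩
        filter_upwards [Iio_mem_nhds (hlt hr hr2)] with y hy
        exact hr1.trans_le (hge _ _ hr (le_of_lt hy))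
    · rcases lt_or_ge 1 a with h | h
      · exact Eventually.of_forall fun y => (hmem y).2.trans_lt h
      · obtain ⟨r, hr1, hr2⟩ := exists_between ha
        have hr : r ∈ Ioo (-1:ℝ) 1 := ⟨(hmem x).1.trans_lt hr1, hr2.trans_le h⟩
        filter_upwards [Ioi_mem_nhds (hgt hr hr1)] with y hy
        exact (hle _ _ hr (le_of_lt hy)).trans_lt hr2
  have hGq : ∀ x, q x ∈ Ioo (-1:ℝ) 1 → G (q x) = x := by
    intro x hx
    refine le_antisymm (not_lt.1 fun h => ?_) (not_lt.1 fun h => ?_)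
    · have h1 : ∀ᶠ r in nhdsWithin (q x) (Ioi (q x)), x < G r :=
        nhdsWithin_le_nhds ((hGc _ hx).eventually (lt_mem_nhds h))
      obtain ⟨r, hr, hr1, hr2⟩ := (h1.and (Ioo_mem_nhdsGT hx.2)).exists
      exact absurd (hge _ _ ⟨hx.1.trans hr1, hr2⟩ hr.le) (not_le.2 hr1)
    · have h1 : ∀ᶠ r in nhdsWithin (q x) (Iio (q x)), G r < x :=
        nhdsWithin_le_nhds ((hGc _ hx).eventually (gt_mem_nhds h))
      obtain ⟨r, hr, hr1, hr2⟩ := (h1.and (Ioo_mem_nhdsLT hx.1)).exists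
      exact absurd (hle _ _ ⟨hr1, hr2.trans hx.2⟩ hr.le) (not_le.2 hr2)
  refine ⟨q, hanti, hmem, ?_, ?_, by rw [← hG0, hqG μ hμ], ?_⟩
  · refine tendsto_order.2 ⟨fun a ha => ?_, fun a ha =>
      Eventually.of_forall fun x => (hmem x).2.trans_lt ha⟩
    obtain ⟨r, hr1, hr2⟩ := exists_between (max_lt ha (by norm_num : (-1:ℝ) < 1))
    filter_upwards [eventually_le_atBot (G r)] with x hx
    exact ((le_max_left _ _).trans_lt hr1).trans_le
      (hge x r ⟨(le_max_right _ _).trans_lt hr1, hr2⟩ hx)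
  · refine tendsto_order.2 ⟨fun a ha =>
      Eventually.of_forall fun x => ha.trans_le (hmem x).1, fun a ha => ?_⟩
    obtain ⟨r, hr1, hr2⟩ := exists_between (lt_min ha (by norm_num : (-1:ℝ) < 1))
    filter_upwards [eventually_ge_atTop (G r)] with x hx
    exact (hle x r ⟨hr1, hr2.trans_le (min_le_right _ _)⟩ hx).trans_lt
      (hr2.trans_le (min_le_left _ _))
  · refine hasDerivAt_of_hasDerivAt_of_mem_Ioo hanti hmem hqc (hp.comp hqc).neg
      (fun x hx => ?_) (a := 1) (b := -1) (fun x hx => ⟨hx, by simp [hx, hr]⟩)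
      fun x hx => ⟨hx, by simp [hx, hl]⟩
    have h := (hGd _ hx).to_local_left_inverse (neg_ne_zero.2 (inv_ne_zero (hpos _ hx).ne'))
      ((Ioo_mem_nhds hx.1 hx.2 |> fun h => mem_of_superset h fun r hr => hqG r hr))
    rw [hGq x hx, inv_neg, inv_inv] at h
    exact h.hasDerivAt

section Existence

variable {φ Θ V P f : ℝ → ℝ} {μ : ℝ} (hP : PhaseCoordinates φ Θ V P)
  (hφodd : ∀ s, φ (-s) = -φ s) (hf : IsBistable f μ)

include hP hφodd hf in
theorem IsPhaseSolution.exists_isTW {c : ℝ} {Z : ℝ → ℝ} (hZ : IsPhaseSolution P f c Z)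
    (hpos : ∀ r ∈ Ioo (-1:ℝ) 1, 0 < Z r) (h1 : Z 1 = 0) :
    ∃ q, IsTW φ f μ q c ∧ ∀ x, HasDerivAt q (-P (Z (q x))) x := by
  have hP0 : P 0 = 0 := hP.slope_of_nonpos 0 le_rfl
  have hl := hZ.at_neg_one
  have hpc : Continuous fun s => P (Z s) := hP.slope_continuous.comp hZ.1
  obtain ⟨q, hanti, hmem, hbot, htop, h0, hd⟩ := exists_decreasing_connection hf.mid_mem hpc
    (fun r hr => hP.slope_pos _ (hpos r hr)) (by rw [hl, hP0]) (by rw [h1, hP0])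
  have hderiv : deriv q = fun x => -P (Z (q x)) := funext fun x => (hd x).deriv
  have hqd : Differentiable ℝ q := fun x => (hd x).differentiableAt
  have hqc := hqd.continuous
  refine ⟨q, ⟨contDiff_one_iff_deriv.2 ⟨hqd, ?_⟩, fun x => ?_, fun x => ?_, hbot, htop, h0⟩, hd⟩
  · rw [hderiv]
    exact (hpc.comp hqc).neg
  · have hZ0 : ∀ x, 0 ≤ Z (q x) := fun x => by
      rcases (hmem x).1.eq_or_lt with h | h
      · rw [← h, hl]
      rcases (hmem x).2.eq_or_lt with h' | h'
      · rw [h', h1]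
      · exact (hpos _ ⟨h, h'⟩).le
    have hfun : (fun y => φ (deriv q y)) = fun y => -V (Z (q y)) := funext fun y => by
      simp only [hderiv, hφodd, hP.flux_slope _ (hZ0 y)]
    have key := hasDerivAt_of_hasDerivAt_of_mem_Ioo (u := fun y => -V (Z (q y)))
      (v := fun y => c * P (Z (q y)) - f (q y)) (a := 0) (b := 0) hanti hmem
      (hP.inv_continuous.comp (hZ.1.comp hqc)).neg
      ((continuous_const.mul (hpc.comp hqc)).sub (hf.continuous.comp hqc))
      (fun y hy => ?_)
      (fun y hy => by simp [hy, h1, hP.inv_zero, hP0, hf.one])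
      (fun y hy => by simp [hy, hl, hP.inv_zero, hP0, hf.neg_one]) x
    · rw [hfun]
      refine key.congr_deriv ?_
      rw [hderiv]
      ring
    · have hV := hP.hasDerivAt_inv _ (hpos _ hy)
      have hp := (hP.slope_pos _ (hpos _ hy)).ne'
      refine (hV.comp y ((hZ.hasDerivAt hP hf hy).comp y (hd y))).neg.congr_deriv ?_
      field_simp
  · rw [hderiv]
    exact neg_nonpos.2 (hP.slope_nonneg _)

end Existence

theorem IsTW.integrable_deriv {φ f q : ℝ → ℝ} {μ c : ℝ} (h : IsTW φ f μ q c) :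
    Integrable (deriv q) := by
  have hc : Continuous (deriv q) := h.1.continuous_deriv le_rfl
  refine integrable_of_intervalIntegral_norm_bounded (l := atTop) 2
    (fun i : ℝ => (hc.integrableOn_Icc (a := -i) (b := i)).mono_set Ioc_subset_Icc_self)
    tendsto_neg_atTop_atBot tendsto_id (Eventually.of_forall fun i => ?_)
  have hnorm : ∀ x, ‖deriv q x‖ = -deriv q x := fun x => by
    rw [Real.norm_eq_abs, abs_of_nonpos (h.2.2.1 x)]
  simp only [hnorm, intervalIntegral.integral_neg]
  rw [intervalIntegral.integral_deriv_eq_sub (fun x _ => h.1.differentiable one_ne_zero x)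
    (hc.intervalIntegrable _ _)]
  linarith [(h.mem_Icc i).1, (h.mem_Icc (-i)).2]

/-- The dissipation of a wave profile, computed in the phase plane. -/
theorem integral_sq_deriv_eq {p q : ℝ → ℝ} (hp : Continuous p)
    (hd : ∀ x, HasDerivAt q (-p (q x)) x) (hbot : Tendsto q atBot (nhds 1))
    (htop : Tendsto q atTop (nhds (-1))) (hint : Integrable fun x => deriv q x ^ 2) :
    ∫ x, deriv q x ^ 2 = ∫ s in (-1:ℝ)..1, p s := by
  have hK : ∀ r, HasDerivAt (fun r => ∫ s in (-1:ℝ)..r, p s) (p r) r := fun r =>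
    (hp.integral_hasStrictDerivAt (-1) r).hasDerivAt
  have hKd : ∀ x, HasDerivAt (fun x => ∫ s in (-1:ℝ)..q x, p s) (-deriv q x ^ 2) x := fun x =>
    ((hK (q x)).comp x (hd x)).congr_deriv (by rw [(hd x).deriv]; ring)
  have h := integral_of_hasDerivAt_of_tendsto hKd hint.neg
    ((hK 1).continuousAt.tendsto.comp hbot) ((hK (-1)).continuousAt.tendsto.comp htop)
  rw [integral_neg, intervalIntegral.integral_same] at h
  linarith

/-- Proposition 3.1 / `prop-TW`: existence and uniqueness of
the travelling wave `[q, c]`, together with `q' ∈ L¹ ∩ L^∞`, strict negativity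
of `q'` where `-1 < q < 1`, the formula
`c = (∫ |q'|²)⁻¹ ∫_{-1}^1 f ≥ 0`, and `c > 0 ↔ ∫_{-1}^1 f > 0`. -/
theorem stmt_1
    (f : ℝ → ℝ) (μ : ℝ) (hμ : μ ∈ Ioo (-1:ℝ) 1)
    (hfLip : ∃ K : NNReal, LipschitzWith K f)
    (hfm1 : f (-1) = 0) (hfμ : f μ = 0) (hf1 : f 1 = 0)
    (hfneg : ∀ s ∈ Ioo (-1:ℝ) μ, f s < 0)
    (hfpos : ∀ s ∈ Ioo μ (1:ℝ), 0 < f s)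
    (hF : ∀ r ∈ Ioo (-1:ℝ) 1, 0 < ∫ s in r..(1:ℝ), f s)
    -- φ = Φ' for a diffusion potential Φ(z) = φ₀(|z|) as in the context
    (φ : ℝ → ℝ) (Λ₁ Λ₂ : ℝ) (hΛ₁ : 0 < Λ₁) (hΛ₂ : 0 < Λ₂)
    (hφcont : Continuous φ)
    (hφodd : ∀ s, φ (-s) = - φ s)
    (hφmono : StrictMono φ)
    (hφtop : Tendsto φ atTop atTop)
    (hφbot : Tendsto φ atBot atBot)
    (hφdiff : ∀ z : ℝ, 0 < z → DifferentiableAt ℝ φ z)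
    (hΛ : ∀ z : ℝ, 0 < z →
      Λ₁ * φ z ≤ z * deriv φ z ∧ z * deriv φ z ≤ Λ₂ * φ z) :
    ∃ q : ℝ → ℝ, ∃ c : ℝ,
      IsTW φ f μ q c ∧
      (∀ q' : ℝ → ℝ, ∀ c' : ℝ, IsTW φ f μ q' c' → q' = q ∧ c' = c) ∧
      Integrable (deriv q) ∧
      (∃ C : ℝ, ∀ x : ℝ, |deriv q x| ≤ C) ∧
      (∀ x : ℝ, q x ∈ Ioo (-1:ℝ) 1 → deriv q x < 0) ∧
      c = (∫ x : ℝ, (deriv q x) ^ 2)⁻¹ * (∫ s in (-1:ℝ)..(1:ℝ), f s) ∧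
      0 ≤ c ∧
      (0 < c ↔ 0 < ∫ s in (-1:ℝ)..(1:ℝ), f s) := by
  obtain ⟨K, hK⟩ := hfLip
  have hf : IsBistable f μ := ⟨hμ, hK.continuous, hfm1, hf1, hfneg, hfpos, hF⟩
  obtain ⟨Θ, V, P, hP⟩ := exists_phaseCoordinates φ Λ₁ hΛ₁ hφcont hφodd hφmono hφtop hφbot hφdiff
    fun z hz => (hΛ z hz).1
  obtain ⟨c, Z, hc, hZ, hpos, h1⟩ := exists_connecting_phaseSolution hP hf
  obtain ⟨q, hq, hd⟩ := hZ.exists_isTW hP hφodd hf hpos h1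
  obtain ⟨M, hM0, hM⟩ := hq.exists_deriv_bound hP hφcont hφodd hf
  have habs : ∀ x, |deriv q x| ≤ M := fun x => by
    rw [abs_of_nonpos (hq.2.2.1 x)]
    exact hM x
  have hpc : Continuous fun s => P (Z s) := hP.slope_continuous.comp hZ.1
  have hint : Integrable fun x => deriv q x ^ 2 := by
    simp only [sq]
    exact hq.integrable_deriv.bdd_mul hq.integrable_deriv.aestronglyMeasurable
      (Eventually.of_forall habs)
  have hI := integral_sq_deriv_eq hpc hd hq.2.2.2.1 hq.2.2.2.2.1 hint
  have hIpos : 0 < ∫ x, deriv q x ^ 2 := by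
    rw [hI]
    exact intervalIntegral.intervalIntegral_pos_of_pos_on (hpc.intervalIntegrable _ _)
      (fun s hs => hP.slope_pos _ (hpos s hs)) (by norm_num)
  have hbal : c * ∫ x, deriv q x ^ 2 = ∫ s in (-1:ℝ)..1, f s := by
    have := hZ.eq_on_Icc (r := 1) (by norm_num)
    rw [hI]
    linarith
  refine ⟨q, c, hq, fun q' c' h => h.unique hP hφcont hφodd hφmono hf hq, hq.integrable_deriv,
    ⟨M, habs⟩, fun x hx => hq.deriv_neg hP hφcont hφodd hφmono hf hx, ?_, hc, ?_⟩
  · rw [← hbal]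
    field_simp
  · rw [← hbal]
    exact (mul_pos_iff_of_pos_right hIpos).symm
end

section
/- Let H = ψ ∘ (Ψ|_{[0,∞)})⁻¹ and let c₁, c₂ ∈ ℝ satisfy c₁ ≥ c₂ and c₁ ≥ 0. Assume z₁, z₂ : [−1,1] → ℝ are absolutely continuous functions satisfying z₁'(r) + c₁ H(z₁(r)⁺) = f(−r) and z₂'(r) + c₂ H(z₂(r)⁺) = f(−r) for almost every r ∈ (−1,1), such that z₁(r) > 0 for all r ∈ (−1,1) and z₁(−1) = z₁(1) = z₂(−1) = z₂(1) = 0. Then c₁ = c₂ and z₁ ≡ z₂ on [−1,1]. -/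
open MeasureTheory Set Filter
open Topology

/-- A continuous function starting at a nonnegative value stays nonnegative if its derivative is
nonnegative wherever the function is negative. -/
lemma nonneg_of_deriv_nonneg_of_neg {a b : ℝ} {w w' : ℝ → ℝ} (hw : ContinuousOn w (Icc a b))
    (hw' : ∀ x ∈ Ioo a b, HasDerivAt w (w' x) x) (ha : 0 ≤ w a)
    (h : ∀ x ∈ Ioo a b, w x < 0 → 0 ≤ w' x) : ∀ x ∈ Icc a b, 0 ≤ w x := by
  intro x hx
  by_contra! hneg
  have hwx : ContinuousOn w (Icc a x) := hw.mono (Icc_subset_Icc_right hx.2)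
  obtain ⟨t, ⟨ht, ht0⟩, hmax⟩ : ∃ t, IsGreatest (Icc a x ∩ w ⁻¹' Ici 0) t :=
    (isCompact_Icc.of_isClosed_subset (hwx.preimage_isClosed_of_isClosed isClosed_Icc isClosed_Ici)
      inter_subset_left).exists_isGreatest ⟨a, left_mem_Icc.2 hx.1, ha⟩
  have hmono : MonotoneOn w (Icc t x) := by
    refine monotoneOn_of_hasDerivWithinAt_nonneg (f' := w') (convex_Icc t x)
      (hwx.mono (Icc_subset_Icc_left ht.1)) ?_ ?_ <;>
    · rw [interior_Icc]
      intro y hy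
      have hy' : y ∈ Ioo a b := ⟨ht.1.trans_lt hy.1, hy.2.trans_le hx.2⟩
      first
      | exact (hw' y hy').hasDerivWithinAt
      | refine h y hy' (not_le.1 fun h0 ↦ hy.1.not_ge ?_)
        exact hmax ⟨⟨hy'.1.le, hy.2.le⟩, h0⟩
  have := hmono (left_mem_Icc.2 ht.2) (right_mem_Icc.2 ht.2) ht.2
  exact absurd (le_trans ht0 this) (not_le.2 hneg)

/-- A primitive of an integrable function is continuous. -/
lemma continuousOn_of_eq_add_integral {a b : ℝ} {z d : ℝ → ℝ} (hab : a ≤ b)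
    (hd : IntegrableOn d (Icc a b)) (hz : ∀ r ∈ Icc a b, z r = z a + ∫ s in a..r, d s) :
    ContinuousOn z (Icc a b) := by
  have := intervalIntegral.continuousOn_primitive_interval (μ := volume) (f := d) (a := a) (b := b)
    (by rwa [uIcc_of_le hab])
  rw [uIcc_of_le hab] at this
  exact (continuousOn_const.add this).congr hz

/-- A primitive of a function which agrees a.e. with a continuous function `g` is differentiable
with derivative `g`. -/
lemma hasDerivAt_of_eq_add_integral {a b : ℝ} {z d g : ℝ → ℝ}
    (hz : ∀ r ∈ Icc a b, z r = z a + ∫ s in a..r, d s) (hg : ContinuousOn g (Icc a b))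
    (hdg : ∀ᵐ r ∂(volume.restrict (Ioo a b)), d r = g r) :
    ∀ r ∈ Ioo a b, HasDerivAt z (g r) r := by
  intro r hr
  have hab : a ≤ b := (hr.1.trans hr.2).le
  have hG : Continuous (IccExtend hab ((Icc a b).domRestrict g)) := hg.domRestrict.Icc_extend'
  have hGg : ∀ s ∈ Icc a b, IccExtend hab ((Icc a b).domRestrict g) s = g s := fun s hs ↦ by
    rw [IccExtend_of_mem _ _ hs, domRestrict_apply]
  have hder := (hG.integral_hasStrictDerivAt a r).hasDerivAt.const_add (z a)
  rw [hGg r (Ioo_subset_Icc_self hr)] at hder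
  refine hder.congr_of_eventuallyEq ?_
  filter_upwards [Ioo_mem_nhds hr.1 hr.2] with t ht
  rw [hz t (Ioo_subset_Icc_self ht)]
  congr 1
  refine intervalIntegral.integral_congr_ae_restrict ?_
  rw [uIoc_of_le ht.1.le]
  have hsub : Ioc a t ⊆ Ioo a b := fun s hs ↦ ⟨hs.1, hs.2.trans_lt ht.2⟩
  filter_upwards [ae_restrict_of_ae_restrict_of_subset hsub hdg,
    ae_restrict_mem measurableSet_Ioc] with s hs hs'
  rw [hs, hGg s (Ioo_subset_Icc_self (hsub hs'))]

/-- A monotone map of `[0, ∞)` onto itself is continuous after extension by its value at `0`. -/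
lemma continuous_comp_max_zero {h : ℝ → ℝ} (hmono : MonotoneOn h (Ici 0))
    (hmaps : MapsTo h (Ici 0) (Ici 0)) (hsurj : SurjOn h (Ici 0) (Ici 0)) :
    Continuous fun y ↦ h (max y 0) := by
  have h0 : h 0 = 0 := by
    obtain ⟨x, hx, hx0⟩ := hsurj (mem_Ici.2 le_rfl)
    exact le_antisymm (hx0 ▸ hmono (mem_Ici.2 le_rfl) hx hx) (hmaps (mem_Ici.2 le_rfl))
  have hK : Continuous fun y ↦ h (max y 0) + min y 0 := by
    refine Monotone.continuous_of_surjective (fun x y hxy ↦ ?_) fun y ↦ ?_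
    · exact add_le_add (hmono (mem_Ici.2 (le_max_right _ _)) (mem_Ici.2 (le_max_right _ _))
        (max_le_max_right 0 hxy)) (min_le_min_right 0 hxy)
    · rcases le_total 0 y with hy | hy
      · obtain ⟨x, hx, rfl⟩ := hsurj hy
        exact ⟨x, by simp [max_eq_left (mem_Ici.1 hx), min_eq_right (mem_Ici.1 hx)]⟩
      · exact ⟨y, by simp [max_eq_right hy, min_eq_left hy, h0]⟩
  simpa [Pi.sub_def] using hK.sub (continuous_id.min (continuous_const (y := (0 : ℝ))))

/-- Comparison principle for `z' + c h(z) = g` with `h` monotone and nonnegative, and `c ≥ 0`. -/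
lemma le_of_hasDerivAt_sub_mul {a b c₁ c₂ : ℝ} {g h z₁ z₂ : ℝ → ℝ} (hh : Monotone h)
    (hh0 : ∀ y, 0 ≤ h y) (hc : c₂ ≤ c₁) (hc₁ : 0 ≤ c₁) (hz₁ : ContinuousOn z₁ (Icc a b))
    (hz₂ : ContinuousOn z₂ (Icc a b))
    (hd₁ : ∀ r ∈ Ioo a b, HasDerivAt z₁ (g r - c₁ * h (z₁ r)) r)
    (hd₂ : ∀ r ∈ Ioo a b, HasDerivAt z₂ (g r - c₂ * h (z₂ r)) r)
    (ha : z₁ a ≤ z₂ a) : ∀ r ∈ Icc a b, z₁ r ≤ z₂ r := by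
  intro r hr
  refine sub_nonneg.1 (nonneg_of_deriv_nonneg_of_neg (hz₂.sub hz₁)
    (fun x hx ↦ (hd₂ x hx).sub (hd₁ x hx)) (sub_nonneg.2 ha) (fun x _ hneg ↦ ?_) r hr)
  have hlt : z₂ x ≤ z₁ x := (sub_neg.1 hneg).le
  nlinarith [mul_nonneg hc₁ (sub_nonneg.2 (hh hlt)), mul_nonneg (sub_nonneg.2 hc) (hh0 (z₂ x))]

/-- The convex conjugate of an even convex function vanishing at `0` vanishes at `0`. -/
lemma iSup_neg_eq_zero_of_even_convex {Φ : ℝ → ℝ} (heven : ∀ s, Φ (-s) = Φ s) (h0 : Φ 0 = 0)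
    (hconv : ConvexOn ℝ univ Φ) : ⨆ s : ℝ, (s * 0 - Φ s) = 0 := by
  have hΦ : ∀ s, s * 0 - Φ s ≤ 0 := fun s ↦ by
    have := hconv.2 (mem_univ s) (mem_univ (-s)) (by norm_num : (0 : ℝ) ≤ 1 / 2)
      (by norm_num : (0 : ℝ) ≤ 1 / 2) (by norm_num)
    simp only [smul_eq_mul, heven] at this
    rw [show (1 / 2 : ℝ) * s + 1 / 2 * -s = 0 by ring, h0] at this
    linarith
  refine le_antisymm (ciSup_le hΦ) ?_
  simpa [h0] using le_ciSup (f := fun s : ℝ ↦ s * 0 - Φ s) ⟨0, forall_mem_range.2 hΦ⟩ 0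

/-- Proposition 3.6 / `prop-unique_c`: uniqueness of the wave
speed.  Here `H = ψ ∘ (Ψ|_{[0,∞)})⁻¹`, where `Ψ` is the convex conjugate of
the diffusion potential `Φ` and `ψ = Ψ'` is the inverse of `φ = Φ'`.  If
`c₁ ≥ c₂`, `c₁ ≥ 0`, and `z₁, z₂` are absolutely continuous solutions of
`zᵢ' + cᵢ H(zᵢ⁺) = f(-r)` a.e. on `(-1,1)` with `z₁ > 0` on `(-1,1)` and
`z₁(±1) = z₂(±1) = 0`, then `c₁ = c₂` and `z₁ ≡ z₂` on `[-1,1]`. -/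
theorem stmt_2
    (f : ℝ → ℝ) (μ : ℝ) (hμ : μ ∈ Ioo (-1:ℝ) 1)
    (hfLip : ∃ K : NNReal, LipschitzWith K f)
    (hfm1 : f (-1) = 0) (hfμ : f μ = 0) (hf1 : f 1 = 0)
    (hfneg : ∀ s ∈ Ioo (-1:ℝ) μ, f s < 0)
    (hfpos : ∀ s ∈ Ioo μ (1:ℝ), 0 < f s)
    (hF : ∀ r ∈ Ioo (-1:ℝ) 1, 0 < ∫ s in r..(1:ℝ), f s)
    (Φ φ Ψ ψ Ψinv H : ℝ → ℝ)
    (hΦderiv : ∀ s, HasDerivAt Φ (φ s) s)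
    (hΦeven : ∀ s, Φ (-s) = Φ s)
    (hΦ0 : Φ 0 = 0)
    (hΦconv : StrictConvexOn ℝ univ Φ)
    (hφodd : ∀ s, φ (-s) = - φ s)
    (hφmono : StrictMono φ)
    (hφtop : Tendsto φ atTop atTop)
    (hφbot : Tendsto φ atBot atBot)
    (hΨ : ∀ t, Ψ t = ⨆ s : ℝ, (s * t - Φ s))
    (hΨderiv : ∀ t, HasDerivAt Ψ (ψ t) t)
    (hψφ : ∀ s, ψ (φ s) = s)
    (hφψ : ∀ t, φ (ψ t) = t)
    (hΨinv0 : ∀ y ∈ Ici (0:ℝ), Ψinv y ∈ Ici (0:ℝ) ∧ Ψ (Ψinv y) = y)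
    (hΨinv1 : ∀ v ∈ Ici (0:ℝ), Ψinv (Ψ v) = v)
    (hH : ∀ y, H y = ψ (Ψinv y))
    (c₁ c₂ : ℝ) (hc₁₂ : c₂ ≤ c₁) (hc₁ : 0 ≤ c₁)
    (z₁ z₂ d₁ d₂ : ℝ → ℝ)
    (hd₁int : IntegrableOn d₁ (Icc (-1:ℝ) 1))
    (hd₂int : IntegrableOn d₂ (Icc (-1:ℝ) 1))
    (hz₁ : ∀ r ∈ Icc (-1:ℝ) 1, z₁ r = z₁ (-1) + ∫ s in (-1:ℝ)..r, d₁ s)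
    (hz₂ : ∀ r ∈ Icc (-1:ℝ) 1, z₂ r = z₂ (-1) + ∫ s in (-1:ℝ)..r, d₂ s)
    (hd₁ : ∀ᵐ r ∂(volume.restrict (Ioo (-1:ℝ) 1)), d₁ r = deriv z₁ r)
    (hd₂ : ∀ᵐ r ∂(volume.restrict (Ioo (-1:ℝ) 1)), d₂ r = deriv z₂ r)
    (hode₁ : ∀ᵐ r ∂(volume.restrict (Ioo (-1:ℝ) 1)),
      d₁ r + c₁ * H (max (z₁ r) 0) = f (-r))
    (hode₂ : ∀ᵐ r ∂(volume.restrict (Ioo (-1:ℝ) 1)),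
      d₂ r + c₂ * H (max (z₂ r) 0) = f (-r))
    (hz₁pos : ∀ r ∈ Ioo (-1:ℝ) 1, 0 < z₁ r)
    (hbc₁ : z₁ (-1) = 0 ∧ z₁ 1 = 0)
    (hbc₂ : z₂ (-1) = 0 ∧ z₂ 1 = 0) :
    c₁ = c₂ ∧ ∀ r ∈ Icc (-1:ℝ) 1, z₁ r = z₂ r := by
  have hφ0 : φ 0 = 0 := by have := hφodd 0; rw [neg_zero] at this; linarith
  have hψ0 : ψ 0 = 0 := by rw [← hφ0, hψφ, hφ0]
  have hψmono : StrictMono ψ := fun a b hab ↦ by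
    rwa [← hφmono.lt_iff_lt, hφψ, hφψ]
  have hψpos : ∀ v, 0 < v → 0 < ψ v := fun v hv ↦ hψ0 ▸ hψmono hv
  have hΨzero : Ψ 0 = 0 := by
    rw [hΨ, iSup_neg_eq_zero_of_even_convex hΦeven hΦ0 hΦconv.convexOn]
  have hΨmono : StrictMonoOn Ψ (Ici 0) := by
    refine strictMonoOn_of_hasDerivWithinAt_pos (convex_Ici 0)
      (fun t _ ↦ (hΨderiv t).continuousAt.continuousWithinAt)
      (fun t _ ↦ (hΨderiv t).hasDerivWithinAt) fun t ht ↦ hψpos t ?_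
    rwa [interior_Ici] at ht
  have hΨnonneg : ∀ v ∈ Ici (0:ℝ), 0 ≤ Ψ v := fun v hv ↦
    hΨzero ▸ hΨmono.monotoneOn (mem_Ici.2 le_rfl) hv hv
  have hΨinv_zero : Ψinv 0 = 0 := by simpa [hΨzero] using hΨinv1 0 (mem_Ici.2 le_rfl)
  have hΨinv_mono : StrictMonoOn Ψinv (Ici 0) := fun x hx y hy hxy ↦ by
    rwa [← hΨmono.lt_iff_lt (hΨinv0 x hx).1 (hΨinv0 y hy).1, (hΨinv0 x hx).2, (hΨinv0 y hy).2]
  have hΨinv_pos : ∀ y, 0 < y → 0 < Ψinv y := fun y hy ↦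
    hΨinv_zero ▸ hΨinv_mono (mem_Ici.2 le_rfl) hy.le hy
  have hΨinv_cont : Continuous fun y ↦ Ψinv (max y 0) :=
    continuous_comp_max_zero hΨinv_mono.monotoneOn (fun y hy ↦ (hΨinv0 y hy).1)
      fun v hv ↦ ⟨Ψ v, hΨnonneg v hv, hΨinv1 v hv⟩
  have hHmono : StrictMonoOn H (Ici 0) := fun x hx y hy hxy ↦ by
    rw [hH, hH]; exact hψmono (hΨinv_mono hx hy hxy)
  have hHpos : ∀ y, 0 < y → 0 < H y := fun y hy ↦ by
    rw [hH]; exact hψpos _ (hΨinv_pos y hy)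
  have hH0 : H 0 = 0 := by rw [hH, hΨinv_zero, hψ0]
  have hHnonneg : ∀ y ∈ Ici (0:ℝ), 0 ≤ H y := fun y hy ↦
    hH0 ▸ hHmono.monotoneOn (mem_Ici.2 le_rfl) hy hy
  have hHcont : Continuous fun y ↦ H (max y 0) := by
    refine continuous_comp_max_zero hHmono.monotoneOn hHnonneg fun v hv ↦ ?_
    have hφv : 0 ≤ φ v := hφ0 ▸ hφmono.monotone hv
    exact ⟨Ψ (φ v), hΨnonneg _ hφv, by rw [hH, hΨinv1 _ hφv, hψφ]⟩
  have hHmono' : Monotone fun y ↦ H (max y 0) := fun x y hxy ↦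
    hHmono.monotoneOn (mem_Ici.2 (le_max_right _ _)) (mem_Ici.2 (le_max_right _ _))
    (max_le_max_right 0 hxy)
  have hHnonneg' : ∀ y, 0 ≤ H (max y 0) := fun y ↦ hHnonneg _ (mem_Ici.2 (le_max_right _ _))
  have hΨinv_deriv : ∀ y, 0 < y → HasDerivAt Ψinv (H y)⁻¹ y := fun y hy ↦ by
    have hc : ContinuousAt Ψinv y := hΨinv_cont.continuousAt.congr <| by
      filter_upwards [Ioi_mem_nhds hy] with x hx
      rw [max_eq_left (le_of_lt hx)]
    rw [hH]
    refine (hΨderiv (Ψinv y)).of_local_left_inverse hc (hψpos _ (hΨinv_pos y hy)).ne' ?_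
    filter_upwards [Ioi_mem_nhds hy] with x hx using (hΨinv0 x (Ioi_subset_Ici_self hx)).2
  have hfcont : Continuous f := hfLip.choose_spec.continuous
  have hz₁c := continuousOn_of_eq_add_integral (by norm_num) hd₁int hz₁
  have hz₂c := continuousOn_of_eq_add_integral (by norm_num) hd₂int hz₂
  have hD₁ : ∀ r ∈ Ioo (-1:ℝ) 1, HasDerivAt z₁ (f (-r) - c₁ * H (max (z₁ r) 0)) r :=
    hasDerivAt_of_eq_add_integral hz₁
      ((hfcont.comp continuous_neg).continuousOn.sub
        (continuousOn_const.mul (hHcont.comp_continuousOn hz₁c)))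
      (hode₁.mono fun r hr ↦ eq_sub_of_add_eq hr)
  have hD₂ : ∀ r ∈ Ioo (-1:ℝ) 1, HasDerivAt z₂ (f (-r) - c₂ * H (max (z₂ r) 0)) r :=
    hasDerivAt_of_eq_add_integral hz₂
      ((hfcont.comp continuous_neg).continuousOn.sub
        (continuousOn_const.mul (hHcont.comp_continuousOn hz₂c)))
      (hode₂.mono fun r hr ↦ eq_sub_of_add_eq hr)
  have hle : ∀ r ∈ Icc (-1:ℝ) 1, z₁ r ≤ z₂ r :=
    le_of_hasDerivAt_sub_mul hHmono' hHnonneg' hc₁₂ hc₁ hz₁c hz₂c hD₁ hD₂ (by rw [hbc₁.1, hbc₂.1])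
  have hz₂pos : ∀ r ∈ Ioo (-1:ℝ) 1, 0 < z₂ r := fun r hr ↦
    (hz₁pos r hr).trans_le (hle r (Ioo_subset_Icc_self hr))
  -- In the variable `Ψinv ∘ z` the equation, run backwards from `r = 1`, is again monotone.
  have hback : ∀ s ∈ Icc (-1:ℝ) μ, 0 ≤ Ψinv (max (z₁ (-s)) 0) - Ψinv (max (z₂ (-s)) 0) := by
    have hmaps : MapsTo (fun s : ℝ ↦ -s) (Icc (-1) μ) (Icc (-1) 1) := fun s hs ↦
      ⟨by linarith [hs.2, hμ.2], by linarith [hs.1]⟩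
    have hIoo : ∀ s ∈ Ioo (-1:ℝ) μ, -s ∈ Ioo (-1:ℝ) 1 := fun s hs ↦
      ⟨by linarith [hs.2, hμ.2], by linarith [hs.1]⟩
    have hv : ∀ {z : ℝ → ℝ} {z' s : ℝ}, 0 < z (-s) → HasDerivAt z z' (-s) →
        HasDerivAt (fun s ↦ Ψinv (max (z (-s)) 0)) (-((H (z (-s)))⁻¹ * z')) s := by
      intro z z' s hpos hz
      have hzs : HasDerivAt (fun s ↦ z (-s)) (-z') s := by
        simpa [Function.comp_def] using hz.comp s (hasDerivAt_neg s)
      have h := (hΨinv_deriv _ hpos).comp s hzs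
      rw [mul_neg] at h
      refine h.congr_of_eventuallyEq ?_
      filter_upwards [hzs.continuousAt.eventually_const_lt hpos] with t ht
      simp only [Function.comp_apply, max_eq_left ht.le]
    refine nonneg_of_deriv_nonneg_of_neg
      ((hΨinv_cont.comp_continuousOn (hz₁c.comp continuous_neg.continuousOn hmaps)).sub
        (hΨinv_cont.comp_continuousOn (hz₂c.comp continuous_neg.continuousOn hmaps)))
      (fun s hs ↦ (hv (hz₁pos _ (hIoo s hs)) (hD₁ _ (hIoo s hs))).sub
        (hv (hz₂pos _ (hIoo s hs)) (hD₂ _ (hIoo s hs)))) ?_ fun s hs hneg ↦ ?_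
    · simp [hbc₁.2, hbc₂.2]
    · have h1 := hz₁pos _ (hIoo s hs)
      have h2 := hz₂pos _ (hIoo s hs)
      have hHle : H (z₁ (-s)) ≤ H (z₂ (-s)) :=
        hHmono.monotoneOn h1.le h2.le (hle _ (Ioo_subset_Icc_self (hIoo s hs)))
      have hH1 := hHpos _ h1
      have hH2 := hHpos _ h2
      have hinv : (H (z₂ (-s)))⁻¹ ≤ (H (z₁ (-s)))⁻¹ := inv_anti₀ hH1 hHle
      have hf := hfneg s hs
      rw [max_eq_left h1.le, max_eq_left h2.le, neg_neg]
      have e1 : (H (z₁ (-s)))⁻¹ * (f s - c₁ * H (z₁ (-s))) = (H (z₁ (-s)))⁻¹ * f s - c₁ := by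
        field_simp
      have e2 : (H (z₂ (-s)))⁻¹ * (f s - c₂ * H (z₂ (-s))) = (H (z₂ (-s)))⁻¹ * f s - c₂ := by
        field_simp
      rw [e1, e2]
      nlinarith
  have heq : ∀ r ∈ Ioo (-μ) 1, z₁ r = z₂ r := fun r hr ↦ by
    have hr' : r ∈ Ioo (-1:ℝ) 1 := ⟨by linarith [hr.1, hμ.2], hr.2⟩
    have h := hback (-r) ⟨by linarith [hr.2], by linarith [hr.1]⟩
    rw [neg_neg, max_eq_left (hz₁pos r hr').le, max_eq_left (hz₂pos r hr').le, sub_nonneg,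
      hΨinv_mono.le_iff_le (hz₂pos r hr').le (hz₁pos r hr').le] at h
    exact le_antisymm (hle r (Ioo_subset_Icc_self hr')) h
  have hc : c₁ = c₂ := by
    obtain ⟨r, hr⟩ : (Ioo (-μ) 1).Nonempty := nonempty_Ioo.2 (by linarith [hμ.1])
    have hr' : r ∈ Ioo (-1:ℝ) 1 := ⟨by linarith [hr.1, hμ.2], hr.2⟩
    have h := (hD₂ r hr').congr_of_eventuallyEq
      (show z₁ =ᶠ[𝓝 r] z₂ from eventually_of_mem (Ioo_mem_nhds hr.1 hr.2) heq)
    have h := (hD₁ r hr').unique h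
    rw [heq r hr, max_eq_left (hz₂pos r hr').le] at h
    exact mul_right_cancel₀ (hHpos _ (hz₂pos r hr')).ne' (by linarith)
  subst hc
  exact ⟨rfl, fun r hr ↦ le_antisymm (hle r hr) <|
    le_of_hasDerivAt_sub_mul hHmono' hHnonneg' le_rfl hc₁ hz₂c hz₁c hD₂ hD₁
      (by rw [hbc₁.1, hbc₂.1]) r hr⟩
end

section
/- Let H = ψ ∘ (Ψ|_{[0,∞)})⁻¹, and for each c ≥ 0 let z_c : [−1,1] → ℝ be the unique absolutely continuous solution of the initial value problem z'(r) + c H(z(r)⁺) = f(−r) for a.e. r ∈ (−1,1), z(−1) = 0. Then lim_{c→+∞} z_c(1) < 0; in particular, there exists c₀ > 0 such that z_c(1) < 0 for every c ≥ c₀. -/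
open MeasureTheory Set Filter

/-- A primitive of `d` whose derivative is almost everywhere at most `g` on `{z > ε}` grows, on an
interval where `z > ε`, at most as much as a primitive of `g`. -/
theorem sub_le_integral_of_ae_le {z d g : ℝ → ℝ} {a b x y : ℝ}
    (hd : IntegrableOn d (Icc a b)) (hz : ∀ r ∈ Icc a b, z r = z a + ∫ s in a..r, d s)
    (hg : Continuous g) (hax : a ≤ x) (hxy : x ≤ y) (hyb : y ≤ b)
    (hle : ∀ᵐ r ∂(volume.restrict (Ioo a b)), r ∈ Ioo x y → d r ≤ g r) :
    z y - z x ≤ ∫ s in x..y, g s := by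
  have hint : ∀ p q, a ≤ p → p ≤ q → q ≤ b → IntervalIntegrable d volume p q := by
    intro p q hp hpq hq
    rw [intervalIntegrable_iff_integrableOn_Icc_of_le hpq]
    exact hd.mono_set (Icc_subset_Icc hp hq)
  have hsub : z y - z x = ∫ s in x..y, d s := by
    rw [hz y ⟨hax.trans hxy, hyb⟩, hz x ⟨hax, hxy.trans hyb⟩,
      ← intervalIntegral.integral_add_adjacent_intervals
        (hint a x le_rfl hax (hxy.trans hyb)) (hint x y hax hxy hyb)]
    ring
  rw [hsub]
  refine intervalIntegral.integral_mono_ae_restrict hxy (hint x y hax hxy hyb)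
    (hg.intervalIntegrable _ _) ?_
  rw [← restrict_Ioo_eq_restrict_Icc]
  have hle' := ae_restrict_of_ae_restrict_of_subset (Ioo_subset_Ioo hax hyb) hle
  filter_upwards [hle', ae_restrict_mem measurableSet_Ioo] with r hr hmem
  exact hr hmem

/-- An absolutely continuous function that starts at most at `ε` and does not increase while it is
above `ε` stays at most at `ε`. -/
theorem le_of_ae_deriv_nonpos_above {z d : ℝ → ℝ} {a b ε : ℝ}
    (hd : IntegrableOn d (Icc a b)) (hz : ∀ r ∈ Icc a b, z r = z a + ∫ s in a..r, d s)
    (hza : z a ≤ ε) (hle : ∀ᵐ r ∂(volume.restrict (Ioo a b)), ε < z r → d r ≤ 0) :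
    ∀ r ∈ Icc a b, z r ≤ ε := by
  intro r hr
  have hab : a ≤ b := hr.1.trans hr.2
  have hcont : ContinuousOn z (Icc a b) := by
    have h := intervalIntegral.continuousOn_primitive_interval (μ := volume) (f := d)
      (a := a) (b := b) (by rwa [uIcc_of_le hab])
    rw [uIcc_of_le hab] at h
    exact (continuousOn_const.add h).congr hz
  have hcl : IsClosed (Icc a r ∩ z ⁻¹' Iic ε) :=
    (hcont.mono (Icc_subset_Icc_right hr.2)).preimage_isClosed_of_isClosed isClosed_Icc isClosed_Iic
  have hcomp : IsCompact (Icc a r ∩ z ⁻¹' Iic ε) :=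
    isCompact_Icc.of_isClosed_subset hcl inter_subset_left
  obtain ⟨x, ⟨hx, hzx⟩, hmax⟩ := hcomp.exists_isGreatest ⟨a, left_mem_Icc.2 hr.1, hza⟩
  have key := sub_le_integral_of_ae_le (g := fun _ => 0) hd hz continuous_const hx.1 hx.2 hr.2 (by
    filter_upwards [hle] with s hs hmem
    refine hs (lt_of_not_ge fun hzs => ?_)
    exact absurd (hmax ⟨⟨hx.1.trans hmem.1.le, hmem.2.le⟩, hzs⟩) (not_le.2 hmem.1))
  have hzx' : z x ≤ ε := hzx
  simp only [intervalIntegral.integral_zero] at key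
  linarith

/-- Lemma 3.7 / `lem-z_c(1):-infty`: for the shooting
solutions `z_c` of `z' + c H(z⁺) = f(-r)`, `z(-1) = 0`, with
`H = ψ ∘ (Ψ|_{[0,∞)})⁻¹`, one has `lim_{c → +∞} z_c(1) < 0`; in particular
`z_c(1) < 0` for all sufficiently large `c`. -/
theorem stmt_3
    (f : ℝ → ℝ) (μ : ℝ) (hμ : μ ∈ Ioo (-1:ℝ) 1)
    (hfLip : ∃ K : NNReal, LipschitzWith K f)
    (hfm1 : f (-1) = 0) (hfμ : f μ = 0) (hf1 : f 1 = 0)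
    (hfneg : ∀ s ∈ Ioo (-1:ℝ) μ, f s < 0)
    (hfpos : ∀ s ∈ Ioo μ (1:ℝ), 0 < f s)
    (hF : ∀ r ∈ Ioo (-1:ℝ) 1, 0 < ∫ s in r..(1:ℝ), f s)
    (Φ φ Ψ ψ Ψinv H : ℝ → ℝ)
    (hΦderiv : ∀ s, HasDerivAt Φ (φ s) s)
    (hΦeven : ∀ s, Φ (-s) = Φ s)
    (hΦ0 : Φ 0 = 0)
    (hΦconv : StrictConvexOn ℝ univ Φ)
    (hφodd : ∀ s, φ (-s) = - φ s)
    (hφmono : StrictMono φ)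
    (hφtop : Tendsto φ atTop atTop)
    (hφbot : Tendsto φ atBot atBot)
    (hΨ : ∀ t, Ψ t = ⨆ s : ℝ, (s * t - Φ s))
    (hΨderiv : ∀ t, HasDerivAt Ψ (ψ t) t)
    (hψφ : ∀ s, ψ (φ s) = s)
    (hφψ : ∀ t, φ (ψ t) = t)
    (hΨinv0 : ∀ y ∈ Ici (0:ℝ), Ψinv y ∈ Ici (0:ℝ) ∧ Ψ (Ψinv y) = y)
    (hΨinv1 : ∀ v ∈ Ici (0:ℝ), Ψinv (Ψ v) = v)
    (hH : ∀ y, H y = ψ (Ψinv y))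
    -- the family `c ↦ z_c` of shooting solutions, with a.e. derivatives `d c`
    (z d : ℝ → ℝ → ℝ)
    (hzsol : ∀ c : ℝ, 0 ≤ c →
      IntegrableOn (d c) (Icc (-1:ℝ) 1) ∧
      (∀ r ∈ Icc (-1:ℝ) 1, z c r = z c (-1) + ∫ s in (-1:ℝ)..r, d c s) ∧
      (∀ᵐ r ∂(volume.restrict (Ioo (-1:ℝ) 1)), d c r = deriv (z c) r) ∧
      (∀ᵐ r ∂(volume.restrict (Ioo (-1:ℝ) 1)),
        d c r + c * H (max (z c r) 0) = f (-r)) ∧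
      z c (-1) = 0)
    -- uniqueness of the shooting solution for each `c ≥ 0`
    (hzuniq : ∀ c : ℝ, 0 ≤ c → ∀ w e : ℝ → ℝ,
      IntegrableOn e (Icc (-1:ℝ) 1) →
      (∀ r ∈ Icc (-1:ℝ) 1, w r = w (-1) + ∫ s in (-1:ℝ)..r, e s) →
      (∀ᵐ r ∂(volume.restrict (Ioo (-1:ℝ) 1)), e r = deriv w r) →
      (∀ᵐ r ∂(volume.restrict (Ioo (-1:ℝ) 1)),
        e r + c * H (max (w r) 0) = f (-r)) →
      w (-1) = 0 → ∀ r ∈ Icc (-1:ℝ) 1, w r = z c r) :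
    (∃ δ > (0:ℝ), ∀ᶠ c in atTop, z c 1 ≤ -δ) ∧
    (∃ c₀ > (0:ℝ), ∀ c ≥ c₀, z c 1 < 0) := by
  obtain ⟨K, hK⟩ := hfLip
  have hg : Continuous fun r => f (-r) := hK.continuous.comp continuous_neg
  have hφ0 : φ 0 = 0 := by
    have := hφodd 0
    rw [neg_zero] at this
    linarith
  have hψ0 : ψ 0 = 0 := by simpa [hφ0] using hψφ 0
  have hψmono : StrictMono ψ := fun s t hst => hφmono.lt_iff_lt.1 (by rwa [hφψ, hφψ])
  have hΦnonneg : ∀ s, 0 ≤ Φ s := by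
    intro s
    have h := hΦconv.convexOn.2 (mem_univ s) (mem_univ (-s)) (by norm_num : (0:ℝ) ≤ 1 / 2)
      (by norm_num : (0:ℝ) ≤ 1 / 2) (by norm_num)
    simp only [smul_eq_mul, hΦeven] at h
    rw [show (1 / 2 * s + 1 / 2 * -s : ℝ) = 0 by ring, hΦ0] at h
    linarith
  have hΨ0 : Ψ 0 = 0 := by
    rw [hΨ]
    refine le_antisymm (ciSup_le fun s => by simpa using hΦnonneg s) ?_
    refine le_ciSup_of_le ⟨0, ?_⟩ 0 (by simp [hΦ0])
    rintro _ ⟨s, rfl⟩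
    simpa using hΦnonneg s
  have hΨmono : MonotoneOn Ψ (Ici 0) := by
    refine monotoneOn_of_deriv_nonneg (convex_Ici 0)
      (fun t _ => (hΨderiv t).continuousAt.continuousWithinAt)
      (fun t _ => (hΨderiv t).differentiableAt.differentiableWithinAt) fun t ht => ?_
    rw [interior_Ici] at ht
    rw [(hΨderiv t).deriv, ← hψ0]
    exact (hψmono ht).le
  have hHnonneg : ∀ y, 0 ≤ y → 0 ≤ H y := by
    intro y hy
    rw [hH, ← hψ0]
    exact hψmono.monotone (hΨinv0 y hy).1
  have hHpos : ∀ y, 0 < y → 0 < H y := by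
    intro y hy
    obtain ⟨h0, h1⟩ := hΨinv0 y hy.le
    have hne : Ψinv y ≠ 0 := fun h => by
      rw [h, hΨ0] at h1
      exact hy.ne h1
    rw [hH, ← hψ0]
    exact hψmono (lt_of_le_of_ne h0 hne.symm)
  have hHmono : ∀ x y, 0 ≤ x → x < y → H x ≤ H y := by
    intro x y hx hxy
    rw [hH, hH]
    refine hψmono.monotone (le_of_not_gt fun hlt => ?_)
    have hle := hΨmono (hΨinv0 y (hx.trans hxy.le)).1 (hΨinv0 x hx).1 hlt.le
    rw [(hΨinv0 y (hx.trans hxy.le)).2, (hΨinv0 x hx).2] at hle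
    linarith
  obtain ⟨M, hM⟩ := isCompact_Icc.exists_bound_of_continuousOn
    (s := Icc (-1:ℝ) 1) hg.continuousOn
  have hI : ∫ s in (-μ)..1, f (-s) < 0 := by
    have hpos : 0 < ∫ s in (-μ)..1, -f (-s) :=
      intervalIntegral.intervalIntegral_pos_of_pos_on (hg.neg.intervalIntegrable _ _)
        (fun s hs => neg_pos.2 (hfneg _ ⟨by linarith [hs.2], by linarith [hs.1]⟩))
        (by linarith [hμ.1])
    rw [intervalIntegral.integral_neg] at hpos
    linarith
  obtain ⟨ε, hε, hIε⟩ : ∃ ε > 0, ∫ s in (-μ)..1, f (-s) = -(2 * ε) :=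
    ⟨-(∫ s in (-μ)..1, f (-s)) / 2, by linarith, by ring⟩
  have hlarge : ∀ c, max 0 (M / H ε) ≤ c → z c 1 ≤ -ε := by
    intro c hc
    have hc0 : 0 ≤ c := (le_max_left _ _).trans hc
    have hcM : M ≤ c * H ε := (div_le_iff₀ (hHpos ε hε)).1 ((le_max_right _ _).trans hc)
    obtain ⟨hd, hz, -, hode, hz0⟩ := hzsol c hc0
    have hsmall : z c (-μ) ≤ ε := by
      refine le_of_ae_deriv_nonpos_above hd hz (hz0.trans_le hε.le) ?_ (-μ)
        ⟨by linarith [hμ.2], by linarith [hμ.1]⟩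
      filter_upwards [hode, ae_restrict_mem measurableSet_Ioo] with r hr hmem hεr
      rw [max_eq_left (hε.le.trans hεr.le)] at hr
      have h1 := mul_le_mul_of_nonneg_left (hHmono ε (z c r) hε.le hεr) hc0
      have h2 := (le_abs_self _).trans (hM r (Ioo_subset_Icc_self hmem))
      linarith
    have htail := sub_le_integral_of_ae_le (x := -μ) (y := 1) hd hz hg
      (by linarith [hμ.2]) (by linarith [hμ.1]) le_rfl (by
        filter_upwards [hode] with r hr _
        have := mul_nonneg hc0 (hHnonneg _ (le_max_right (z c r) 0))
        linarith)
    linarith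
  refine ⟨⟨ε, hε, eventually_atTop.2 ⟨_, hlarge⟩⟩, max 0 (M / H ε) + 1, by positivity, ?_⟩
  intro c hc
  linarith [hlarge c (by linarith)]
end

section
/- Let c ∈ ℝ with c ≥ 0 and let z₁, z₂ : [a,b] → ℝ be absolutely continuous functions on an interval [a,b] ⊂ [−1,1] with a < b, such that for almost every r ∈ (a,b) one has z₁'(r) + c H(z₁(r)⁺) ≤ z₂'(r) + c H(z₂(r)⁺). If z₁(a) ≤ z₂(a), then z₁(r) ≤ z₂(r) for all r ∈ [a,b]. -/
open MeasureTheory Set Filter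

/-- A function that is the integral of an integrable density on `[a, b]`, starts nonpositive, and
whose density is a.e. nonpositive where the function is positive, stays nonpositive. -/
theorem nonpos_of_density_nonpos_where_pos {w d : ℝ → ℝ} {a b : ℝ}
    (hd : IntegrableOn d (Icc a b))
    (hw : ∀ r ∈ Icc a b, w r = w a + ∫ s in a..r, d s)
    (hneg : ∀ᵐ r ∂(volume.restrict (Ioo a b)), 0 < w r → d r ≤ 0)
    (hinit : w a ≤ 0) :
    ∀ r ∈ Icc a b, w r ≤ 0 := by
  intro r hr
  have hab : a ≤ b := hr.1.trans hr.2
  have hcont : ContinuousOn w (Icc a b) := by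
    have h := intervalIntegral.continuousOn_primitive_interval (by rwa [uIcc_of_le hab])
    rw [uIcc_of_le hab] at h
    exact (continuousOn_const.add h).congr hw
  have hcont' : ContinuousOn w (Icc a r) := hcont.mono (Icc_subset_Icc_right hr.2)
  have hcompact : IsCompact (Icc a r ∩ w ⁻¹' Iic 0) :=
    isCompact_Icc.of_isClosed_subset
      (hcont'.preimage_isClosed_of_isClosed isClosed_Icc isClosed_Iic) inter_subset_left
  obtain ⟨s, ⟨hs, hws⟩, hmax⟩ :=
    hcompact.exists_isGreatest ⟨a, ⟨le_rfl, hr.1⟩, hinit⟩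
  have hpos : ∀ x ∈ Ioo s r, 0 < w x := fun x hx => by
    by_contra! hle
    exact absurd (hmax ⟨⟨hs.1.trans hx.1.le, hx.2.le⟩, hle⟩) (not_le.2 hx.1)
  have hint : ∀ x ∈ Icc a b, IntervalIntegrable d volume a x := fun x hx =>
    (intervalIntegrable_iff_integrableOn_Icc_of_le hx.1).2
      (hd.mono_set (Icc_subset_Icc_right hx.2))
  have hsb : s ∈ Icc a b := ⟨hs.1, hs.2.trans hr.2⟩
  have hdiff : w r - w s = ∫ x in s..r, d x := by
    rw [hw r hr, hw s hsb, ← intervalIntegral.integral_interval_sub_left (hint r hr) (hint s hsb)]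
    ring
  have hle : ∫ x in s..r, d x ≤ 0 := by
    rw [intervalIntegral.integral_of_le hs.2, integral_Ioc_eq_integral_Ioo]
    refine integral_nonpos_of_ae ?_
    filter_upwards [ae_restrict_mem measurableSet_Ioo,
      ae_restrict_of_ae_restrict_of_subset (Ioo_subset_Ioo hs.1 hr.2) hneg] with x hx hdx
    exact hdx (hpos x hx)
  have hws' : w s ≤ 0 := hws
  linarith

/-- comparison lemma, Lemma 3.3 / `lem-sub-sup`.
`H : [0,∞) → ℝ` is continuous, strictly increasing, `H 0 = 0`.  If `c ≥ 0`,
`z₁, z₂` are absolutely continuous on `[a,b] ⊆ [-1,1]` (with a.e. derivatives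
`d₁, d₂`) and `d₁ + c H(z₁⁺) ≤ d₂ + c H(z₂⁺)` a.e. on `(a,b)`, then
`z₁ a ≤ z₂ a` implies `z₁ ≤ z₂` on `[a,b]`. -/
theorem stmt_4
    (H : ℝ → ℝ)
    (hHcont : ContinuousOn H (Ici 0))
    (hHmono : StrictMonoOn H (Ici 0))
    (hH0 : H 0 = 0)
    (c : ℝ) (hc : 0 ≤ c)
    (a b : ℝ) (hab : a < b) (ha : -1 ≤ a) (hb : b ≤ 1)
    (z₁ z₂ d₁ d₂ : ℝ → ℝ)
    (hd₁int : IntegrableOn d₁ (Icc a b))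
    (hd₂int : IntegrableOn d₂ (Icc a b))
    (hz₁ : ∀ r ∈ Icc a b, z₁ r = z₁ a + ∫ s in a..r, d₁ s)
    (hz₂ : ∀ r ∈ Icc a b, z₂ r = z₂ a + ∫ s in a..r, d₂ s)
    (hd₁ : ∀ᵐ r ∂(volume.restrict (Ioo a b)), d₁ r = deriv z₁ r)
    (hd₂ : ∀ᵐ r ∂(volume.restrict (Ioo a b)), d₂ r = deriv z₂ r)
    (hineq : ∀ᵐ r ∂(volume.restrict (Ioo a b)),
      d₁ r + c * H (max (z₁ r) 0) ≤ d₂ r + c * H (max (z₂ r) 0))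
    (hinit : z₁ a ≤ z₂ a) :
    ∀ r ∈ Icc a b, z₁ r ≤ z₂ r := by
  have hint : ∀ {d : ℝ → ℝ}, IntegrableOn d (Icc a b) → ∀ r ∈ Icc a b,
      IntervalIntegrable d volume a r := fun hd r hr =>
    (intervalIntegrable_iff_integrableOn_Icc_of_le hr.1).2
      (hd.mono_set (Icc_subset_Icc_right hr.2))
  intro r hr
  refine sub_nonpos.1 (nonpos_of_density_nonpos_where_pos (w := fun x => z₁ x - z₂ x)
    (d := fun x => d₁ x - d₂ x) (hd₁int.sub hd₂int) ?_ ?_ (sub_nonpos.2 hinit) r hr)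
  · intro x hx
    rw [intervalIntegral.integral_sub (hint hd₁int x hx) (hint hd₂int x hx), hz₁ x hx, hz₂ x hx]
    ring
  · filter_upwards [hineq] with x hx hlt
    have hH : H (max (z₂ x) 0) ≤ H (max (z₁ x) 0) :=
      hHmono.monotoneOn (mem_Ici.2 (le_max_right _ _)) (mem_Ici.2 (le_max_right _ _))
        (max_le_max_right 0 (sub_pos.1 hlt).le)
    have := mul_le_mul_of_nonneg_left hH hc
    linarith
end

section
/- Let c₁, c₂ ∈ ℝ satisfy c₁ ≥ c₂ and c₁ ≥ 0, and let z₁, z₂ : [a,b] → ℝ be absolutely continuous functions on an interval [a,b] ⊂ [−1,1] with a < b, such that for almost every r ∈ (a,b): z₁'(r) + c₁ H(z₁(r)⁺) ≤ f(−r) and z₂'(r) + c₂ H(z₂(r)⁺) ≥ f(−r). If z₁(a) ≤ z₂(a), then z₁(r) ≤ z₂(r) for all r ∈ [a,b]. -/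
open MeasureTheory Set Filter

/-- Corollary 3.4 / `cor-sub-sup`: comparison of a sub- and a
supersolution of `z' + c H(z⁺) = f(-r)` with possibly different constants
`c₁ ≥ c₂`, `c₁ ≥ 0`. -/
theorem stmt_5
    (H : ℝ → ℝ)
    (hHcont : ContinuousOn H (Ici 0))
    (hHmono : StrictMonoOn H (Ici 0))
    (hH0 : H 0 = 0)
    (f : ℝ → ℝ) (μ : ℝ) (hμ : μ ∈ Ioo (-1:ℝ) 1)
    (hfLip : ∃ K : NNReal, LipschitzWith K f)
    (hfm1 : f (-1) = 0) (hfμ : f μ = 0) (hf1 : f 1 = 0)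
    (hfneg : ∀ s ∈ Ioo (-1:ℝ) μ, f s < 0)
    (hfpos : ∀ s ∈ Ioo μ (1:ℝ), 0 < f s)
    (hF : ∀ r ∈ Ioo (-1:ℝ) 1, 0 < ∫ s in r..(1:ℝ), f s)
    (c₁ c₂ : ℝ) (hc₁₂ : c₂ ≤ c₁) (hc₁ : 0 ≤ c₁)
    (a b : ℝ) (hab : a < b) (ha : -1 ≤ a) (hb : b ≤ 1)
    (z₁ z₂ d₁ d₂ : ℝ → ℝ)
    (hd₁int : IntegrableOn d₁ (Icc a b))
    (hd₂int : IntegrableOn d₂ (Icc a b))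
    (hz₁ : ∀ r ∈ Icc a b, z₁ r = z₁ a + ∫ s in a..r, d₁ s)
    (hz₂ : ∀ r ∈ Icc a b, z₂ r = z₂ a + ∫ s in a..r, d₂ s)
    (hd₁ : ∀ᵐ r ∂(volume.restrict (Ioo a b)), d₁ r = deriv z₁ r)
    (hd₂ : ∀ᵐ r ∂(volume.restrict (Ioo a b)), d₂ r = deriv z₂ r)
    (hsub : ∀ᵐ r ∂(volume.restrict (Ioo a b)),
      d₁ r + c₁ * H (max (z₁ r) 0) ≤ f (-r))
    (hsup : ∀ᵐ r ∂(volume.restrict (Ioo a b)),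
      f (-r) ≤ d₂ r + c₂ * H (max (z₂ r) 0))
    (hinit : z₁ a ≤ z₂ a) :
    ∀ r ∈ Icc a b, z₁ r ≤ z₂ r := by
  intro r hr
  by_contra! hlt
  have hsubset : Icc a r ⊆ Icc a b := Icc_subset_Icc_right hr.2
  have hcont : ∀ z d : ℝ → ℝ, IntegrableOn d (Icc a b) →
      (∀ r ∈ Icc a b, z r = z a + ∫ s in a..r, d s) → ContinuousOn z (Icc a b) := by
    intro z d hd hz
    refine ContinuousOn.congr (continuousOn_const.add ?_) hz
    have h := intervalIntegral.continuousOn_primitive_interval (μ := volume) (f := d)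
      (a := a) (b := b) (by rwa [uIcc_of_le hab.le])
    rwa [uIcc_of_le hab.le] at h
  have hz₁c := (hcont z₁ d₁ hd₁int hz₁).mono hsubset
  have hz₂c := (hcont z₂ d₂ hd₂int hz₂).mono hsubset
  -- the last point before `r` at which `z₁ ≤ z₂`
  obtain ⟨t, ⟨ht, htle⟩, htmax⟩ :=
    (isCompact_Icc.of_isClosed_subset (isClosed_Icc.isClosed_le hz₁c hz₂c)
      (sep_subset _ _)).exists_isGreatest ⟨a, left_mem_Icc.2 hr.1, hinit⟩
  have hafter : ∀ s ∈ Ioc t r, z₂ s < z₁ s := by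
    intro s hs
    by_contra! hle
    exact absurd (htmax ⟨⟨ht.1.trans hs.1.le, hs.2⟩, hle⟩) (not_le.2 hs.1)
  have hincr : ∀ z d : ℝ → ℝ, IntegrableOn d (Icc a b) →
      (∀ r ∈ Icc a b, z r = z a + ∫ s in a..r, d s) →
      IntervalIntegrable d volume t r ∧ z r = z t + ∫ s in t..r, d s := by
    intro z d hd hz
    have hi : ∀ u ∈ Icc a b, ∀ v ∈ Icc a b, IntervalIntegrable d volume u v := fun u hu v hv =>
      (hd.mono_set (ordConnected_Icc.uIcc_subset hu hv)).intervalIntegrable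
    have hta := hsubset ht
    have haa : a ∈ Icc a b := left_mem_Icc.2 hab.le
    refine ⟨hi t hta r hr, ?_⟩
    rw [hz r hr, hz t hta, add_assoc,
      intervalIntegral.integral_add_adjacent_intervals (hi a haa t hta) (hi t hta r hr)]
  obtain ⟨hi₁, he₁⟩ := hincr z₁ d₁ hd₁int hz₁
  obtain ⟨hi₂, he₂⟩ := hincr z₂ d₂ hd₂int hz₂
  have hle : ∫ s in t..r, d₁ s ≤ ∫ s in t..r, d₂ s := by
    rw [intervalIntegral.integral_of_le ht.2, intervalIntegral.integral_of_le ht.2,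
      integral_Ioc_eq_integral_Ioo, integral_Ioc_eq_integral_Ioo]
    have hss : Ioo t r ⊆ Ioo a b := Ioo_subset_Ioo ht.1 hr.2
    refine integral_mono_ae
      (((intervalIntegrable_iff_integrableOn_Ioo_of_le ht.2).1 hi₁))
      (((intervalIntegrable_iff_integrableOn_Ioo_of_le ht.2).1 hi₂)) ?_
    filter_upwards [ae_restrict_of_ae_restrict_of_subset hss hsub,
      ae_restrict_of_ae_restrict_of_subset hss hsup,
      ae_restrict_mem measurableSet_Ioo] with s hs₁ hs₂ hs
    have h0 : ∀ x : ℝ, max x 0 ∈ Ici (0 : ℝ) := fun x => le_max_right x 0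
    have hmono := hHmono.monotoneOn (h0 (z₂ s)) (h0 (z₁ s))
      (max_le_max_right 0 (hafter s ⟨hs.1, hs.2.le⟩).le)
    have hnonneg : 0 ≤ H (max (z₂ s) 0) :=
      hH0.ge.trans (hHmono.monotoneOn (mem_Ici.2 le_rfl) (h0 (z₂ s)) (h0 (z₂ s)))
    have h₁ := mul_le_mul_of_nonneg_left hmono hc₁
    have h₂ := mul_le_mul_of_nonneg_right hc₁₂ hnonneg
    linarith
  linarith
end

section
/- Let c₁, c₂ ∈ ℝ satisfy c₁ > c₂ and c₁ ≥ 0, and let z₁, z₂ : [a,b] → ℝ be absolutely continuous on [a,b] ⊂ [−1,1], a < b, satisfying z₁'(r) + c₁ H(z₁(r)⁺) = f(−r) and z₂'(r) + c₂ H(z₂(r)⁺) = f(−r) for almost every r ∈ (a,b). If z₁(a) ≤ z₂(a), then for every r ∈ (a,b) exactly one of the following holds: either z₁(r) < z₂(r), or z₁(r) = z₂(r) ≤ 0. -/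
open MeasureTheory Set Filter

/-- A function with an integrable density on `[a, b]` is continuous there. -/
lemma continuousOn_of_eq_add_intervalIntegral {z d : ℝ → ℝ} {a b : ℝ} (hab : a ≤ b)
    (hd : IntegrableOn d (Icc a b)) (hz : ∀ r ∈ Icc a b, z r = z a + ∫ s in a..r, d s) :
    ContinuousOn z (Icc a b) := by
  have h : ContinuousOn (fun r => ∫ s in a..r, d s) (Icc a b) := by
    have := intervalIntegral.continuousOn_primitive_interval (μ := volume) (f := d)
      (a := a) (b := b) (by rwa [uIcc_of_le hab])
    rwa [uIcc_of_le hab] at this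
  exact (continuousOn_const.add h).congr hz

/-- If the derivative of `W` is nonpositive wherever `W` is nonnegative, then `W` stays
nonpositive once it is nonpositive at the left endpoint. -/
lemma nonpos_of_hasDerivAt_nonpos_of_nonneg {W G : ℝ → ℝ} {a b : ℝ}
    (hW : ∀ r, HasDerivAt W (G r) r) (ha : W a ≤ 0)
    (hG : ∀ r ∈ Ico a b, 0 ≤ W r → G r ≤ 0) : ∀ r ∈ Icc a b, W r ≤ 0 := by
  intro r hr
  have hε : ∀ ε > 0, W r ≤ ε * (r - a) := fun ε hε => by
    refine image_le_of_deriv_right_lt_deriv_boundary (f := W) (f' := G) (a := a) (b := b)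
      (B := fun t => ε * (t - a)) (B' := fun _ => ε)
      (fun x _ => (hW x).continuousAt.continuousWithinAt)
      (fun x _ => (hW x).hasDerivWithinAt) (by simpa using ha)
      (fun x => by simpa using ((hasDerivAt_id x).sub_const a).const_mul ε) ?_ hr
    intro x hx hWx
    have : 0 ≤ W x := hWx ▸ mul_nonneg hε.le (sub_nonneg.2 hx.1)
    exact (hG x hx this).trans_lt hε
  have hlim : Tendsto (fun ε : ℝ => ε * (r - a)) (nhdsWithin 0 (Ioi 0)) (nhds 0) := by
    have : Continuous fun ε : ℝ => ε * (r - a) := by fun_prop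
    simpa using (this.tendsto 0).mono_left nhdsWithin_le_nhds
  exact ge_of_tendsto hlim (eventually_mem_nhdsWithin.mono hε)

/-- Corollary 3.5(i) / `cor-sub<sup` Part (i): if `c₁ > c₂`,
`c₁ ≥ 0`, and `z₁, z₂` solve `zᵢ' + cᵢ H(zᵢ⁺) = f(-r)` a.e. on `(a,b) ⊆ (-1,1)`
with `z₁ a ≤ z₂ a`, then at every `r ∈ (a,b)` exactly one of the alternatives
`z₁ r < z₂ r` or `z₁ r = z₂ r ≤ 0` occurs. -/
theorem stmt_6
    (H : ℝ → ℝ)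
    (hHcont : ContinuousOn H (Ici 0))
    (hHmono : StrictMonoOn H (Ici 0))
    (hH0 : H 0 = 0)
    (f : ℝ → ℝ) (μ : ℝ) (hμ : μ ∈ Ioo (-1:ℝ) 1)
    (hfLip : ∃ K : NNReal, LipschitzWith K f)
    (hfm1 : f (-1) = 0) (hfμ : f μ = 0) (hf1 : f 1 = 0)
    (hfneg : ∀ s ∈ Ioo (-1:ℝ) μ, f s < 0)
    (hfpos : ∀ s ∈ Ioo μ (1:ℝ), 0 < f s)
    (hF : ∀ r ∈ Ioo (-1:ℝ) 1, 0 < ∫ s in r..(1:ℝ), f s)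
    (c₁ c₂ : ℝ) (hc₁₂ : c₂ < c₁) (hc₁ : 0 ≤ c₁)
    (a b : ℝ) (hab : a < b) (ha : -1 ≤ a) (hb : b ≤ 1)
    (z₁ z₂ d₁ d₂ : ℝ → ℝ)
    (hd₁int : IntegrableOn d₁ (Icc a b))
    (hd₂int : IntegrableOn d₂ (Icc a b))
    (hz₁ : ∀ r ∈ Icc a b, z₁ r = z₁ a + ∫ s in a..r, d₁ s)
    (hz₂ : ∀ r ∈ Icc a b, z₂ r = z₂ a + ∫ s in a..r, d₂ s)
    (hd₁ : ∀ᵐ r ∂(volume.restrict (Ioo a b)), d₁ r = deriv z₁ r)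
    (hd₂ : ∀ᵐ r ∂(volume.restrict (Ioo a b)), d₂ r = deriv z₂ r)
    (hode₁ : ∀ᵐ r ∂(volume.restrict (Ioo a b)),
      d₁ r + c₁ * H (max (z₁ r) 0) = f (-r))
    (hode₂ : ∀ᵐ r ∂(volume.restrict (Ioo a b)),
      d₂ r + c₂ * H (max (z₂ r) 0) = f (-r))
    (hinit : z₁ a ≤ z₂ a) :
    ∀ r ∈ Ioo a b,
      (z₁ r < z₂ r ∧ ¬(z₁ r = z₂ r ∧ z₁ r ≤ 0)) ∨
      (z₁ r = z₂ r ∧ z₁ r ≤ 0 ∧ ¬(z₁ r < z₂ r)) := by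
  have hz₁c := continuousOn_of_eq_add_intervalIntegral hab.le hd₁int hz₁
  have hz₂c := continuousOn_of_eq_add_intervalIntegral hab.le hd₂int hz₂
  have hcont : ∀ z : ℝ → ℝ, ContinuousOn z (Icc a b) →
      Continuous fun r => H (max (z (projIcc a b hab.le r)) 0) := fun z hz =>
    hHcont.comp_continuous
      ((hz.comp_continuous (continuous_subtype_val.comp continuous_projIcc)
        fun r => (projIcc a b hab.le r).2).max continuous_const)
      fun r => mem_Ici.2 (le_max_right _ _)
  set G : ℝ → ℝ := fun r => c₂ * H (max (z₂ (projIcc a b hab.le r)) 0)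
    - c₁ * H (max (z₁ (projIcc a b hab.le r)) 0) with hGdef
  have hGc : Continuous G :=
    ((hcont z₂ hz₂c).const_mul c₂).sub ((hcont z₁ hz₁c).const_mul c₁)
  have hGeq : ∀ r ∈ Icc a b, G r = c₂ * H (max (z₂ r) 0) - c₁ * H (max (z₁ r) 0) :=
    fun r hr => by simp only [hGdef, projIcc_of_mem hab.le hr]
  set W : ℝ → ℝ := fun r => (z₁ a - z₂ a) + ∫ s in a..r, G s with hWdef
  have hWd : ∀ r, HasDerivAt W (G r) r := fun r =>
    (hGc.integral_hasStrictDerivAt a r).hasDerivAt.const_add _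
  have hWa : W a = z₁ a - z₂ a := by simp [hWdef]
  have hWeq : ∀ r ∈ Icc a b, W r = z₁ r - z₂ r := by
    intro r hr
    have hsub : uIcc a r ⊆ Icc a b := by
      rw [uIcc_of_le hr.1]; exact Icc_subset_Icc_right hr.2
    have hint : ∫ s in a..r, G s = ∫ s in a..r, (d₁ s - d₂ s) := by
      rw [intervalIntegral.integral_of_le hr.1, intervalIntegral.integral_of_le hr.1,
        integral_Ioc_eq_integral_Ioo, integral_Ioc_eq_integral_Ioo]
      refine integral_congr_ae ?_
      have hs : Ioo a r ⊆ Ioo a b := Ioo_subset_Ioo_right hr.2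
      filter_upwards [ae_restrict_of_ae_restrict_of_subset hs hode₁,
        ae_restrict_of_ae_restrict_of_subset hs hode₂,
        ae_restrict_mem measurableSet_Ioo] with s h₁ h₂ hs'
      rw [hGeq s (Ioo_subset_Icc_self (hs hs'))]
      linarith
    have hi₁ : IntervalIntegrable d₁ volume a r :=
      (hd₁int.mono_set hsub).intervalIntegrable
    have hi₂ : IntervalIntegrable d₂ volume a r :=
      (hd₂int.mono_set hsub).intervalIntegrable
    simp only [hWdef]
    rw [hint, intervalIntegral.integral_sub hi₁ hi₂, hz₁ r hr, hz₂ r hr]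
    ring
  have hHnonneg : ∀ y, 0 ≤ H (max y 0) := fun y => by
    simpa only [hH0] using
      hHmono.monotoneOn self_mem_Ici (mem_Ici.2 (le_max_right y 0)) (le_max_right y 0)
  have hsign : ∀ r ∈ Ico a b, 0 ≤ W r → G r ≤ 0 := by
    intro r hr h0
    have hr' := Ico_subset_Icc_self hr
    rw [hWeq r hr'] at h0
    rw [hGeq r hr']
    have hle : H (max (z₂ r) 0) ≤ H (max (z₁ r) 0) :=
      hHmono.monotoneOn (mem_Ici.2 (le_max_right _ _)) (mem_Ici.2 (le_max_right _ _))
        (max_le_max_right 0 (by linarith))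
    nlinarith [mul_le_mul_of_nonneg_left hle hc₁,
      mul_nonneg (sub_nonneg.2 hc₁₂.le) (hHnonneg (z₂ r))]
  have hnonpos := nonpos_of_hasDerivAt_nonpos_of_nonneg hWd (by linarith) hsign
  intro r hr
  have hr' := Ioo_subset_Icc_self hr
  have hle := hnonpos r hr'
  rw [hWeq r hr'] at hle
  rcases (sub_nonpos.1 hle).lt_or_eq with hlt | heq
  · exact Or.inl ⟨hlt, fun h => hlt.ne h.1⟩
  refine Or.inr ⟨heq, ?_, heq.not_lt⟩
  by_contra! hpos
  have hmax : IsLocalMax W r := by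
    filter_upwards [Icc_mem_nhds hr.1 hr.2] with t ht
    rw [hWeq r hr', heq, sub_self]
    exact hnonpos t ht
  have hG0 := hmax.hasDerivAt_eq_zero (hWd r)
  rw [hGeq r hr', ← heq, max_eq_left hpos.le] at hG0
  have hHpos : 0 < H (z₁ r) := by
    simpa only [hH0] using hHmono self_mem_Ici (mem_Ici.2 hpos.le) hpos
  nlinarith [mul_pos (sub_pos.2 hc₁₂) hHpos]
end

section
/- Let H = ψ ∘ (Ψ|_{[0,∞)})⁻¹, let c₁, c₂ ∈ ℝ satisfy c₁ > c₂ and c₁ ≥ 0, and let z₁, z₂ : [a,b] → ℝ be absolutely continuous on [a,b] with −μ ≤ a < b ≤ 1, satisfying z₁'(r) + c₁ H(z₁(r)⁺) = f(−r) and z₂'(r) + c₂ H(z₂(r)⁺) = f(−r) for almost every r ∈ (a,b). If z₁(a) ≤ z₂(a) and z₁(r) > 0 for all r ∈ (a,b), then z₁(r) < z₂(r) for all r ∈ (a,b]. -/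
open MeasureTheory Set Filter

/-- The primitive of an integrable function is continuous. -/
theorem continuousOn_of_eq_primitive {z d : ℝ → ℝ} {a b : ℝ} (hab : a < b)
    (hd : IntegrableOn d (Icc a b)) (hz : ∀ r ∈ Icc a b, z r = z a + ∫ s in a..r, d s) :
    ContinuousOn z (Icc a b) := by
  refine ContinuousOn.congr (continuousOn_const.add ?_) hz
  have := intervalIntegral.continuousOn_primitive_interval (μ := volume) (f := d) (a := a) (b := b)
    (by rwa [uIcc_of_le hab.le])
  rwa [uIcc_of_le hab.le] at this

/-- A primitive whose density agrees a.e. with a continuous function is differentiable. -/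
theorem hasDerivAt_of_eq_primitive {z d g : ℝ → ℝ} {a b : ℝ}
    (hz : ∀ r ∈ Icc a b, z r = z a + ∫ s in a..r, d s) (hg : ContinuousOn g (Icc a b))
    (hdg : ∀ᵐ r ∂(volume.restrict (Ioo a b)), d r = g r) {r : ℝ} (hr : r ∈ Ioo a b) :
    HasDerivAt z (g r) r := by
  have hprim : ∀ t ∈ Icc a b, z t = z a + ∫ s in a..t, g s := by
    intro t ht
    rw [hz t ht]
    congr 1
    rw [intervalIntegral.integral_of_le ht.1, intervalIntegral.integral_of_le ht.1,
      integral_Ioc_eq_integral_Ioo, integral_Ioc_eq_integral_Ioo]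
    exact integral_congr_ae (ae_restrict_of_ae_restrict_of_subset (Ioo_subset_Ioo_right ht.2) hdg)
  have hderiv : HasDerivAt (fun t => z a + ∫ s in a..t, g s) (g r) r := by
    refine (intervalIntegral.integral_hasDerivAt_right ?_ ?_ ?_).const_add _
    · refine ContinuousOn.intervalIntegrable ?_
      rw [uIcc_of_le hr.1.le]
      exact hg.mono (Icc_subset_Icc_right hr.2.le)
    · exact (hg.mono Ioo_subset_Icc_self).stronglyMeasurableAtFilter isOpen_Ioo r hr
    · exact hg.continuousAt (Icc_mem_nhds hr.1 hr.2)
  refine hderiv.congr_of_eventuallyEq ?_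
  filter_upwards [Icc_mem_nhds hr.1 hr.2] with t ht using hprim t ht

/-- A function starting below zero and nonincreasing wherever it is positive stays below zero. -/
theorem nonpos_of_deriv_nonpos_of_pos_s8 {w w' : ℝ → ℝ} {a b : ℝ} (hw : ContinuousOn w (Icc a b))
    (hderiv : ∀ r ∈ Ioo a b, HasDerivAt w (w' r) r)
    (hw' : ∀ r ∈ Ioo a b, 0 < w r → w' r ≤ 0) (hwa : w a ≤ 0) :
    ∀ r ∈ Icc a b, w r ≤ 0 := by
  intro r hr
  by_contra! hpos
  have hcont : ContinuousOn w (Icc a r) := hw.mono (Icc_subset_Icc_right hr.2)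
  have hclosed : IsClosed (Icc a r ∩ w ⁻¹' Iic 0) :=
    hcont.preimage_isClosed_of_isClosed isClosed_Icc isClosed_Iic
  obtain ⟨t, ⟨ht, htw⟩, htmax⟩ := (isCompact_Icc.of_isClosed_subset hclosed
    inter_subset_left).exists_isGreatest ⟨a, ⟨le_rfl, hr.1⟩, hwa⟩
  have hlater : ∀ s ∈ Ioo t r, 0 < w s := by
    intro s hs
    by_contra! hsw
    exact absurd (htmax ⟨⟨ht.1.trans hs.1.le, hs.2.le⟩, hsw⟩) (not_le.2 hs.1)
  have hsub : ∀ s ∈ Ioo t r, s ∈ Ioo a b := fun s hs =>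
    ⟨ht.1.trans_lt hs.1, hs.2.trans_le hr.2⟩
  have hanti : AntitoneOn w (Icc t r) := by
    refine antitoneOn_of_deriv_nonpos (convex_Icc t r) (hcont.mono (Icc_subset_Icc_left ht.1))
      ?_ ?_ <;> rw [interior_Icc] <;> intro s hs
    · exact (hderiv s (hsub s hs)).differentiableAt.differentiableWithinAt
    · rw [(hderiv s (hsub s hs)).deriv]
      exact hw' s (hsub s hs) (hlater s hs)
  have := hanti ⟨le_rfl, ht.2⟩ ⟨ht.2, le_rfl⟩ ht.2
  exact absurd (this.trans htw) (not_le.2 hpos)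

/-- The restricted inverse of `Ψ` on `[0,∞)`, extended to `ℝ` by the identity on `(-∞,0]`. -/
noncomputable def extendInverse (Ψinv : ℝ → ℝ) (y : ℝ) : ℝ := Ψinv (max y 0) + min y 0

theorem extendInverse_of_nonneg {Ψinv : ℝ → ℝ} {y : ℝ} (hy : 0 ≤ y) :
    extendInverse Ψinv y = Ψinv y := by
  simp [extendInverse, hy]

/-- Monotonicity of a right inverse of a function that is strictly increasing on `[0,∞)`. -/
theorem extendInverse_monotone {Ψ Ψinv : ℝ → ℝ} (hΨ : StrictMonoOn Ψ (Ici 0))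
    (hinv : ∀ y ∈ Ici (0:ℝ), Ψinv y ∈ Ici (0:ℝ) ∧ Ψ (Ψinv y) = y) :
    Monotone (extendInverse Ψinv) := by
  intro x y hxy
  have hx := hinv (max x 0) (mem_Ici.2 (le_max_right _ _))
  have hy := hinv (max y 0) (mem_Ici.2 (le_max_right _ _))
  refine add_le_add ((hΨ.le_iff_le hx.1 hy.1).1 ?_) (min_le_min_right 0 hxy)
  rw [hx.2, hy.2]
  exact max_le_max_right 0 hxy

theorem extendInverse_continuous {Ψ Ψinv : ℝ → ℝ} (hΨ : StrictMonoOn Ψ (Ici 0)) (hΨ0 : Ψ 0 = 0)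
    (hinv : ∀ y ∈ Ici (0:ℝ), Ψinv y ∈ Ici (0:ℝ) ∧ Ψ (Ψinv y) = y)
    (hinv' : ∀ v ∈ Ici (0:ℝ), Ψinv (Ψ v) = v) :
    Continuous (extendInverse Ψinv) := by
  refine (extendInverse_monotone hΨ hinv).continuous_of_surjective fun t => ?_
  rcases le_total 0 t with ht | ht
  · refine ⟨Ψ t, ?_⟩
    rw [extendInverse_of_nonneg, hinv' t ht]
    rw [← hΨ0]
    exact hΨ.monotoneOn self_mem_Ici ht ht
  · refine ⟨t, ?_⟩
    have h0 := hinv' 0 self_mem_Ici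
    rw [hΨ0] at h0
    simp [extendInverse, ht, h0]

/-- Corollary 3.5(iii) / `cor-sub<sup` Part (iii): with
`H = ψ ∘ (Ψ|_{[0,∞)})⁻¹`, if `c₁ > c₂`, `c₁ ≥ 0`, `-μ ≤ a < b ≤ 1`,
`z₁ a ≤ z₂ a` and `z₁ > 0` on `(a,b)`, then `z₁ < z₂` on `(a,b]`. -/
theorem stmt_8
    (f : ℝ → ℝ) (μ : ℝ) (hμ : μ ∈ Ioo (-1:ℝ) 1)
    (hfLip : ∃ K : NNReal, LipschitzWith K f)
    (hfm1 : f (-1) = 0) (hfμ : f μ = 0) (hf1 : f 1 = 0)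
    (hfneg : ∀ s ∈ Ioo (-1:ℝ) μ, f s < 0)
    (hfpos : ∀ s ∈ Ioo μ (1:ℝ), 0 < f s)
    (hF : ∀ r ∈ Ioo (-1:ℝ) 1, 0 < ∫ s in r..(1:ℝ), f s)
    (Φ φ Ψ ψ Ψinv H : ℝ → ℝ)
    (hΦderiv : ∀ s, HasDerivAt Φ (φ s) s)
    (hΦeven : ∀ s, Φ (-s) = Φ s)
    (hΦ0 : Φ 0 = 0)
    (hΦconv : StrictConvexOn ℝ univ Φ)
    (hφodd : ∀ s, φ (-s) = - φ s)
    (hφmono : StrictMono φ)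
    (hφtop : Tendsto φ atTop atTop)
    (hφbot : Tendsto φ atBot atBot)
    (hΨ : ∀ t, Ψ t = ⨆ s : ℝ, (s * t - Φ s))
    (hΨderiv : ∀ t, HasDerivAt Ψ (ψ t) t)
    (hψφ : ∀ s, ψ (φ s) = s)
    (hφψ : ∀ t, φ (ψ t) = t)
    (hΨinv0 : ∀ y ∈ Ici (0:ℝ), Ψinv y ∈ Ici (0:ℝ) ∧ Ψ (Ψinv y) = y)
    (hΨinv1 : ∀ v ∈ Ici (0:ℝ), Ψinv (Ψ v) = v)
    (hH : ∀ y, H y = ψ (Ψinv y))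
    (c₁ c₂ : ℝ) (hc₁₂ : c₂ < c₁) (hc₁ : 0 ≤ c₁)
    (a b : ℝ) (hab : a < b) (ha : -μ ≤ a) (hb : b ≤ 1)
    (z₁ z₂ d₁ d₂ : ℝ → ℝ)
    (hd₁int : IntegrableOn d₁ (Icc a b))
    (hd₂int : IntegrableOn d₂ (Icc a b))
    (hz₁ : ∀ r ∈ Icc a b, z₁ r = z₁ a + ∫ s in a..r, d₁ s)
    (hz₂ : ∀ r ∈ Icc a b, z₂ r = z₂ a + ∫ s in a..r, d₂ s)
    (hd₁ : ∀ᵐ r ∂(volume.restrict (Ioo a b)), d₁ r = deriv z₁ r)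
    (hd₂ : ∀ᵐ r ∂(volume.restrict (Ioo a b)), d₂ r = deriv z₂ r)
    (hode₁ : ∀ᵐ r ∂(volume.restrict (Ioo a b)),
      d₁ r + c₁ * H (max (z₁ r) 0) = f (-r))
    (hode₂ : ∀ᵐ r ∂(volume.restrict (Ioo a b)),
      d₂ r + c₂ * H (max (z₂ r) 0) = f (-r))
    (hinit : z₁ a ≤ z₂ a)
    (hz₁pos : ∀ r ∈ Ioo a b, 0 < z₁ r) :
    ∀ r ∈ Ioc a b, z₁ r < z₂ r := by
  have hφ0 : φ 0 = 0 := by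
    have := hφodd 0
    rw [neg_zero] at this
    linarith
  have hψ0 : ψ 0 = 0 := by rw [← hφ0, hψφ, hφ0]
  have hψmono : StrictMono ψ := fun x y hxy => by
    rw [← hφmono.lt_iff_lt, hφψ, hφψ]
    exact hxy
  have hψcont : Continuous ψ :=
    hψmono.monotone.continuous_of_surjective fun s => ⟨φ s, hψφ s⟩
  have hΦnonneg : ∀ s, 0 ≤ Φ s := by
    intro s
    have := hΦconv.convexOn.2 (mem_univ s) (mem_univ (-s)) (show (0:ℝ) ≤ 1 / 2 by norm_num)
      (show (0:ℝ) ≤ 1 / 2 by norm_num) (by norm_num)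
    simp only [smul_eq_mul, hΦeven] at this
    rw [show (1 / 2 : ℝ) * s + 1 / 2 * -s = 0 by ring, hΦ0] at this
    linarith
  have hΨ0 : Ψ 0 = 0 := by
    rw [hΨ]
    refine le_antisymm (ciSup_le fun s => by linarith [hΦnonneg s]) ?_
    have hbdd : BddAbove (range fun s : ℝ => s * 0 - Φ s) :=
      ⟨0, by rintro _ ⟨s, rfl⟩; simpa using hΦnonneg s⟩
    simpa [hΦ0] using le_ciSup hbdd 0
  have hΨmono : StrictMonoOn Ψ (Ici 0) := by
    refine strictMonoOn_of_deriv_pos (convex_Ici 0)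
      (fun t _ => (hΨderiv t).continuousAt.continuousWithinAt) fun t ht => ?_
    rw [interior_Ici] at ht
    rw [(hΨderiv t).deriv, ← hψ0]
    exact hψmono ht
  set G := extendInverse Ψinv
  have hGmono : Monotone G := extendInverse_monotone hΨmono hΨinv0
  have hGcont : Continuous G := extendInverse_continuous hΨmono hΨ0 hΨinv0 hΨinv1
  have hHG : ∀ y, 0 ≤ y → H y = ψ (G y) := fun y hy => by
    rw [hH, show G y = Ψinv y from extendInverse_of_nonneg hy]
  have hHpos : ∀ y, 0 < y → 0 < H y := by
    intro y hy
    have hinv := hΨinv0 y hy.le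
    rw [hH, ← hψ0]
    refine hψmono (lt_of_le_of_ne hinv.1 fun h => hy.ne ?_)
    rw [← hinv.2, ← h, hΨ0]
  have hHmono : Monotone fun y => H (max y 0) := fun x y hxy => by
    simp only [hHG _ (le_max_right _ _)]
    exact hψmono.monotone (hGmono (max_le_max_right 0 hxy))
  have hHcont : Continuous fun y => H (max y 0) := by
    have : (fun y => H (max y 0)) = fun y => ψ (G (max y 0)) :=
      funext fun y => hHG _ (le_max_right _ _)
    rw [this]
    fun_prop
  have hGderiv : ∀ y, 0 < y → HasDerivAt G (H (max y 0))⁻¹ y := by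
    intro y hy
    rw [max_eq_left hy.le]
    refine HasDerivAt.of_local_left_inverse (f := Ψ) hGcont.continuousAt ?_ (hHpos y hy).ne' ?_
    · rw [hHG y hy.le]
      exact hΨderiv _
    · filter_upwards [lt_mem_nhds hy] with x hx
      rw [show G x = Ψinv x from extendInverse_of_nonneg hx.le]
      exact (hΨinv0 x hx.le).2
  have hfcont : Continuous f := hfLip.choose_spec.continuous
  have hz₁cont := continuousOn_of_eq_primitive hab hd₁int hz₁
  have hz₂cont := continuousOn_of_eq_primitive hab hd₂int hz₂
  have hderiv : ∀ {z d : ℝ → ℝ} {c : ℝ}, ContinuousOn z (Icc a b) →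
      (∀ r ∈ Icc a b, z r = z a + ∫ s in a..r, d s) →
      (∀ᵐ r ∂(volume.restrict (Ioo a b)), d r + c * H (max (z r) 0) = f (-r)) →
      ∀ r ∈ Ioo a b, HasDerivAt z (f (-r) - c * H (max (z r) 0)) r := by
    intro z d c hzcont hz hode r hr
    refine hasDerivAt_of_eq_primitive (g := fun r => f (-r) - c * H (max (z r) 0)) hz ?_ ?_ hr
    · exact (hfcont.comp continuous_neg).continuousOn.sub
        (continuousOn_const.mul (hHcont.comp_continuousOn hzcont))
    · filter_upwards [hode] with r hr
      linarith
  have hz₁deriv := hderiv hz₁cont hz₁ hode₁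
  have hz₂deriv := hderiv hz₂cont hz₂ hode₂
  have hle : ∀ r ∈ Icc a b, z₁ r ≤ z₂ r := by
    intro r hr
    refine sub_nonpos.1 (nonpos_of_deriv_nonpos_of_pos_s8 (w := fun r => z₁ r - z₂ r)
      (hz₁cont.sub hz₂cont) (fun r hr => (hz₁deriv r hr).sub (hz₂deriv r hr)) ?_
      (sub_nonpos.2 hinit) r hr)
    intro s _ hs
    have hmono := hHmono (sub_pos.1 hs).le
    have hnonneg : 0 ≤ H (max (z₂ s) 0) := by
      have hH0 : H 0 = 0 := by rw [hH, ← hΨ0, hΨinv1 0 self_mem_Ici, hψ0, hΨ0]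
      simpa [hH0] using hHmono (le_max_right (z₂ s) 0)
    simp only at hmono
    nlinarith [mul_le_mul_of_nonneg_left hmono hc₁, mul_le_mul_of_nonneg_right hc₁₂.le hnonneg]
  have hanti : AntitoneOn (fun r => G (z₁ r) - G (z₂ r) + (c₁ - c₂) * r) (Icc a b) := by
    have hg : ∀ r ∈ Ioo a b, HasDerivAt (fun r => G (z₁ r) - G (z₂ r) + (c₁ - c₂) * r)
        ((H (max (z₁ r) 0))⁻¹ * (f (-r) - c₁ * H (max (z₁ r) 0))
          - (H (max (z₂ r) 0))⁻¹ * (f (-r) - c₂ * H (max (z₂ r) 0)) + (c₁ - c₂) * 1) r := by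
      intro r hr
      have hpos₁ := hz₁pos r hr
      have hpos₂ := hpos₁.trans_le (hle r (Ioo_subset_Icc_self hr))
      exact (((hGderiv _ hpos₁).comp r (hz₁deriv r hr)).sub
        ((hGderiv _ hpos₂).comp r (hz₂deriv r hr))).add ((hasDerivAt_id r).const_mul _)
    refine antitoneOn_of_deriv_nonpos (convex_Icc a b) ?_ ?_ ?_
    · exact ((hGcont.comp_continuousOn hz₁cont).sub (hGcont.comp_continuousOn hz₂cont)).add
        (continuous_const.mul continuous_id).continuousOn
    · rw [interior_Icc]
      exact fun r hr => (hg r hr).differentiableAt.differentiableWithinAt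
    · rw [interior_Icc]
      intro r hr
      rw [(hg r hr).deriv]
      have hf : f (-r) < 0 := hfneg _ ⟨by linarith [hr.2], by linarith [hr.1]⟩
      have hmono := hHmono (hle r (Ioo_subset_Icc_self hr))
      have hpos : 0 < H (max (z₁ r) 0) := hHpos _ (lt_max_of_lt_left (hz₁pos r hr))
      simp only at hmono
      generalize H (max (z₁ r) 0) = h₁ at *
      generalize H (max (z₂ r) 0) = h₂ at *
      have hpos₂ : 0 < h₂ := hpos.trans_le hmono
      have hinv : h₂⁻¹ ≤ h₁⁻¹ := inv_anti₀ hpos hmono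
      have heq : h₁⁻¹ * (f (-r) - c₁ * h₁) - h₂⁻¹ * (f (-r) - c₂ * h₂) + (c₁ - c₂) * 1
          = f (-r) * (h₁⁻¹ - h₂⁻¹) := by
        field_simp
        ring
      rw [heq]
      exact mul_nonpos_of_nonpos_of_nonneg hf.le (sub_nonneg.2 hinv)
  intro r hr
  have hdecr := hanti (left_mem_Icc.2 hab.le) (Ioc_subset_Icc_self hr) hr.1.le
  simp only at hdecr
  refine hGmono.reflect_lt ?_
  nlinarith [hGmono hinit, mul_pos (sub_pos.2 hc₁₂) (sub_pos.2 hr.1)]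
end

section
/- Let f and φ = Φ' be as in the context and let [q, c] solve the travelling-wave problem: q ∈ C¹(ℝ), x ↦ φ(q'(x)) is differentiable with d/dx[φ(q'(x))] + c q'(x) + f(q(x)) = 0 on ℝ, q' ≤ 0, lim_{x→−∞} q(x) = 1, lim_{x→+∞} q(x) = −1. Then ∫_{−∞}^{∞} |q'(x)| dx = 2, q'(x) → 0 as x → ±∞, and c ∫_{−∞}^{∞} |q'(x)|² dx = ∫_{−1}^{1} f(s) ds = F(1). -/
open MeasureTheory Set Filter

/-- The chain rule `(p φ(p) - ∫₀ᵖ φ)' = p (φ(p))'` along a continuous curve `p`, for monotone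
`φ`; no differentiability of `p` is needed. -/
theorem hasDerivAt_mul_sub_integral_of_monotone {φ p : ℝ → ℝ} (hφ : Monotone φ)
    (hφc : Continuous φ) {x d : ℝ} (hp : ContinuousAt p x)
    (hd : HasDerivAt (fun y => φ (p y)) d x) :
    HasDerivAt (fun y => p y * φ (p y) - ∫ s in (0 : ℝ)..p y, φ s) (p x * d) x := by
  have key : ∀ a b : ℝ, |(b - a) * φ b - ∫ s in a..b, φ s| ≤ |(b - a) * (φ b - φ a)| := by
    intro a b
    have h1 : (b - a) * φ b - ∫ s in a..b, φ s = ∫ s in a..b, (φ b - φ s) := by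
      rw [intervalIntegral.integral_sub (by simp) (hφc.intervalIntegrable _ _)]
      simp
    rw [h1, ← Real.norm_eq_abs, abs_mul, mul_comm, abs_sub_comm b a, abs_sub_comm a b]
    refine intervalIntegral.norm_integral_le_of_norm_le_const fun s hs => ?_
    rw [Real.norm_eq_abs]
    rcases le_total a b with h | h
    · rw [uIoc_of_le h] at hs
      have := hφ hs.1.le
      have := hφ hs.2
      rw [abs_of_nonneg, abs_of_nonneg] <;> linarith
    · rw [uIoc_of_ge h] at hs
      have := hφ hs.1.le
      have := hφ hs.2
      rw [abs_of_nonpos, abs_of_nonpos] <;> linarith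
  rw [hasDerivAt_iff_isLittleO]
  have h1 : (fun y => (p y - p x) * (φ (p y) - φ (p x))) =o[nhds x] fun y => y - x := by
    have ha : (fun y => p y - p x) =o[nhds x] fun _ => (1 : ℝ) := by
      rw [Asymptotics.isLittleO_one_iff]
      simpa using hp.tendsto.sub_const (p x)
    simpa using ha.mul_isBigO hd.isBigO_sub
  have h2 : (fun y => p x * (φ (p y) - φ (p x) - (y - x) • d)) =o[nhds x] fun y => y - x :=
    (hasDerivAt_iff_isLittleO.1 hd).const_mul_left _
  have h3 : (fun y => (p y - p x) * φ (p y) - ∫ s in p x..p y, φ s)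
      =o[nhds x] fun y => y - x := by
    refine (Asymptotics.IsBigO.of_bound 1 (Eventually.of_forall fun y => ?_)).trans_isLittleO h1
    simpa only [one_mul, Real.norm_eq_abs] using key (p x) (p y)
  refine (h2.add h3).congr_left fun y => ?_
  rw [← intervalIntegral.integral_interval_sub_left (hφc.intervalIntegrable 0 (p y))
    (hφc.intervalIntegrable 0 (p x))]
  simp only [smul_eq_mul]
  ring

/-- Let `q` be monotone with a limit along `l`. If `φ ∘ q'` oscillates arbitrarily little on unit
intervals far out along `l`, then `q'` tends to `0`. -/
theorem tendsto_deriv_zero_of_oscillation {φ q : ℝ → ℝ} {l : Filter ℝ} {L : ℝ}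
    (hφ : StrictMono φ) (hq : Differentiable ℝ q) (hq' : ∀ x, deriv q x ≤ 0)
    (hl : Tendsto (fun x => x + 1) l l) (hL : Tendsto q l (nhds L))
    (hosc : ∀ η > 0, ∀ᶠ x in l, ∀ y ∈ Icc x (x + 1),
      φ (deriv q y) ≤ φ (deriv q x) + η) :
    Tendsto (deriv q) l (nhds 0) := by
  rw [Metric.tendsto_nhds]
  intro ε hε
  have hη : 0 < φ (-(ε / 2)) - φ (-ε) := sub_pos.2 (hφ (by linarith))
  have hdiff : Tendsto (fun x => q (x + 1) - q x) l (nhds 0) := by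
    simpa using (hL.comp hl).sub hL
  filter_upwards [hosc _ hη, hdiff.eventually (lt_mem_nhds (a := -(ε / 2)) (by linarith))]
    with x hx hx2
  rw [Real.dist_eq, sub_zero, abs_of_nonpos (hq' x)]
  by_contra! hc
  have hb : ∀ y ∈ interior (Icc x (x + 1)), deriv q y ≤ -(ε / 2) := fun y hy => by
    have h1 := hx y (interior_subset hy)
    have h2 : φ (deriv q x) ≤ φ (-ε) := hφ.monotone (by linarith)
    exact hφ.le_iff_le.1 (by linarith)
  have := (convex_Icc x (x + 1)).image_sub_le_mul_sub_of_deriv_le hq.continuous.continuousOn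
    hq.differentiableOn hb x (by simp) (x + 1) (by simp) (by simp)
  linarith

/-- A function whose derivative tends to `0` along `atTop` or `atBot` oscillates arbitrarily little
on unit intervals. -/
theorem eventually_oscillation_le {G g : ℝ → ℝ} {l : Filter ℝ}
    (hG : ∀ x, HasDerivAt G (g x) x)
    (hl : ∀ s ∈ l, ∀ᶠ x in l, Icc x (x + 1) ⊆ s) (hg : Tendsto g l (nhds 0)) :
    ∀ η > 0, ∀ᶠ x in l, ∀ y ∈ Icc x (x + 1), |G y - G x| ≤ η := by
  intro η hη
  have h := hl _ (hg (Metric.closedBall_mem_nhds 0 hη))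
  filter_upwards [h] with x hx y hy
  have := (convex_Icc x (x + 1)).norm_image_sub_le_of_norm_hasDerivWithin_le (C := η)
    (fun z _ => (hG z).hasDerivWithinAt) (fun z hz => by simpa using hx hz)
    (left_mem_Icc.2 (by linarith)) hy
  rw [Real.norm_eq_abs, Real.norm_eq_abs, abs_of_nonneg (sub_nonneg.2 hy.1)] at this
  nlinarith [hy.2]

theorem eventually_atTop_Icc_add_one_subset (s : Set ℝ) (hs : s ∈ (atTop : Filter ℝ)) :
    ∀ᶠ x in (atTop : Filter ℝ), Icc x (x + 1) ⊆ s := by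
  obtain ⟨a, ha⟩ := mem_atTop_sets.1 hs
  filter_upwards [eventually_ge_atTop a] with x hx y hy using ha y (hx.trans hy.1)

theorem eventually_atBot_Icc_add_one_subset (s : Set ℝ) (hs : s ∈ (atBot : Filter ℝ)) :
    ∀ᶠ x in (atBot : Filter ℝ), Icc x (x + 1) ⊆ s := by
  obtain ⟨a, ha⟩ := mem_atBot_sets.1 hs
  filter_upwards [eventually_le_atBot (a - 1)] with x hx y hy using ha y (by linarith [hy.2])

/-- The derivative of a decreasing travelling wave vanishes at an end where the wave converges to
a zero of `f`. -/
theorem tendsto_deriv_zero_of_travelling_wave {f φ q : ℝ → ℝ} {c L : ℝ} {l : Filter ℝ}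
    (hf : Continuous f) (hfL : f L = 0) (hφ : StrictMono φ) (hq : Differentiable ℝ q)
    (hode : ∀ x, HasDerivAt (fun y => φ (deriv q y)) (-(c * deriv q x + f (q x))) x)
    (hq' : ∀ x, deriv q x ≤ 0) (hl : ∀ s ∈ l, ∀ᶠ x in l, Icc x (x + 1) ⊆ s)
    (hL : Tendsto q l (nhds L)) :
    Tendsto (deriv q) l (nhds 0) := by
  have hl1 : Tendsto (fun x : ℝ => x + 1) l l := fun s hs => by
    rw [mem_map]
    filter_upwards [hl s hs] with x hx using hx (right_mem_Icc.2 (by linarith))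
  refine tendsto_deriv_zero_of_oscillation hφ hq hq' hl1 hL fun η hη => ?_
  have hG : ∀ x, HasDerivAt (fun y => φ (deriv q y) + c * q y) (-f (q x)) x := fun x =>
    ((hode x).add ((hq x).hasDerivAt.const_mul c)).congr_deriv (by ring)
  have hg : Tendsto (fun x => -f (q x)) l (nhds 0) := by
    simpa [hfL] using ((hf.tendsto L).comp hL).neg
  have hcq : Tendsto (fun x => |c| * |q (x + 1) - q x|) l (nhds 0) := by
    simpa using (((hL.comp hl1).sub hL).abs.const_mul |c|)
  filter_upwards [eventually_oscillation_le hG hl hg (η / 2) (half_pos hη),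
    hcq.eventually (gt_mem_nhds (half_pos hη))] with x hx hx2 y hy
  have hanti : Antitone q := antitone_of_deriv_nonpos hq hq'
  have h1 : |q y - q x| ≤ |q (x + 1) - q x| := by
    have := hanti hy.1
    have := hanti hy.2
    rw [abs_of_nonpos, abs_of_nonpos] <;> linarith
  have h2 : |c * (q y - q x)| ≤ |c| * |q (x + 1) - q x| := by
    rw [abs_mul]
    gcongr
  have h3 := (abs_le.1 (hx y hy)).2
  have h4 := (abs_le.1 h2).1
  linarith

/-- for any solution `[q, c]` of the travelling-wave problem
`d/dx [φ(q')] + c q' + f(q) = 0`, `q' ≤ 0`, `q(-∞) = 1`, `q(+∞) = -1`, one has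
`∫ |q'| = 2`, `q'(x) → 0` as `x → ±∞`, and
`c ∫ |q'|² = ∫_{-1}^{1} f(s) ds = F(1)`. -/
theorem stmt_17
    (f : ℝ → ℝ) (μ : ℝ) (hμ : μ ∈ Ioo (-1:ℝ) 1)
    (hfLip : ∃ K : NNReal, LipschitzWith K f)
    (hfm1 : f (-1) = 0) (hfμ : f μ = 0) (hf1 : f 1 = 0)
    (hfneg : ∀ s ∈ Ioo (-1:ℝ) μ, f s < 0)
    (hfpos : ∀ s ∈ Ioo μ (1:ℝ), 0 < f s)
    (hF : ∀ r ∈ Ioo (-1:ℝ) 1, 0 < ∫ s in r..(1:ℝ), f s)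
    (φ : ℝ → ℝ)
    (hφcont : Continuous φ)
    (hφodd : ∀ s, φ (-s) = - φ s)
    (hφmono : StrictMono φ)
    (q : ℝ → ℝ) (c : ℝ)
    (hq : ContDiff ℝ 1 q)
    (hode : ∀ x : ℝ,
      HasDerivAt (fun y => φ (deriv q y)) (-(c * deriv q x + f (q x))) x)
    (hq' : ∀ x : ℝ, deriv q x ≤ 0)
    (hqbot : Tendsto q atBot (nhds 1))
    (hqtop : Tendsto q atTop (nhds (-1))) :
    Integrable (deriv q) ∧
    (∫ x : ℝ, |deriv q x|) = 2 ∧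
    Tendsto (deriv q) atBot (nhds 0) ∧
    Tendsto (deriv q) atTop (nhds 0) ∧
    c * (∫ x : ℝ, (deriv q x) ^ 2) = ∫ s in (-1:ℝ)..(1:ℝ), f s := by
  obtain ⟨K, hK⟩ := hfLip
  have hf : Continuous f := hK.continuous
  have hqd : Differentiable ℝ q := hq.differentiable (by norm_num)
  have hqc : Continuous (deriv q) := hq.continuous_deriv le_rfl
  have hbot := tendsto_deriv_zero_of_travelling_wave hf hf1 hφmono hqd hode hq'
    eventually_atBot_Icc_add_one_subset hqbot
  have htop := tendsto_deriv_zero_of_travelling_wave hf hfm1 hφmono hqd hode hq'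
    eventually_atTop_Icc_add_one_subset hqtop
  have hint : Integrable (deriv q) := by
    rw [← integrableOn_univ, ← Iic_union_Ioi (a := (0 : ℝ))]
    refine IntegrableOn.union ?_ ?_
    · have h : IntegrableOn (fun x => -deriv q (-x)) (Ioi 0) :=
        integrableOn_Ioi_deriv_of_nonneg' (g := fun x => q (-x))
          (fun x _ => (((hqd (-x)).hasDerivAt.comp x (hasDerivAt_neg x)).congr_deriv (by ring)))
          (fun x _ => neg_nonneg.2 (hq' _)) (hqbot.comp tendsto_neg_atTop_atBot)
      have h' : IntegrableOn (fun x => deriv q (-x)) (Ioi (-0)) := by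
        simpa [IntegrableOn] using h.neg
      simpa [integrableOn_Iic_iff_integrableOn_Iio] using h'.comp_neg_Iio
    · exact integrableOn_Ioi_deriv_of_nonpos' (fun x _ => (hqd x).hasDerivAt)
        (fun x _ => hq' x) hqtop
  refine ⟨hint, ?_, hbot, htop, ?_⟩
  · simp_rw [fun x => abs_of_nonpos (hq' x)]
    rw [integral_neg, integral_of_hasDerivAt_of_tendsto (fun x => (hqd x).hasDerivAt) hint
      hqbot hqtop]
    norm_num
  · obtain ⟨C, hC⟩ : ∃ C, ∀ x, ‖deriv q x‖ ≤ C := by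
      let g : ZeroAtInftyContinuousMap ℝ ℝ :=
        { toFun := deriv q
          continuous_toFun := hqc
          zero_at_infty' := by
            rw [cocompact_eq_atBot_atTop]
            exact hbot.sup htop }
      exact ⟨‖g.toBCF‖, g.toBCF.norm_coe_le_norm⟩
    have hint2 : Integrable fun x => deriv q x ^ 2 := by
      simp_rw [sq]
      exact hint.bdd_mul hqc.aestronglyMeasurable (Eventually.of_forall hC)
    have hder : ∀ x, HasDerivAt (fun y => (deriv q y * φ (deriv q y)
        - ∫ s in (0 : ℝ)..deriv q y, φ s) + ∫ s in (-1 : ℝ)..q y, f s)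
        (-(c * deriv q x ^ 2)) x := fun x => by
      have h1 := hasDerivAt_mul_sub_integral_of_monotone hφmono.monotone hφcont
        hqc.continuousAt (hode x)
      have h2 := ((hf.integral_hasStrictDerivAt (-1) (q x)).hasDerivAt).comp x
        (hqd x).hasDerivAt
      exact (h1.add h2).congr_deriv (by ring)
    have hlim : ∀ {l : Filter ℝ} {L : ℝ}, Tendsto (deriv q) l (nhds 0) →
        Tendsto q l (nhds L) → Tendsto (fun y => (deriv q y * φ (deriv q y)
          - ∫ s in (0 : ℝ)..deriv q y, φ s) + ∫ s in (-1 : ℝ)..q y, f s) l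
          (nhds (∫ s in (-1 : ℝ)..L, f s)) := fun {l L} h0 hL => by
      have hΦ : Continuous fun p => p * φ p - ∫ s in (0 : ℝ)..p, φ s :=
        (continuous_id.mul hφcont).sub
          (intervalIntegral.continuous_primitive (fun a b => hφcont.intervalIntegrable a b) 0)
      have hFc : Continuous fun r => ∫ s in (-1 : ℝ)..r, f s :=
        intervalIntegral.continuous_primitive (fun a b => hf.intervalIntegrable a b) (-1)
      simpa using ((hΦ.tendsto 0).comp h0).add ((hFc.tendsto L).comp hL)
    have := integral_of_hasDerivAt_of_tendsto hder (hint2.const_mul c).neg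
      (hlim hbot hqbot) (hlim htop hqtop)
    rw [integral_neg, integral_const_mul, intervalIntegral.integral_same] at this
    linarith
end

section
/- Let c ≤ 0 and let z : [−1,1] → ℝ be any absolutely continuous solution of z'(r) + c H(z(r)⁺) = f(−r) for a.e. r ∈ (−1,1) with z(−1) = 0. Then z(r) ≥ ∫_{−1}^{r} f(−s) ds = F(1) − F(−r) > 0 for every r ∈ (−1,1); moreover, if F(1) > 0 then z(1) ≥ F(1) > 0. -/
open MeasureTheory Set Filter

/-- for `c ≤ 0`, any absolutely continuous solution of
`z' + c H(z⁺) = f(-r)` on `(-1,1)` with `z(-1) = 0` satisfies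
`z r ≥ ∫_{-1}^r f(-s) ds = F(1) - F(-r) > 0` on `(-1,1)`, and if moreover
`F(1) > 0` then `z 1 ≥ F(1) > 0`. -/
theorem stmt_18
    (H : ℝ → ℝ)
    (hHcont : ContinuousOn H (Ici 0))
    (hHmono : StrictMonoOn H (Ici 0))
    (hH0 : H 0 = 0)
    (f : ℝ → ℝ) (μ : ℝ) (hμ : μ ∈ Ioo (-1:ℝ) 1)
    (hfLip : ∃ K : NNReal, LipschitzWith K f)
    (hfm1 : f (-1) = 0) (hfμ : f μ = 0) (hf1 : f 1 = 0)
    (hfneg : ∀ s ∈ Ioo (-1:ℝ) μ, f s < 0)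
    (hfpos : ∀ s ∈ Ioo μ (1:ℝ), 0 < f s)
    (hF : ∀ r ∈ Ioo (-1:ℝ) 1, 0 < ∫ s in r..(1:ℝ), f s)
    (c : ℝ) (hc : c ≤ 0)
    (z d : ℝ → ℝ)
    (hdint : IntegrableOn d (Icc (-1:ℝ) 1))
    (hz : ∀ r ∈ Icc (-1:ℝ) 1, z r = z (-1) + ∫ s in (-1:ℝ)..r, d s)
    (hd : ∀ᵐ r ∂(volume.restrict (Ioo (-1:ℝ) 1)), d r = deriv z r)
    (hode : ∀ᵐ r ∂(volume.restrict (Ioo (-1:ℝ) 1)),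
      d r + c * H (max (z r) 0) = f (-r))
    (hz0 : z (-1) = 0) :
    (∀ r ∈ Ioo (-1:ℝ) 1,
      (∫ s in (-1:ℝ)..r, f (-s)) ≤ z r ∧
      (∫ s in (-1:ℝ)..r, f (-s)) = (∫ s in (-r)..(1:ℝ), f s) ∧
      0 < ∫ s in (-1:ℝ)..r, f (-s)) ∧
    (0 < (∫ s in (-1:ℝ)..(1:ℝ), f s) →
      (∫ s in (-1:ℝ)..(1:ℝ), f s) ≤ z 1) := by
  obtain ⟨K, hK⟩ := hfLip
  have hcont : Continuous fun s => f (-s) := hK.continuous.comp continuous_neg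
  have hle : ∀ᵐ s ∂(volume.restrict (Icc (-1:ℝ) 1)), f (-s) ≤ d s := by
    rw [← restrict_Ioo_eq_restrict_Icc]
    filter_upwards [hode] with s hs
    have hH : 0 ≤ H (max (z s) 0) :=
      hH0.ge.trans <| hHmono.monotoneOn self_mem_Ici (mem_Ici.2 (le_max_right _ _))
        (le_max_right _ _)
    linarith [mul_nonpos_of_nonpos_of_nonneg hc hH]
  have hlower : ∀ r ∈ Icc (-1:ℝ) 1, (∫ s in (-1:ℝ)..r, f (-s)) ≤ z r := by
    intro r hr
    have hsub : Icc (-1:ℝ) r ⊆ Icc (-1) 1 := Icc_subset_Icc_right hr.2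
    rw [hz r hr, hz0, zero_add]
    refine intervalIntegral.integral_mono_ae_restrict hr.1 (hcont.intervalIntegrable _ _) ?_
      (ae_restrict_of_ae_restrict_of_subset hsub hle)
    rw [intervalIntegrable_iff_integrableOn_Icc_of_le hr.1]
    exact hdint.mono_set hsub
  have hreflect : ∀ r : ℝ, (∫ s in (-1:ℝ)..r, f (-s)) = ∫ s in (-r)..(1:ℝ), f s := by
    intro r
    rw [intervalIntegral.integral_comp_neg, neg_neg]
  refine ⟨fun r hr => ⟨hlower r (Ioo_subset_Icc_self hr), hreflect r, ?_⟩, fun _ => ?_⟩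
  · rw [hreflect]
    exact hF (-r) ⟨by linarith [hr.2], by linarith [hr.1]⟩
  · rw [← hreflect 1]
    exact hlower 1 (right_mem_Icc.2 (by norm_num))
end

section
/- Let c > 0 and let z_c : [−1,1] → ℝ be the unique absolutely continuous solution of the initial value problem z'(r) + c H(z(r)⁺) = f(−r) for a.e. r ∈ (−1,1), z(−1) = 0. Then z_c(r) > 0 for every r ∈ (−1, −μ). -/
open MeasureTheory Set Filter

/-- At a point with positive derivative, the function takes strictly smaller values just to the
left. -/
lemma HasDerivAt.eventually_lt_nhdsLT {z : ℝ → ℝ} {m v : ℝ} (h : HasDerivAt z v m) (hv : 0 < v) :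
    ∀ᶠ x in nhdsWithin m (Iio m), z x < z m := by
  have hs : ∀ᶠ x in nhdsWithin m (Iio m), 0 < slope z m x :=
    ((hasDerivAt_iff_tendsto_slope.1 h).mono_left
      (nhdsWithin_mono m fun x (hx : x < m) => hx.ne)).eventually (lt_mem_nhds hv)
  filter_upwards [hs, self_mem_nhdsWithin] with x hx hxm
  have hxm' : x - m < 0 := sub_neg.2 hxm
  rw [slope_def_field] at hx
  rcases div_pos_iff.1 hx with h' | h' <;> linarith

/-- A continuous function on `[a, b]` starting at `0`, whose derivative is positive at every point
where the function is nonpositive, is positive on `(a, b)`. -/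
lemma pos_of_deriv_pos_of_nonpos {z g : ℝ → ℝ} {a b : ℝ} (hz : ContinuousOn z (Icc a b))
    (ha : z a = 0) (hderiv : ∀ r ∈ Ioo a b, HasDerivAt z (g r) r)
    (hg : ∀ r ∈ Ioo a b, z r ≤ 0 → 0 < g r) : ∀ r ∈ Ioo a b, 0 < z r := by
  intro r hr
  by_contra! hzr
  obtain ⟨m, hm, hzm, hmin⟩ : ∃ m ∈ Ioc a r, z m ≤ 0 ∧ ∀ x ∈ Icc a r, z m ≤ z x := by
    obtain ⟨m, hm, hmin⟩ := isCompact_Icc.exists_isMinOn (nonempty_Icc.2 hr.1.le)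
      (hz.mono (Icc_subset_Icc_right hr.2.le))
    have hmin' : ∀ x ∈ Icc a r, z m ≤ z x := fun x hx => hmin hx
    rcases hm.1.eq_or_lt with rfl | ham
    · exact ⟨r, ⟨hr.1, le_rfl⟩, hzr, fun x hx => by linarith [hmin' x hx]⟩
    · exact ⟨m, ⟨ham, hm.2⟩, (hmin' r ⟨hr.1.le, le_rfl⟩).trans hzr, hmin'⟩
  have hmI : m ∈ Ioo a b := ⟨hm.1, hm.2.trans_lt hr.2⟩
  obtain ⟨x, hx, hxa⟩ := (((hderiv m hmI).eventually_lt_nhdsLT (hg m hmI hzm)).and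
    (Ioo_mem_nhdsLT hm.1)).exists
  exact (hmin x ⟨hxa.1.le, hxa.2.le.trans hm.2⟩).not_gt hx

/-- for `c > 0`, the unique absolutely continuous solution
`z_c` of `z' + c H(z⁺) = f(-r)` on `(-1,1)` with `z(-1) = 0` is strictly
positive on `(-1, -μ)`. -/
theorem stmt_19
    (H : ℝ → ℝ)
    (hHcont : ContinuousOn H (Ici 0))
    (hHmono : StrictMonoOn H (Ici 0))
    (hH0 : H 0 = 0)
    (f : ℝ → ℝ) (μ : ℝ) (hμ : μ ∈ Ioo (-1:ℝ) 1)
    (hfLip : ∃ K : NNReal, LipschitzWith K f)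
    (hfm1 : f (-1) = 0) (hfμ : f μ = 0) (hf1 : f 1 = 0)
    (hfneg : ∀ s ∈ Ioo (-1:ℝ) μ, f s < 0)
    (hfpos : ∀ s ∈ Ioo μ (1:ℝ), 0 < f s)
    (hF : ∀ r ∈ Ioo (-1:ℝ) 1, 0 < ∫ s in r..(1:ℝ), f s)
    (c : ℝ) (hc : 0 < c)
    (z d : ℝ → ℝ)
    (hdint : IntegrableOn d (Icc (-1:ℝ) 1))
    (hz : ∀ r ∈ Icc (-1:ℝ) 1, z r = z (-1) + ∫ s in (-1:ℝ)..r, d s)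
    (hd : ∀ᵐ r ∂(volume.restrict (Ioo (-1:ℝ) 1)), d r = deriv z r)
    (hode : ∀ᵐ r ∂(volume.restrict (Ioo (-1:ℝ) 1)),
      d r + c * H (max (z r) 0) = f (-r))
    (hz0 : z (-1) = 0) :
    ∀ r ∈ Ioo (-1:ℝ) (-μ), 0 < z r := by
  obtain ⟨K, hK⟩ := hfLip
  have hzI : ∀ r ∈ Icc (-1:ℝ) 1, z r = ∫ s in (-1:ℝ)..r, d s := fun r hr => by
    rw [hz r hr, hz0, zero_add]
  have huIcc : uIcc (-1:ℝ) 1 = Icc (-1) 1 := uIcc_of_le (by norm_num)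
  have hzcont : ContinuousOn z (Icc (-1) 1) := by
    have := intervalIntegral.continuousOn_primitive_interval (huIcc ▸ hdint)
    rw [huIcc] at this
    exact this.congr hzI
  set g : ℝ → ℝ := fun s => f (-s) - c * H (max (z s) 0) with hg
  have hgcont : ContinuousOn g (Icc (-1) 1) :=
    (hK.continuous.comp continuous_neg).continuousOn.sub
      (continuousOn_const.mul (hHcont.comp (hzcont.sup continuousOn_const)
        fun s _ => le_max_right (z s) 0))
  have hdg : ∀ᵐ s ∂(volume.restrict (Icc (-1:ℝ) 1)), d s = g s := by
    rw [← restrict_Ioo_eq_restrict_Icc]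
    filter_upwards [hode] with s hs
    simp only [hg]
    linarith
  have hzg : ∀ r ∈ Icc (-1:ℝ) 1, z r = ∫ s in (-1:ℝ)..r, g s := fun r hr => by
    rw [hzI r hr]
    refine intervalIntegral.integral_congr_ae_restrict ?_
    rw [uIoc_of_le hr.1]
    exact ae_restrict_of_ae_restrict_of_subset
      (Ioc_subset_Icc_self.trans (Icc_subset_Icc_right hr.2)) hdg
  have hzderiv : ∀ r ∈ Ioo (-1:ℝ) 1, HasDerivAt z (g r) r := fun r hr => by
    have hint : IntervalIntegrable g volume (-1) r :=
      (hgcont.mono (by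
        rw [uIcc_of_le hr.1.le]; exact Icc_subset_Icc_right hr.2.le)).intervalIntegrable
    refine (intervalIntegral.integral_hasDerivAt_right hint
      ((hgcont.mono Ioo_subset_Icc_self).stronglyMeasurableAtFilter isOpen_Ioo r hr)
      (hgcont.continuousAt (Icc_mem_nhds hr.1 hr.2))).congr_of_eventuallyEq ?_
    filter_upwards [Icc_mem_nhds hr.1 hr.2] with s hs using hzg s hs
  have hμ1 : -μ ≤ 1 := by linarith [hμ.1]
  refine pos_of_deriv_pos_of_nonpos (g := g) (hzcont.mono (Icc_subset_Icc_right hμ1)) hz0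
    (fun r hr => hzderiv r (Ioo_subset_Ioo_right hμ1 hr)) fun r hr hzr => ?_
  simp only [hg, max_eq_right hzr, hH0, mul_zero, sub_zero]
  exact hfpos (-r) ⟨by linarith [hr.2], by linarith [hr.1]⟩
end
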